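/- Let p, p₁, p₂ ∈ (1,∞) satisfy 1/p = 1/p₁ + 1/p₂. There is a constant C = C(p,p₁,p₂) such that for every bounded function φ : ℝ² → ℂ whose partial derivatives ∂^α φ of all orders |α| ≤ 7 exist on ℝ² ∖ {0} and satisfy A := sup_{|α|≤7} sup_{ξ∈ℝ²∖{0}} |ξ|^{|α|} |∂^α φ(ξ)| < ∞, and for all f, g ∈ 𝒮(ℝ), the function x ↦ ∫_{ℝ}∫_{ℝ} φ(ξ₁, ξ₂) 𝓕f(ξ₁) 𝓕g(ξ₂) e^{2π i x(ξ₁+ξ₂)} dξ₁ dξ₂ has L^p(ℝ) norm at most C · A · ‖f‖_{L^{p₁}(ℝ)} ‖g‖_{L^{p₂}(ℝ)}. -/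

import Mathlib

open MeasureTheory Real
open scoped ENNReal NNReal

/-- The Fourier transform on `ℝ`: `𝓕f(ξ) = ∫ f(x) e^{-2πi xξ} dx`. -/
noncomputable def FtR1 (f : ℝ → ℂ) (ξ : ℝ) : ℂ :=
  ∫ x : ℝ, f x * Complex.exp (-(2 * Real.pi * Complex.I) * (x : ℂ) * (ξ : ℂ))

/-- First partial derivative of a function of two real variables. -/
noncomputable def pd1 (m : ℝ → ℝ → ℂ) : ℝ → ℝ → ℂ := fun x y => deriv (fun t => m t y) x

/-- Second partial derivative of a function of two real variables. -/
noncomputable def pd2 (m : ℝ → ℝ → ℂ) : ℝ → ℝ → ℂ := fun x y => deriv (fun t => m x t) y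

/-- The mixed partial derivative `∂₁^a ∂₂^b m`. -/
noncomputable def mpd (a b : ℕ) (m : ℝ → ℝ → ℂ) : ℝ → ℝ → ℂ :=
  pd1^[a] (pd2^[b] m)

namespace CoifmanMeyer

open Set

/-- The uncentred Hardy–Littlewood maximal function on `ℝ`. -/
noncomputable def maxFn (f : ℝ → ℝ≥0∞) (x : ℝ) : ℝ≥0∞ :=
  ⨆ (a : ℝ) (b : ℝ) (_ : x ∈ Ioo a b), (∫⁻ y in Ioo a b, f y) / ENNReal.ofReal (b - a)

lemma lt_maxFn_iff {f : ℝ → ℝ≥0∞} {x : ℝ} {t : ℝ≥0∞} :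
    t < maxFn f x ↔ ∃ a b, x ∈ Ioo a b ∧
      t < (∫⁻ y in Ioo a b, f y) / ENNReal.ofReal (b - a) := by
  simp only [maxFn, lt_iSup_iff, exists_prop]

lemma isOpen_lt_maxFn (f : ℝ → ℝ≥0∞) (t : ℝ≥0∞) : IsOpen {x | t < maxFn f x} := by
  rw [isOpen_iff_forall_mem_open]
  intro x hx
  obtain ⟨a, b, hab, h⟩ := lt_maxFn_iff.1 hx
  exact ⟨Ioo a b, fun y hy => lt_maxFn_iff.2 ⟨a, b, hy, h⟩, isOpen_Ioo, hab⟩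

lemma measurable_maxFn (f : ℝ → ℝ≥0∞) : Measurable (maxFn f) :=
  measurable_of_Ioi fun t => (isOpen_lt_maxFn f t).measurableSet

lemma setLIntegral_Ioo_le_maxFn (f : ℝ → ℝ≥0∞) {a b x : ℝ} (hx : x ∈ Ioo a b) :
    ∫⁻ y in Ioo a b, f y ≤ maxFn f x * ENNReal.ofReal (b - a) := by
  have h0 : 0 < b - a := by linarith [hx.1, hx.2]
  have h : (∫⁻ y in Ioo a b, f y) / ENNReal.ofReal (b - a) ≤ maxFn f x := by
    unfold maxFn
    exact le_iSup_of_le a (le_iSup_of_le b (le_iSup_of_le hx le_rfl))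
  rwa [ENNReal.div_le_iff (by simpa using h0) ENNReal.ofReal_ne_top] at h

lemma setLIntegral_Icc_le_maxFn (f : ℝ → ℝ≥0∞) {a b x : ℝ} (hab : a < b) (hx : x ∈ Icc a b) :
    ∫⁻ y in Ioo a b, f y ≤ maxFn f x * ENNReal.ofReal (b - a) := by
  by_cases hM : maxFn f x = ∞
  · rw [hM, ENNReal.top_mul (by simpa using hab)]; exact le_top
  have key : ∀ ε : ℝ, 0 < ε →
      ∫⁻ y in Ioo a b, f y ≤ maxFn f x * ENNReal.ofReal (b - a + 2 * ε) := by
    intro ε hε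
    have h1 : x ∈ Ioo (a - ε) (b + ε) := ⟨by linarith [hx.1], by linarith [hx.2]⟩
    refine (lintegral_mono_set (Ioo_subset_Ioo ?_ ?_)).trans
      ((setLIntegral_Ioo_le_maxFn f h1).trans_eq ?_)
    · linarith
    · linarith
    · congr 2; ring
  have hc : Filter.Tendsto (fun ε : ℝ => maxFn f x * ENNReal.ofReal (b - a + 2 * ε))
      (nhdsWithin 0 (Ioi 0)) (nhds (maxFn f x * ENNReal.ofReal (b - a))) := by
    refine ENNReal.Tendsto.const_mul ?_ (Or.inr hM)
    refine (ENNReal.continuous_ofReal.tendsto _).comp ?_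
    have : Filter.Tendsto (fun ε : ℝ => b - a + 2 * ε) (nhds 0) (nhds (b - a + 2 * 0)) :=
      (by fun_prop : Continuous fun ε : ℝ => b - a + 2 * ε).tendsto _
    simpa using this.mono_left nhdsWithin_le_nhds
  refine ge_of_tendsto hc ?_
  filter_upwards [self_mem_nhdsWithin] with ε hε using key ε hε

lemma maxFn_le_of_le {f : ℝ → ℝ≥0∞} {K : ℝ≥0∞} (hf : ∀ x, f x ≤ K) (x : ℝ) :
    maxFn f x ≤ K := by
  unfold maxFn
  refine iSup_le fun a => iSup_le fun b => iSup_le fun h => ?_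
  refine ENNReal.div_le_of_le_mul ?_
  calc ∫⁻ y in Ioo a b, f y ≤ ∫⁻ _ in Ioo a b, K := lintegral_mono fun y => hf y
    _ = K * ENNReal.ofReal (b - a) := by simp

lemma le_maxFn_of_continuous {f : ℝ → ℝ≥0∞} (hf : Continuous f) (x : ℝ) : f x ≤ maxFn f x := by
  refine le_of_forall_lt fun t ht => ?_
  obtain ⟨t', h1, h2⟩ := exists_between ht
  have : {y | t' < f y} ∈ nhds x := (isOpen_lt continuous_const hf).mem_nhds h2
  obtain ⟨ε, hε, hs⟩ := Metric.mem_nhds_iff.1 this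
  rw [Real.ball_eq_Ioo] at hs
  refine lt_maxFn_iff.2 ⟨x - ε, x + ε, ⟨by linarith, by linarith⟩, h1.trans_le ?_⟩
  rw [ENNReal.le_div_iff_mul_le (Or.inl (by simp; linarith)) (Or.inl ENNReal.ofReal_ne_top)]
  calc t' * ENNReal.ofReal (x + ε - (x - ε)) = ∫⁻ _ in Ioo (x - ε) (x + ε), t' := by simp
    _ ≤ _ := setLIntegral_mono_ae' measurableSet_Ioo
      (Filter.Eventually.of_forall fun y hy => (hs hy).le)

/-- Weak type `(1,1)` bound for the maximal function. -/
lemma measure_lt_maxFn_le (f : ℝ → ℝ≥0∞) {t : ℝ≥0∞} (ht : t ≠ ∞) :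
    t * volume {x | t < maxFn f x} ≤ 5 * ∫⁻ x, f x := by
  by_cases hI : ∫⁻ x, f x = ∞
  · simp [hI]
  rcases eq_or_ne t 0 with rfl | ht0
  · simp
  let T : Set (ℝ × ℝ) := {q | 0 < q.2 ∧
    t < (∫⁻ y in Ioo (q.1 - q.2) (q.1 + q.2), f y) / ENNReal.ofReal (2 * q.2)}
  have hT : ∀ q ∈ T, t * ENNReal.ofReal (2 * q.2) ≤ ∫⁻ y in Ioo (q.1 - q.2) (q.1 + q.2), f y := by
    intro q hq
    have := hq.2.le
    rwa [ENNReal.le_div_iff_mul_le (Or.inl (by simpa using hq.1))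
      (Or.inl ENNReal.ofReal_ne_top)] at this
  have hR : ∀ q ∈ T, q.2 ≤ ((∫⁻ x, f x) / t).toReal := by
    intro q hq
    have h1 : t * ENNReal.ofReal (2 * q.2) ≤ ∫⁻ x, f x :=
      (hT q hq).trans (setLIntegral_le_lintegral _ _)
    have h2 : ENNReal.ofReal (2 * q.2) ≤ (∫⁻ x, f x) / t := by
      rw [ENNReal.le_div_iff_mul_le (Or.inl ht0) (Or.inl ht), mul_comm]; exact h1
    have h3 := (ENNReal.ofReal_le_iff_le_toReal (ENNReal.div_ne_top hI ht0)).1 h2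
    linarith [hq.1]
  obtain ⟨u, huT, hud, huc⟩ := Vitali.exists_disjoint_subfamily_covering_enlargement_closedBall
    T (fun q => q.1) (fun q => q.2) _ hR 5 (by norm_num)
  have hucount : u.Countable := by
    refine hud.countable_of_nonempty_interior fun q hq => ?_
    rw [interior_closedBall _ (huT hq).1.ne']
    exact ⟨q.1, Metric.mem_ball_self (huT hq).1⟩
  have hcov : {x | t < maxFn f x} ⊆ ⋃ q ∈ u, Metric.closedBall q.1 (5 * q.2) := by
    intro x hx
    obtain ⟨a, b, hab, h⟩ := lt_maxFn_iff.1 hx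
    have hlt : a < b := hab.1.trans hab.2
    have hq : ((a + b) / 2, (b - a) / 2) ∈ T := by
      refine ⟨by simp; linarith, ?_⟩
      have e1 : (a + b) / 2 - (b - a) / 2 = a := by ring
      have e2 : (a + b) / 2 + (b - a) / 2 = b := by ring
      have e3 : 2 * ((b - a) / 2) = b - a := by ring
      simpa only [e1, e2, e3] using h
    obtain ⟨q, hqu, hsub⟩ := huc _ hq
    refine mem_biUnion hqu (hsub ?_)
    rw [Metric.mem_closedBall, Real.dist_eq, abs_le]
    constructor <;> simp only <;> linarith [hab.1, hab.2]
  have := hucount.to_subtype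
  calc t * volume {x | t < maxFn f x}
      ≤ t * ∑' q : u, volume (Metric.closedBall q.1.1 (5 * q.1.2)) := by
        gcongr
        exact (measure_mono hcov).trans (measure_biUnion_le _ hucount _)
    _ = ∑' q : u, 5 * (t * ENNReal.ofReal (2 * q.1.2)) := by
        rw [← ENNReal.tsum_mul_left]
        congr 1; ext q
        rw [Real.volume_closedBall, show 2 * (5 * q.1.2) = 5 * (2 * q.1.2) by ring,
          ENNReal.ofReal_mul (by norm_num)]
        simp only [ENNReal.ofReal_ofNat]; ring
    _ ≤ ∑' q : u, 5 * ∫⁻ y in Metric.closedBall q.1.1 q.1.2, f y := by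
        refine ENNReal.tsum_le_tsum fun q => ?_
        gcongr
        refine (hT q.1 (huT q.2)).trans (lintegral_mono_set ?_)
        rw [Real.closedBall_eq_Icc]; exact Ioo_subset_Icc_self
    _ = 5 * ∫⁻ y in ⋃ q ∈ u, Metric.closedBall q.1 q.2, f y := by
        rw [ENNReal.tsum_mul_left, lintegral_biUnion hucount
          (fun q _ => Metric.isClosed_closedBall.measurableSet) hud]
    _ ≤ 5 * ∫⁻ x, f x := by gcongr; exact Measure.restrict_le_self

lemma measure_lt_maxFn_le_truncated (f : ℝ → ℝ≥0∞) {t : ℝ≥0∞} (ht : t ≠ ∞) :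
    t * volume {x | t < maxFn f x} ≤ 10 * ∫⁻ x in {x | t / 2 < f x}, f x := by
  classical
  let g : ℝ → ℝ≥0∞ := fun x => if t / 2 < f x then f x else 0
  have hsub : {x | t < maxFn f x} ⊆ {x | t / 2 < maxFn g x} := by
    intro x hx
    obtain ⟨a, b, hab, h⟩ := lt_maxFn_iff.1 hx
    refine lt_maxFn_iff.2 ⟨a, b, hab, ?_⟩
    have hlt : 0 < b - a := by linarith [hab.1, hab.2]
    have h1 : (∫⁻ y in Ioo a b, f y) / ENNReal.ofReal (b - a) ≤
        (∫⁻ y in Ioo a b, g y) / ENNReal.ofReal (b - a) + t / 2 := by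
      have : ∫⁻ y in Ioo a b, f y ≤ (∫⁻ y in Ioo a b, g y) + t / 2 * ENNReal.ofReal (b - a) := by
        calc ∫⁻ y in Ioo a b, f y ≤ ∫⁻ y in Ioo a b, (g y + t / 2) := by
              refine lintegral_mono fun y => ?_
              by_cases hy : t / 2 < f y
              · simp [g, hy]
              · simp only [g, hy, if_false, zero_add]; exact not_lt.1 hy
          _ = _ := by rw [lintegral_add_right _ measurable_const]; simp
      calc _ ≤ ((∫⁻ y in Ioo a b, g y) + t / 2 * ENNReal.ofReal (b - a))
              / ENNReal.ofReal (b - a) := by gcongr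
        _ = _ := by
          rw [ENNReal.add_div, ENNReal.mul_div_cancel_right (by simpa using hlt)
            ENNReal.ofReal_ne_top]
    by_contra hcon
    have h2 := h.trans_le (h1.trans (add_le_add_left (not_lt.1 hcon) _))
    simp at h2
  have h3 := measure_lt_maxFn_le g (t := t / 2) (ENNReal.div_ne_top ht (by simp))
  have h4 : ∫⁻ x, g x ≤ ∫⁻ x in {x | t / 2 < f x}, f x := by
    calc ∫⁻ x, g x = ∫⁻ x, ({x | t / 2 < f x}).indicator f x := by
          congr 1; ext x; by_cases h : t / 2 < f x <;> simp [g, h]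
      _ ≤ _ := lintegral_indicator_le _ _
  calc t * volume {x | t < maxFn f x} = 2 * (t / 2 * volume {x | t < maxFn f x}) := by
        rw [← mul_assoc, ENNReal.mul_div_cancel (by simp) (by simp)]
    _ ≤ 2 * (5 * ∫⁻ x in {x | t / 2 < f x}, f x) := by
        refine mul_le_mul_right ?_ 2
        exact (mul_le_mul_right (measure_mono hsub) _).trans (h3.trans (mul_le_mul_right h4 5))
    _ = _ := by rw [← mul_assoc]; norm_num

/-- Layer cake formula for finite `ℝ≥0∞`-valued functions. -/
lemma lintegral_rpow_eq_layer {F : ℝ → ℝ≥0∞} (hF : Measurable F) (hfin : ∀ x, F x ≠ ∞)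
    {q : ℝ} (hq : 0 < q) :
    ∫⁻ x, F x ^ q = ENNReal.ofReal q *
      ∫⁻ t in Ioi (0 : ℝ), volume {x | ENNReal.ofReal t < F x} * ENNReal.ofReal (t ^ (q - 1)) := by
  have h := lintegral_rpow_eq_lintegral_meas_lt_mul (volume : Measure ℝ)
    (f := fun x => (F x).toReal) (Filter.Eventually.of_forall fun x => ENNReal.toReal_nonneg)
    hF.ennreal_toReal.aemeasurable hq
  calc ∫⁻ x, F x ^ q = ∫⁻ x, ENNReal.ofReal ((F x).toReal ^ q) := by
        congr 1; ext x
        rw [← ENNReal.ofReal_rpow_of_nonneg ENNReal.toReal_nonneg hq.le,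
          ENNReal.ofReal_toReal (hfin x)]
    _ = _ := by
        rw [h]
        congr 1
        refine setLIntegral_congr_fun measurableSet_Ioi fun t ht => ?_
        have : {a | t < (F a).toReal} = {x | ENNReal.ofReal t < F x} := by
          ext x
          simp only [mem_ofPred_eq]
          exact (ENNReal.ofReal_lt_iff_lt_toReal (le_of_lt ht) (hfin x)).symm
        simp only [this]

lemma setLIntegral_Ioo_rpow {c r : ℝ} (hc : 0 ≤ c) (hr : -1 < r) :
    ∫⁻ t in Ioo 0 c, ENNReal.ofReal (t ^ r) = ENNReal.ofReal (c ^ (r + 1) / (r + 1)) := by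
  have h1 := integral_rpow (a := 0) (b := c) (Or.inl hr)
  rw [Real.zero_rpow (by linarith), sub_zero, intervalIntegral.integral_of_le hc,
    integral_Ioc_eq_integral_Ioo] at h1
  rw [← h1, ofReal_integral_eq_lintegral_ofReal]
  · exact ((intervalIntegral.intervalIntegrable_rpow' hr).1).mono_set Ioo_subset_Ioc_self
  · filter_upwards [self_mem_ae_restrict measurableSet_Ioo] with t ht
    exact Real.rpow_nonneg ht.1.le _

lemma setLIntegral_Ioi_rpow {c r : ℝ} (hc : 0 < c) (hr : r < -1) :
    ∫⁻ t in Ioi c, ENNReal.ofReal (t ^ r) = ENNReal.ofReal (-c ^ (r + 1) / (r + 1)) := by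
  rw [← integral_Ioi_rpow_of_lt hr hc, ofReal_integral_eq_lintegral_ofReal]
  · exact integrableOn_Ioi_rpow_of_lt hr hc
  · filter_upwards [self_mem_ae_restrict measurableSet_Ioi] with t ht
    exact Real.rpow_nonneg (hc.le.trans (le_of_lt ht)) _

/-- Strong type bound for the maximal function. -/
lemma exists_lintegral_maxFn_rpow_le {q : ℝ} (hq : 1 < q) :
    ∃ C : ℝ≥0, ∀ f : ℝ → ℝ≥0∞, Measurable f → ∀ K : ℝ≥0, (∀ x, f x ≤ K) →
      ∫⁻ x, maxFn f x ^ q ≤ C * ∫⁻ x, f x ^ q := by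
  refine ⟨(q * 10 * (2 ^ (q - 1) / (q - 1))).toNNReal, fun f hf K hK => ?_⟩
  have hffin : ∀ x, f x ≠ ∞ := fun x => ((hK x).trans_lt ENNReal.coe_lt_top).ne
  have hfin : ∀ x, maxFn f x ≠ ∞ :=
    fun x => ((maxFn_le_of_le hK x).trans_lt ENNReal.coe_lt_top).ne
  rw [lintegral_rpow_eq_layer (measurable_maxFn f) hfin (by linarith)]
  have hS : MeasurableSet {z : ℝ × ℝ | ENNReal.ofReal z.1 / 2 < f z.2} :=
    measurableSet_lt ((ENNReal.measurable_ofReal.comp measurable_fst).div_const 2)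
      (hf.comp measurable_snd)
  have step : ∀ t ∈ Ioi (0 : ℝ), volume {x | ENNReal.ofReal t < maxFn f x} *
      ENNReal.ofReal (t ^ (q - 1)) ≤ 10 * ∫⁻ x, ({z : ℝ × ℝ | ENNReal.ofReal z.1 / 2 < f z.2}).indicator
        (fun z => f z.2 * ENNReal.ofReal (z.1 ^ (q - 2))) (t, x) := by
    intro t ht
    have ht' : 0 < t := ht
    have h1 := measure_lt_maxFn_le_truncated f (t := ENNReal.ofReal t) ENNReal.ofReal_ne_top
    have e : t ^ (q - 1) = t * t ^ (q - 2) := by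
      rw [show q - 1 = 1 + (q - 2) by ring, Real.rpow_add ht', Real.rpow_one]
    have hm : MeasurableSet {x | ENNReal.ofReal t / 2 < f x} := measurableSet_lt measurable_const hf
    calc _ = ENNReal.ofReal t * volume {x | ENNReal.ofReal t < maxFn f x} *
          ENNReal.ofReal (t ^ (q - 2)) := by
          rw [e, ENNReal.ofReal_mul ht'.le]; ring
      _ ≤ (10 * ∫⁻ x in {x | ENNReal.ofReal t / 2 < f x}, f x) *
          ENNReal.ofReal (t ^ (q - 2)) := by gcongr
      _ = 10 * ∫⁻ x in {x | ENNReal.ofReal t / 2 < f x}, f x * ENNReal.ofReal (t ^ (q - 2)) := by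
          rw [mul_assoc, lintegral_mul_const _ hf]
      _ = _ := by
          rw [← lintegral_indicator hm]
          rfl
  have hmeas : Measurable (({z : ℝ × ℝ | ENNReal.ofReal z.1 / 2 < f z.2}).indicator
        (fun z => f z.2 * ENNReal.ofReal (z.1 ^ (q - 2)))) :=
    ((hf.comp measurable_snd).mul (by fun_prop)).indicator hS
  calc ENNReal.ofReal q * ∫⁻ t in Ioi (0 : ℝ), volume {x | ENNReal.ofReal t < maxFn f x} *
        ENNReal.ofReal (t ^ (q - 1))
      ≤ ENNReal.ofReal q * ∫⁻ t in Ioi (0 : ℝ), 10 * ∫⁻ x,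
        ({z : ℝ × ℝ | ENNReal.ofReal z.1 / 2 < f z.2}).indicator
        (fun z => f z.2 * ENNReal.ofReal (z.1 ^ (q - 2))) (t, x) := by
        exact mul_le_mul_right (setLIntegral_mono' measurableSet_Ioi step) _
    _ = ENNReal.ofReal q * (10 * ∫⁻ x, ∫⁻ t in Ioi (0 : ℝ),
        ({z : ℝ × ℝ | ENNReal.ofReal z.1 / 2 < f z.2}).indicator
        (fun z => f z.2 * ENNReal.ofReal (z.1 ^ (q - 2))) (t, x)) := by
        rw [lintegral_const_mul _ hmeas.lintegral_prod_right', lintegral_lintegral_swap]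
        exact hmeas.aemeasurable
    _ = ENNReal.ofReal q * (10 * ∫⁻ x, ENNReal.ofReal (2 ^ (q - 1) / (q - 1)) * f x ^ q) := by
        congr 3; ext x
        have hx : f x = ENNReal.ofReal (f x).toReal := (ENNReal.ofReal_toReal (hffin x)).symm
        set c := (f x).toReal with hc
        have hc0 : 0 ≤ c := ENNReal.toReal_nonneg
        have : ∀ t ∈ Ioi (0 : ℝ), ({z : ℝ × ℝ | ENNReal.ofReal z.1 / 2 < f z.2}).indicator
            (fun z => f z.2 * ENNReal.ofReal (z.1 ^ (q - 2))) (t, x) =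
            (Iio (2 * c)).indicator (fun t => f x * ENNReal.ofReal (t ^ (q - 2))) t := by
          intro t ht
          have hiff : (ENNReal.ofReal t / 2 < f x) ↔ t < 2 * c := by
            rw [hx, ENNReal.div_lt_iff (by simp) (by simp),
              show (2 : ℝ≥0∞) = ENNReal.ofReal 2 by simp, ← ENNReal.ofReal_mul hc0,
              ENNReal.ofReal_lt_ofReal_iff_of_nonneg (le_of_lt ht), mul_comm]
          by_cases h : t < 2 * c
          · simp [hiff, h]
          · simp [hiff, h]
        rw [setLIntegral_congr_fun measurableSet_Ioi this, lintegral_indicator measurableSet_Iio,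
          Measure.restrict_restrict measurableSet_Iio, Iio_inter_Ioi, lintegral_const_mul _ (by fun_prop),
          setLIntegral_Ioo_rpow (by positivity) (by linarith), hx,
          ENNReal.ofReal_rpow_of_nonneg hc0 (by linarith), ← ENNReal.ofReal_mul hc0,
          ← ENNReal.ofReal_mul (div_nonneg (by positivity) (by linarith))]
        congr 1
        rw [show q - 2 + 1 = q - 1 by ring, Real.mul_rpow (by norm_num) hc0]
        have : c ^ q = c * c ^ (q - 1) := by
          rcases hc0.eq_or_lt with h | h
          · rw [← h, Real.zero_rpow (by linarith), zero_mul]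
          · nth_rw 2 [← Real.rpow_one c]; rw [← Real.rpow_add h]; congr 1; ring
        rw [this]; ring
    _ = _ := by
        rw [lintegral_const_mul _ (hf.pow_const q), ← mul_assoc, ← mul_assoc]
        congr 1
        have : (0:ℝ) ≤ 2 ^ (q - 1) / (q - 1) := div_nonneg (by positivity) (by linarith)
        rw [show (10 : ℝ≥0∞) = ENNReal.ofReal 10 by simp, ← ENNReal.ofReal_mul (by linarith),
          ← ENNReal.ofReal_mul (by linarith)]
        rfl

/-- An open subset of `ℝ` of finite measure is a countable disjoint union of bounded open
intervals whose endpoints lie outside of it. -/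
lemma exists_intervals_of_isOpen {Ω : Set ℝ} (hΩ : IsOpen Ω) (hfin : volume Ω ≠ ∞) :
    ∃ S : Set (ℝ × ℝ), S.Countable ∧ (∀ q ∈ S, q.1 < q.2 ∧ q.1 ∉ Ω ∧ q.2 ∉ Ω) ∧
      S.PairwiseDisjoint (fun q => Ioo q.1 q.2) ∧ Ω = ⋃ q ∈ S, Ioo q.1 q.2 := by
  let S : Set (ℝ × ℝ) := {q | (q.1 < q.2 ∧ q.1 ∉ Ω ∧ q.2 ∉ Ω) ∧ Ioo q.1 q.2 ⊆ Ω}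
  have hd : S.PairwiseDisjoint (fun q => Ioo q.1 q.2) := by
    intro q hq r hr hne
    rw [Function.onFun, Set.disjoint_left]
    intro x hx hx'
    apply hne
    refine Prod.ext ?_ ?_
    · rcases lt_trichotomy q.1 r.1 with h | h | h
      · exact absurd (hq.2 ⟨h, hx'.1.trans hx.2⟩) hr.1.2.1
      · exact h
      · exact absurd (hr.2 ⟨h, hx.1.trans hx'.2⟩) hq.1.2.1
    · rcases lt_trichotomy q.2 r.2 with h | h | h
      · exact absurd (hr.2 ⟨hx'.1.trans hx.2, h⟩) hq.1.2.2
      · exact h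
      · exact absurd (hq.2 ⟨hx.1.trans hx'.2, h⟩) hr.1.2.2
  refine ⟨S, ?_, fun q hq => hq.1, hd, ?_⟩
  · refine hd.countable_of_nonempty_interior fun q hq => ?_
    rw [interior_Ioo]
    exact nonempty_Ioo.2 hq.1.1
  refine Subset.antisymm (fun x hx => ?_) (iUnion₂_subset fun q hq => hq.2)
  have hcl : IsClosed (Ωᶜ) := hΩ.isClosed_compl
  have hL : (Ωᶜ ∩ Iic x).Nonempty := by
    by_contra h
    rw [not_nonempty_iff_eq_empty] at h
    refine hfin (top_le_iff.1 ?_)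
    rw [← Real.volume_Iic (a := x)]
    refine measure_mono fun y hy => ?_
    by_contra hy'
    have : y ∈ Ωᶜ ∩ Iic x := ⟨hy', hy⟩
    simp [h] at this
  have hR : (Ωᶜ ∩ Ici x).Nonempty := by
    by_contra h
    rw [not_nonempty_iff_eq_empty] at h
    refine hfin (top_le_iff.1 ?_)
    rw [← Real.volume_Ici (a := x)]
    refine measure_mono fun y hy => ?_
    by_contra hy'
    have : y ∈ Ωᶜ ∩ Ici x := ⟨hy', hy⟩
    simp [h] at this
  have bL : BddAbove (Ωᶜ ∩ Iic x) := ⟨x, fun y hy => hy.2⟩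
  have bR : BddBelow (Ωᶜ ∩ Ici x) := ⟨x, fun y hy => hy.2⟩
  have ha := (hcl.inter isClosed_Iic).csSup_mem hL bL
  have hb := (hcl.inter isClosed_Ici).csInf_mem hR bR
  set a := sSup (Ωᶜ ∩ Iic x)
  set b := sInf (Ωᶜ ∩ Ici x)
  have hax : a < x := lt_of_le_of_ne ha.2 fun h => ha.1 (h ▸ hx)
  have hxb : x < b := lt_of_le_of_ne hb.2 fun h => hb.1 (h ▸ hx)
  refine mem_biUnion (x := (a, b)) ⟨⟨hax.trans hxb, ha.1, hb.1⟩, fun y hy => ?_⟩ ⟨hax, hxb⟩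
  by_contra hy'
  rcases le_total y x with h | h
  · exact absurd (le_csSup bL ⟨hy', h⟩) (not_le.2 hy.1)
  · exact absurd (csInf_le bR ⟨hy', h⟩) (not_le.2 hy.2)

/-- Continuous, integrable and bounded functions. -/
structure Nice {E : Type*} [NormedAddCommGroup E] (f : ℝ → E) : Prop where
  continuous : Continuous f
  integrable : Integrable f
  bounded : ∃ M : ℝ, ∀ x, ‖f x‖ ≤ M

variable {E F : Type*} [NormedAddCommGroup E] [InnerProductSpace ℂ E]
  [NormedAddCommGroup F] [InnerProductSpace ℂ F]

/-- The convolution operator with an operator-valued kernel. -/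
noncomputable def convOp (K : ℝ → E →L[ℂ] F) (f : ℝ → E) (x : ℝ) : F := ∫ y, K (x - y) (f y)

lemma Nice.integrable_apply {K : ℝ → E →L[ℂ] F} (hK : Nice K) {f : ℝ → E} (hf : Integrable f)
    (x : ℝ) : Integrable fun y => K (x - y) (f y) := by
  obtain ⟨M, hM⟩ := hK.bounded
  refine (hf.norm.const_mul M).mono ?_ (Filter.Eventually.of_forall fun y => ?_)
  · exact (ContinuousLinearMap.apply ℂ F).flip.aestronglyMeasurable_comp₂
      (hK.continuous.comp (by fun_prop : Continuous fun y => x - y)).aestronglyMeasurable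
      hf.aestronglyMeasurable
  · have hM0 : 0 ≤ M := (norm_nonneg _).trans (hM 0)
    rw [norm_mul, norm_norm, Real.norm_of_nonneg hM0]
    exact ((K (x - y)).le_opNorm _).trans (by gcongr; exact hM _)

lemma Nice.continuous_convOp {K : ℝ → E →L[ℂ] F} (hK : Nice K) {f : ℝ → E} (hf : Integrable f) :
    Continuous (convOp K f) := by
  obtain ⟨M, hM⟩ := hK.bounded
  refine continuous_of_dominated (bound := fun y => M * ‖f y‖)
    (fun x => (hK.integrable_apply hf x).aestronglyMeasurable)
    (fun x => Filter.Eventually.of_forall fun y => ?_) (hf.norm.const_mul M)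
    (Filter.Eventually.of_forall fun y => ?_)
  · exact ((K (x - y)).le_opNorm _).trans (by gcongr; exact hM _)
  · have := hK.continuous
    fun_prop

lemma enorm_convOp_le (K : ℝ → E →L[ℂ] F) (f : ℝ → E) (x : ℝ) :
    ‖convOp K f x‖ₑ ≤ ∫⁻ y, ‖K (x - y)‖ₑ * ‖f y‖ₑ :=
  (enorm_integral_le_lintegral_enorm _).trans (lintegral_mono fun y => (K (x - y)).le_opENorm _)

lemma Nice.nice_convOp {K : ℝ → E →L[ℂ] F} (hK : Nice K) {f : ℝ → E} (hf : Integrable f) :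
    Nice (convOp K f) := by
  obtain ⟨M, hM⟩ := hK.bounded
  refine ⟨hK.continuous_convOp hf, ⟨(hK.continuous_convOp hf).aestronglyMeasurable, ?_⟩,
    ⟨M * ∫ y, ‖f y‖, fun x => ?_⟩⟩
  · have hm : AEMeasurable (fun z : ℝ × ℝ => ‖K (z.1 - z.2)‖ₑ * ‖f z.2‖ₑ) (volume.prod volume) := by
      refine AEMeasurable.mul ?_ hf.aestronglyMeasurable.comp_snd.enorm
      have := hK.continuous
      exact (by fun_prop : Continuous fun z : ℝ × ℝ => K (z.1 - z.2)).enorm.measurable.aemeasurable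
    calc ∫⁻ x, ‖convOp K f x‖ₑ ≤ ∫⁻ x, ∫⁻ y, ‖K (x - y)‖ₑ * ‖f y‖ₑ :=
          lintegral_mono fun x => enorm_convOp_le K f x
      _ = ∫⁻ y, ∫⁻ x, ‖K (x - y)‖ₑ * ‖f y‖ₑ := lintegral_lintegral_swap hm
      _ = ∫⁻ y, (∫⁻ x, ‖K x‖ₑ) * ‖f y‖ₑ := by
          congr 1; ext y
          rw [lintegral_mul_const', lintegral_sub_right_eq_self (fun x => ‖K x‖ₑ)]
          exact enorm_ne_top
      _ = (∫⁻ x, ‖K x‖ₑ) * ∫⁻ y, ‖f y‖ₑ := by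
          rw [lintegral_const_mul' _ _ hK.integrable.2.ne]
      _ < ∞ := ENNReal.mul_lt_top hK.integrable.2 hf.2
  · rw [← integral_const_mul]
    refine norm_integral_le_of_norm_le (hf.norm.const_mul M) (Filter.Eventually.of_forall fun y => ?_)
    exact ((K (x - y)).le_opNorm _).trans (by gcongr; exact hM _)

/-- Quantitative Calderón–Zygmund kernels. -/
structure IsCZ (K : ℝ → E →L[ℂ] F) (B : ℝ≥0) : Prop where
  nice : Nice K
  l2 : ∀ f : ℝ → E, Integrable f → (∃ M : ℝ, ∀ x, ‖f x‖ ≤ M) →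
    ∫⁻ x, ‖convOp K f x‖ₑ ^ (2 : ℝ) ≤ B * ∫⁻ x, ‖f x‖ₑ ^ (2 : ℝ)
  hormander : ∀ y : ℝ, ∫⁻ x in {x | 2 * |y| ≤ |x|}, ‖K (x - y) - K x‖ₑ ≤ B

lemma Nice.setLIntegral_enorm_integral_le {K : ℝ → E →L[ℂ] F} (hK : Nice K) {B : ℝ≥0}
    (hB : ∀ y : ℝ, ∫⁻ x in {x | 2 * |y| ≤ |x|}, ‖K (x - y) - K x‖ₑ ≤ B)
    [CompleteSpace E] [CompleteSpace F]
    {b : ℝ → E} (hb : Integrable b) {α β : ℝ} (h0 : ∫ y in Ioo α β, b y = 0) :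
    ∫⁻ x in (Metric.ball ((α + β) / 2) (β - α))ᶜ, ‖∫ y in Ioo α β, K (x - y) (b y)‖ₑ ≤
      B * ∫⁻ y in Ioo α β, ‖b y‖ₑ := by
  set c := (α + β) / 2 with hc
  have hKc := hK.continuous
  have h1 : ∀ x, ‖∫ y in Ioo α β, K (x - y) (b y)‖ₑ ≤
      ∫⁻ y in Ioo α β, ‖K (x - y) - K (x - c)‖ₑ * ‖b y‖ₑ := by
    intro x
    have e : ∫ y in Ioo α β, K (x - y) (b y) = ∫ y in Ioo α β, (K (x - y) - K (x - c)) (b y) := by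
      simp only [sub_apply]
      rw [integral_sub (hK.integrable_apply hb x).integrableOn
        ((K (x - c)).integrable_comp hb).integrableOn,
        ContinuousLinearMap.integral_comp_comm _ hb.integrableOn, h0]
      simp
    rw [e]
    exact (enorm_integral_le_lintegral_enorm _).trans
      (lintegral_mono fun y => ContinuousLinearMap.le_opENorm _ _)
  have hm : AEMeasurable (fun z : ℝ × ℝ => ‖K (z.1 - z.2) - K (z.1 - c)‖ₑ * ‖b z.2‖ₑ)
      ((volume.restrict (Metric.ball c (β - α))ᶜ).prod (volume.restrict (Ioo α β))) := by
    refine AEMeasurable.mul ?_ hb.aestronglyMeasurable.restrict.comp_snd.enorm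
    exact (by fun_prop : Continuous fun z : ℝ × ℝ =>
      K (z.1 - z.2) - K (z.1 - c)).enorm.measurable.aemeasurable
  calc _ ≤ ∫⁻ x in (Metric.ball c (β - α))ᶜ,
        ∫⁻ y in Ioo α β, ‖K (x - y) - K (x - c)‖ₑ * ‖b y‖ₑ := lintegral_mono h1
    _ = ∫⁻ y in Ioo α β, ∫⁻ x in (Metric.ball c (β - α))ᶜ,
        ‖K (x - y) - K (x - c)‖ₑ * ‖b y‖ₑ := lintegral_lintegral_swap hm
    _ ≤ ∫⁻ y in Ioo α β, B * ‖b y‖ₑ := by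
        refine setLIntegral_mono' measurableSet_Ioo fun y hy => ?_
        rw [lintegral_mul_const' _ _ enorm_ne_top]
        gcongr
        refine le_trans ?_ (hB (y - c))
        rw [← lintegral_indicator (measurableSet_le (by fun_prop) (by fun_prop)),
          ← lintegral_sub_right_eq_self
            ({x | 2 * |y - c| ≤ |x|}.indicator fun x => ‖K (x - (y - c)) - K x‖ₑ) c,
          ← lintegral_indicator Metric.isOpen_ball.measurableSet.compl]
        refine lintegral_mono fun x => ?_
        by_cases hx : x ∈ (Metric.ball c (β - α))ᶜ
        · have hx' : β - α ≤ |x - c| := by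
            simpa [Metric.mem_ball, Real.dist_eq] using hx
          have hy' : 2 * |y - c| ≤ β - α := by
            have : |y - c| ≤ (β - α) / 2 := by
              rw [abs_le, hc]; constructor <;> linarith [hy.1, hy.2]
            linarith
          have : x - c ∈ {x | 2 * |y - c| ≤ |x|} := hy'.trans hx'
          rw [indicator_of_mem hx, indicator_of_mem this]
          rw [show x - c - (y - c) = x - y by ring]
        · rw [indicator_of_notMem hx]; exact zero_le
    _ = _ := lintegral_const_mul' _ _ ENNReal.coe_ne_top

/-- The Calderón–Zygmund decomposition at height `t`, along the components of the set where the
maximal function exceeds `t`. -/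
lemma exists_calderon_zygmund [CompleteSpace E] {f : ℝ → E} (hf : Nice f) {t : ℝ≥0} (ht : 0 < t) :
    ∃ (S : Set (ℝ × ℝ)) (g : ℝ → E), S.Countable ∧ (∀ q ∈ S, q.1 < q.2) ∧
      S.PairwiseDisjoint (fun q => Ioo q.1 q.2) ∧
      {x | (t : ℝ≥0∞) < maxFn (fun x => ‖f x‖ₑ) x} = ⋃ q ∈ S, Ioo q.1 q.2 ∧
      Integrable g ∧ (∃ M : ℝ, ∀ x, ‖g x‖ ≤ M) ∧
      (∀ x, x ∉ ⋃ q ∈ S, Ioo q.1 q.2 → f x - g x = 0) ∧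
      (∀ q ∈ S, ∫ y in Ioo q.1 q.2, (f y - g y) = 0) ∧
      (∀ q ∈ S, ∫⁻ y in Ioo q.1 q.2, ‖f y - g y‖ₑ ≤ 2 * t * ENNReal.ofReal (q.2 - q.1)) ∧
      ∫⁻ x, ‖g x‖ₑ ^ (2 : ℝ) ≤ (∫⁻ x in {x | ‖f x‖ₑ ≤ t}, ‖f x‖ₑ ^ (2 : ℝ)) +
        (t : ℝ≥0∞) ^ (2 : ℝ) * volume {x | (t : ℝ≥0∞) < maxFn (fun x => ‖f x‖ₑ) x} := by
  classical
  set Ω := {x | (t : ℝ≥0∞) < maxFn (fun x => ‖f x‖ₑ) x} with hΩdef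
  have hΩo : IsOpen Ω := isOpen_lt_maxFn _ _
  have ht0 : (t : ℝ≥0∞) ≠ 0 := by simpa using ht.ne'
  have hΩfin : volume Ω ≠ ∞ := by
    intro h
    have h1 := measure_lt_maxFn_le (fun x => ‖f x‖ₑ) (t := t) ENNReal.coe_ne_top
    rw [← hΩdef, h, ENNReal.mul_top ht0, top_le_iff] at h1
    exact (ENNReal.mul_lt_top (by simp) hf.integrable.2).ne h1
  obtain ⟨S, hSc, hS, hSd, hΩS⟩ := exists_intervals_of_isOpen hΩo hΩfin
  let av : ℝ × ℝ → E := fun q => ((q.2 - q.1)⁻¹ : ℝ) • ∫ y in Ioo q.1 q.2, f y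
  have hchoice : ∀ x : ℝ, ∃ q : ℝ × ℝ, x ∈ Ω → q ∈ S ∧ x ∈ Ioo q.1 q.2 := by
    intro x
    by_cases hx : x ∈ Ω
    · have := hx
      rw [hΩS] at this
      obtain ⟨q, hq, hxq⟩ := mem_iUnion₂.1 this
      exact ⟨q, fun _ => ⟨hq, hxq⟩⟩
    · exact ⟨(0, 0), fun h => absurd h hx⟩
  choose I hI using hchoice
  let g : ℝ → E := fun x => if x ∈ Ω then av (I x) else f x
  have hsub : ∀ q ∈ S, Ioo q.1 q.2 ⊆ Ω := fun q hq => by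
    rw [hΩS]; exact subset_biUnion_of_mem (u := fun q : ℝ × ℝ => Ioo q.1 q.2) hq
  have hgq : ∀ q ∈ S, ∀ x ∈ Ioo q.1 q.2, g x = av q := by
    intro q hq x hx
    have hxΩ := hsub q hq hx
    have : I x = q := by
      by_contra hne
      exact (Set.disjoint_left.1 (hSd (hI x hxΩ).1 hq hne)) (hI x hxΩ).2 hx
    simp only [g, hxΩ, if_true, this]
  have hgc : ∀ x, x ∉ Ω → g x = f x := fun x hx => by simp only [g, hx, if_false]
  have hint : ∀ q ∈ S, ∫⁻ y in Ioo q.1 q.2, ‖f y‖ₑ ≤ t * ENNReal.ofReal (q.2 - q.1) := by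
    intro q hq
    refine (setLIntegral_Icc_le_maxFn _ (hS q hq).1 (left_mem_Icc.2 (hS q hq).1.le)).trans ?_
    gcongr
    exact not_lt.1 (hS q hq).2.1
  have hav : ∀ q ∈ S, ‖av q‖ₑ ≤ t := by
    intro q hq
    have hpos : 0 < q.2 - q.1 := by linarith [(hS q hq).1]
    have h1 := (enorm_integral_le_lintegral_enorm (μ := volume.restrict (Ioo q.1 q.2)) f).trans
      (hint q hq)
    simp only [av, enorm_smul]
    rw [Real.enorm_of_nonneg (by positivity), ENNReal.ofReal_inv_of_pos hpos]
    calc _ ≤ (ENNReal.ofReal (q.2 - q.1))⁻¹ * (t * ENNReal.ofReal (q.2 - q.1)) := by gcongr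
      _ = t * ((ENNReal.ofReal (q.2 - q.1))⁻¹ * ENNReal.ofReal (q.2 - q.1)) := by ring
      _ = t := by
        rw [ENNReal.inv_mul_cancel (by simpa using hpos) ENNReal.ofReal_ne_top, mul_one]
  have hΩm := hΩo.measurableSet
  have hgΩ : ∀ x ∈ Ω, ‖g x‖ₑ ≤ t := by
    intro x hx
    rw [hgq _ (hI x hx).1 x (hI x hx).2]
    exact hav _ (hI x hx).1
  have hfc : ∀ x, x ∉ Ω → ‖f x‖ₑ ≤ t := fun x hx =>
    (le_maxFn_of_continuous hf.continuous.enorm x).trans (not_lt.1 hx)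
  have hgt : ∀ x, ‖g x‖ₑ ≤ t := by
    intro x
    by_cases hx : x ∈ Ω
    · exact hgΩ x hx
    · rw [hgc x hx]; exact hfc x hx
  have hgm : AEStronglyMeasurable g := by
    have h1 : AEStronglyMeasurable g (volume.restrict Ω) := by
      rw [hΩS]
      have := hSc.to_subtype
      rw [biUnion_eq_iUnion, aestronglyMeasurable_iUnion_iff]
      intro q
      refine AEStronglyMeasurable.congr (f := fun _ => av q) aestronglyMeasurable_const ?_
      filter_upwards [self_mem_ae_restrict measurableSet_Ioo] with x hx
      exact (hgq q.1 q.2 x hx).symm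
    have h2 : AEStronglyMeasurable g (volume.restrict Ωᶜ) := by
      refine AEStronglyMeasurable.congr (f := f) hf.continuous.aestronglyMeasurable ?_
      filter_upwards [self_mem_ae_restrict hΩm.compl] with x hx
      exact (hgc x hx).symm
    have := (aestronglyMeasurable_union_iff (s := Ω) (t := Ωᶜ)).2 ⟨h1, h2⟩
    rwa [union_compl_self, Measure.restrict_univ] at this
  have hgi : Integrable g := by
    refine ⟨hgm, ?_⟩
    rw [hasFiniteIntegral_iff_enorm, ← lintegral_add_compl _ hΩm]
    refine ENNReal.add_lt_top.2 ⟨?_, ?_⟩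
    · calc ∫⁻ x in Ω, ‖g x‖ₑ ≤ ∫⁻ _ in Ω, (t : ℝ≥0∞) := setLIntegral_mono' hΩm hgΩ
        _ < ∞ := by
          rw [setLIntegral_const]; exact ENNReal.mul_lt_top ENNReal.coe_lt_top hΩfin.lt_top
    · calc ∫⁻ x in Ωᶜ, ‖g x‖ₑ = ∫⁻ x in Ωᶜ, ‖f x‖ₑ :=
          setLIntegral_congr_fun hΩm.compl fun x hx => by simp only [hgc x hx]
        _ ≤ ∫⁻ x, ‖f x‖ₑ := setLIntegral_le_lintegral _ _
        _ < ∞ := hf.integrable.2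
  refine ⟨S, g, hSc, fun q hq => (hS q hq).1, hSd, hΩS, hgi, ⟨t, fun x => ?_⟩, ?_, ?_, ?_, ?_⟩
  · have := hgt x
    rw [enorm_eq_nnnorm, ENNReal.coe_le_coe] at this
    exact_mod_cast this
  · intro x hx
    rw [← hΩS] at hx
    rw [hgc x hx, sub_self]
  · intro q hq
    have hpos : 0 < q.2 - q.1 := by linarith [(hS q hq).1]
    rw [integral_sub hf.integrable.integrableOn hgi.integrableOn,
      setIntegral_congr_fun measurableSet_Ioo (hgq q hq), setIntegral_const]
    simp only [av, Measure.real, Real.volume_Ioo, ENNReal.toReal_ofReal hpos.le, smul_smul,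
      mul_inv_cancel₀ hpos.ne', one_smul, sub_self]
  · intro q hq
    calc ∫⁻ y in Ioo q.1 q.2, ‖f y - g y‖ₑ ≤ ∫⁻ y in Ioo q.1 q.2, (‖f y‖ₑ + t) :=
          lintegral_mono fun y => enorm_sub_le.trans (add_le_add_right (hgt y) _)
      _ = (∫⁻ y in Ioo q.1 q.2, ‖f y‖ₑ) + t * ENNReal.ofReal (q.2 - q.1) := by
          rw [lintegral_add_right _ measurable_const]; simp
      _ ≤ t * ENNReal.ofReal (q.2 - q.1) + t * ENNReal.ofReal (q.2 - q.1) := by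
          gcongr; exact hint q hq
      _ = _ := by ring
  · rw [← lintegral_add_compl _ hΩm, add_comm]
    refine add_le_add ?_ ?_
    · calc ∫⁻ x in Ωᶜ, ‖g x‖ₑ ^ (2 : ℝ) = ∫⁻ x in Ωᶜ, ‖f x‖ₑ ^ (2 : ℝ) :=
          setLIntegral_congr_fun hΩm.compl fun x hx => by simp only [hgc x hx]
        _ ≤ _ := lintegral_mono_set fun x hx => hfc x hx
    · calc ∫⁻ x in Ω, ‖g x‖ₑ ^ (2 : ℝ) ≤ ∫⁻ _ in Ω, (t : ℝ≥0∞) ^ (2 : ℝ) :=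
          setLIntegral_mono' hΩm fun x hx => by gcongr; exact hgΩ x hx
        _ = _ := by rw [setLIntegral_const]

/-- The distributional estimate behind the `L^q` theory, `1 < q < 2`. -/
lemma IsCZ.measure_lt_le [CompleteSpace E] [CompleteSpace F] {K : ℝ → E →L[ℂ] F} {B : ℝ≥0}
    (hK : IsCZ K B) {f : ℝ → E} (hf : Nice f) {t : ℝ≥0} (ht : 0 < t) :
    volume {x | (t : ℝ≥0∞) < ‖convOp K f x‖ₑ} ≤
      (8 * B + 2) * volume {x | (t : ℝ≥0∞) < maxFn (fun x => ‖f x‖ₑ) x} +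
      4 * B * (((t : ℝ≥0∞) ^ (2 : ℝ))⁻¹ * ∫⁻ x in {x | ‖f x‖ₑ ≤ t}, ‖f x‖ₑ ^ (2 : ℝ)) := by
  obtain ⟨S, g, hSc, hS, hSd, hΩS, hgi, hgb, hb0, hbI, hbS, hg2⟩ := exists_calderon_zygmund hf ht
  set Ω := {x | (t : ℝ≥0∞) < maxFn (fun x => ‖f x‖ₑ) x} with hΩdef
  have ht0 : (t : ℝ≥0∞) ≠ 0 := by simpa using ht.ne'
  have htt : (t : ℝ≥0∞) ≠ ∞ := ENNReal.coe_ne_top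
  have := hSc.to_subtype
  have hb : Integrable (fun y => f y - g y) := hf.integrable.sub hgi
  have hvol : ∑' q : S, ENNReal.ofReal (q.1.2 - q.1.1) = volume Ω := by
    rw [hΩS, measure_biUnion hSc hSd fun q _ => measurableSet_Ioo]
    simp
  let W : Set ℝ := ⋃ q ∈ S, Metric.ball ((q.1 + q.2) / 2) (q.2 - q.1)
  have hW : volume W ≤ 2 * volume Ω := by
    refine (measure_biUnion_le _ hSc _).trans_eq ?_
    rw [← hvol, ← ENNReal.tsum_mul_left]
    congr 1; ext q
    rw [Real.volume_ball, ENNReal.ofReal_mul (by norm_num)]; simp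
  have hadd : ∀ x, convOp K f x = convOp K g x + convOp K (fun y => f y - g y) x := by
    intro x
    unfold convOp
    rw [← integral_add (hK.nice.integrable_apply hgi x) (hK.nice.integrable_apply hb x)]
    congr 1; ext y
    rw [← map_add]; congr 1; abel
  have hTb : ∀ x, ‖convOp K (fun y => f y - g y) x‖ₑ ≤
      ∑' q : S, ‖∫ y in Ioo q.1.1 q.1.2, K (x - y) (f y - g y)‖ₑ := by
    intro x
    have hi := hK.nice.integrable_apply hb x
    have e : convOp K (fun y => f y - g y) x =
        ∑' q : S, ∫ y in Ioo q.1.1 q.1.2, K (x - y) (f y - g y) := by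
      have h1 : ∫ y in ⋃ q ∈ S, Ioo q.1 q.2, K (x - y) (f y - g y) =
          convOp K (fun y => f y - g y) x :=
        setIntegral_eq_integral_of_forall_compl_eq_zero fun y hy => by
          rw [hb0 y hy, map_zero]
      rw [← h1, biUnion_eq_iUnion]
      exact integral_iUnion (s := fun q : S => Ioo q.1.1 q.1.2) (fun q => measurableSet_Ioo)
        (fun p q hpq => hSd p.2 q.2 (fun h => hpq (Subtype.ext h))) hi.integrableOn
    rw [e]
    exact enorm_tsum_le_tsum_enorm
  have hbad : ∫⁻ x in Wᶜ, ‖convOp K (fun y => f y - g y) x‖ₑ ≤ 2 * B * t * volume Ω := by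
    calc _ ≤ ∫⁻ x in Wᶜ, ∑' q : S, ‖∫ y in Ioo q.1.1 q.1.2, K (x - y) (f y - g y)‖ₑ :=
          lintegral_mono hTb
      _ = ∑' q : S, ∫⁻ x in Wᶜ, ‖∫ y in Ioo q.1.1 q.1.2, K (x - y) (f y - g y)‖ₑ := by
          refine lintegral_tsum fun q => ?_
          have h1 := (hK.nice.continuous_convOp (hb.indicator
            (measurableSet_Ioo (a := q.1.1) (b := q.1.2)))).enorm.measurable.aemeasurable
            (μ := volume.restrict Wᶜ)
          refine h1.congr (Filter.Eventually.of_forall fun x => ?_)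
          simp only [convOp]
          rw [← integral_indicator measurableSet_Ioo]
          congr 2; ext y
          by_cases hy : y ∈ Ioo q.1.1 q.1.2 <;> simp [hy]
      _ ≤ ∑' q : S, B * (2 * t * ENNReal.ofReal (q.1.2 - q.1.1)) := by
          refine ENNReal.tsum_le_tsum fun q => ?_
          calc _ ≤ ∫⁻ x in (Metric.ball ((q.1.1 + q.1.2) / 2) (q.1.2 - q.1.1))ᶜ,
                ‖∫ y in Ioo q.1.1 q.1.2, K (x - y) (f y - g y)‖ₑ := by
                refine lintegral_mono_set (compl_subset_compl.2 ?_)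
                exact subset_biUnion_of_mem
                  (u := fun q : ℝ × ℝ => Metric.ball ((q.1 + q.2) / 2) (q.2 - q.1)) q.2
            _ ≤ B * ∫⁻ y in Ioo q.1.1 q.1.2, ‖f y - g y‖ₑ :=
                hK.nice.setLIntegral_enorm_integral_le hK.hormander hb (hbI q.1 q.2)
            _ ≤ _ := by gcongr; exact hbS q.1 q.2
      _ = _ := by
          rw [ENNReal.tsum_mul_left, ENNReal.tsum_mul_left, hvol]; ring
  have hsub : {x | (t : ℝ≥0∞) < ‖convOp K f x‖ₑ} ⊆
      ({x | (t : ℝ≥0∞) / 2 ≤ ‖convOp K g x‖ₑ} ∪ W) ∪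
      ({x | (t : ℝ≥0∞) / 2 ≤ ‖convOp K (fun y => f y - g y) x‖ₑ} ∩ Wᶜ) := by
    intro x hx
    by_contra h
    simp only [mem_union, mem_inter_iff, mem_compl_iff, not_or, not_and, not_not] at h
    obtain ⟨⟨h1, h2⟩, h3⟩ := h
    have h3' : ¬ (t : ℝ≥0∞) / 2 ≤ ‖convOp K (fun y => f y - g y) x‖ₑ := fun h => h2 (h3 h)
    have h4 : ‖convOp K f x‖ₑ ≤ t := by
      rw [hadd x, ← ENNReal.add_halves (t : ℝ≥0∞)]
      exact (enorm_add_le _ _).trans (add_le_add (not_le.1 h1).le (not_le.1 h3').le)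
    exact absurd hx (not_lt.2 h4)
  have hth0 : (t : ℝ≥0∞) / 2 ≠ 0 := (ENNReal.half_pos ht0).ne'
  have htht : (t : ℝ≥0∞) / 2 ≠ ∞ := ENNReal.div_ne_top htt (by simp)
  have hgood : volume {x | (t : ℝ≥0∞) / 2 ≤ ‖convOp K g x‖ₑ} ≤
      4 * B * (((t : ℝ≥0∞) ^ (2 : ℝ))⁻¹ * ∫⁻ x in {x | ‖f x‖ₑ ≤ t}, ‖f x‖ₑ ^ (2 : ℝ)) +
        4 * B * volume Ω := by
    have h1 : ((t : ℝ≥0∞) / 2) ^ (2 : ℝ) * volume {x | (t : ℝ≥0∞) / 2 ≤ ‖convOp K g x‖ₑ} ≤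
        ∫⁻ x, ‖convOp K g x‖ₑ ^ (2 : ℝ) := by
      refine le_trans ?_ (mul_meas_ge_le_lintegral₀ (μ := volume)
        (f := fun x => ‖convOp K g x‖ₑ ^ (2 : ℝ)) ?_ (((t : ℝ≥0∞) / 2) ^ (2 : ℝ)))
      · exact mul_le_mul_right (measure_mono fun x (hx : (t : ℝ≥0∞) / 2 ≤ ‖convOp K g x‖ₑ) =>
          ENNReal.rpow_le_rpow hx (by norm_num)) _
      · exact ((hK.nice.continuous_convOp hgi).enorm.measurable.pow_const _).aemeasurable
    have h2 := (h1.trans (hK.l2 g hgi hgb)).trans (mul_le_mul_right hg2 _)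
    have hT0 : (t : ℝ≥0∞) ^ (2 : ℝ) ≠ 0 := by simp [ht0]
    have hTT : (t : ℝ≥0∞) ^ (2 : ℝ) ≠ ∞ := by simp
    have e4 : (t : ℝ≥0∞) ^ (2 : ℝ) = 4 * ((t : ℝ≥0∞) / 2) ^ (2 : ℝ) := by
      conv_lhs => rw [← ENNReal.mul_div_cancel (a := 2) (b := (t : ℝ≥0∞)) (by simp) (by simp)]
      rw [ENNReal.mul_rpow_of_nonneg _ _ (by norm_num)]
      norm_num
    have h3 : (t : ℝ≥0∞) ^ (2 : ℝ) * volume {x | (t : ℝ≥0∞) / 2 ≤ ‖convOp K g x‖ₑ} ≤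
        4 * (B * ((∫⁻ x in {x | ‖f x‖ₑ ≤ t}, ‖f x‖ₑ ^ (2 : ℝ)) +
          (t : ℝ≥0∞) ^ (2 : ℝ) * volume Ω)) := by
      nth_rw 1 [e4]
      rw [mul_assoc]
      gcongr
    calc _ = ((t : ℝ≥0∞) ^ (2 : ℝ))⁻¹ * ((t : ℝ≥0∞) ^ (2 : ℝ) *
          volume {x | (t : ℝ≥0∞) / 2 ≤ ‖convOp K g x‖ₑ}) := by
          rw [← mul_assoc, ENNReal.inv_mul_cancel hT0 hTT, one_mul]
      _ ≤ ((t : ℝ≥0∞) ^ (2 : ℝ))⁻¹ * (4 * (B * ((∫⁻ x in {x | ‖f x‖ₑ ≤ t}, ‖f x‖ₑ ^ (2 : ℝ)) +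
          (t : ℝ≥0∞) ^ (2 : ℝ) * volume Ω))) := by gcongr
      _ = 4 * B * (((t : ℝ≥0∞) ^ (2 : ℝ))⁻¹ * ∫⁻ x in {x | ‖f x‖ₑ ≤ t}, ‖f x‖ₑ ^ (2 : ℝ)) +
        4 * B * (((t : ℝ≥0∞) ^ (2 : ℝ))⁻¹ * (t : ℝ≥0∞) ^ (2 : ℝ)) * volume Ω := by ring
      _ = _ := by rw [ENNReal.inv_mul_cancel hT0 hTT, mul_one]
  have hbad' : volume ({x | (t : ℝ≥0∞) / 2 ≤ ‖convOp K (fun y => f y - g y) x‖ₑ} ∩ Wᶜ) ≤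
      4 * B * volume Ω := by
    have hWm : MeasurableSet W := by
      refine (isOpen_biUnion fun q _ => Metric.isOpen_ball).measurableSet
    have h1 := (mul_meas_ge_le_lintegral₀ (μ := volume.restrict Wᶜ)
        (f := fun x => ‖convOp K (fun y => f y - g y) x‖ₑ)
        (hK.nice.continuous_convOp hb).enorm.measurable.aemeasurable ((t : ℝ≥0∞) / 2)).trans hbad
    rw [Measure.restrict_apply' hWm.compl] at h1
    set V := volume ({x | (t : ℝ≥0∞) / 2 ≤ ‖convOp K (fun y => f y - g y) x‖ₑ} ∩ Wᶜ)
    calc V = ((t : ℝ≥0∞) / 2)⁻¹ * ((t : ℝ≥0∞) / 2 * V) := by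
          rw [← mul_assoc, ENNReal.inv_mul_cancel hth0 htht, one_mul]
      _ ≤ ((t : ℝ≥0∞) / 2)⁻¹ * (2 * B * t * volume Ω) := by gcongr
      _ = ((t : ℝ≥0∞) / 2)⁻¹ * (2 * B * (2 * (t / 2)) * volume Ω) := by
          rw [ENNReal.mul_div_cancel (by simp) (by simp)]
      _ = (((t : ℝ≥0∞) / 2)⁻¹ * (t / 2)) * (4 * B * volume Ω) := by ring
      _ = _ := by rw [ENNReal.inv_mul_cancel hth0 htht, one_mul]
  calc _ ≤ volume {x | (t : ℝ≥0∞) / 2 ≤ ‖convOp K g x‖ₑ} + volume W +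
        volume ({x | (t : ℝ≥0∞) / 2 ≤ ‖convOp K (fun y => f y - g y) x‖ₑ} ∩ Wᶜ) :=
        (measure_mono hsub).trans ((measure_union_le _ _).trans
          (add_le_add_left (measure_union_le _ _) _))
    _ ≤ _ := by
        refine (add_le_add (add_le_add hgood hW) hbad').trans_eq ?_
        ring

end CoifmanMeyer

namespace CoifmanMeyer
open Set

/-- `L^q` bounds for Calderón–Zygmund operators, `1 < q < 2`. -/
lemma exists_lintegral_convOp_rpow_le_of_lt_two {q : ℝ} (hq : 1 < q) (hq2 : q < 2) :
    ∃ C : ℝ≥0, ∀ (E F : Type) [NormedAddCommGroup E] [InnerProductSpace ℂ E] [CompleteSpace E]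
      [NormedAddCommGroup F] [InnerProductSpace ℂ F] [CompleteSpace F]
      (K : ℝ → E →L[ℂ] F) (B : ℝ≥0), IsCZ K B → ∀ f : ℝ → E, Nice f →
      ∫⁻ x, ‖convOp K f x‖ₑ ^ q ≤ C * (1 + B) * ∫⁻ x, ‖f x‖ₑ ^ q := by
  obtain ⟨CM, hCM⟩ := exists_lintegral_maxFn_rpow_le hq
  refine ⟨8 * CM + 4 * (q / (2 - q)).toNNReal, ?_⟩
  intro E F _ _ _ _ _ _ K B hK f hf
  have hTf := hK.nice.nice_convOp hf.integrable
  obtain ⟨M, hM⟩ := hf.bounded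
  have hfm : Measurable fun x => ‖f x‖ₑ := hf.continuous.enorm.measurable
  have hfM : ∀ x, ‖f x‖ₑ ≤ (M.toNNReal : ℝ≥0∞) := fun x => by
    rw [← ofReal_norm]; exact ENNReal.ofReal_le_ofReal (hM x)
  have hMfin : ∀ x, maxFn (fun x => ‖f x‖ₑ) x ≠ ∞ :=
    fun x => ((maxFn_le_of_le hfM x).trans_lt ENNReal.coe_lt_top).ne
  have hmax := hCM _ hfm _ hfM
  rw [lintegral_rpow_eq_layer hTf.continuous.enorm.measurable (fun _ => enorm_ne_top) (by linarith)]
  have hS : MeasurableSet {z : ℝ × ℝ | ‖f z.2‖ₑ ≤ ENNReal.ofReal z.1} :=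
    measurableSet_le (hfm.comp measurable_snd) (ENNReal.measurable_ofReal.comp measurable_fst)
  let G : ℝ × ℝ → ℝ≥0∞ := ({z : ℝ × ℝ | ‖f z.2‖ₑ ≤ ENNReal.ofReal z.1}).indicator
    fun z => ‖f z.2‖ₑ ^ (2 : ℝ) * ENNReal.ofReal (z.1 ^ (q - 3))
  have hG : Measurable G :=
    (((hfm.comp measurable_snd).pow_const _).mul (by fun_prop)).indicator hS
  have step : ∀ t ∈ Ioi (0 : ℝ), volume {x | ENNReal.ofReal t < ‖convOp K f x‖ₑ} *
      ENNReal.ofReal (t ^ (q - 1)) ≤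
      (8 * B + 2) * (volume {x | ENNReal.ofReal t < maxFn (fun x => ‖f x‖ₑ) x} *
        ENNReal.ofReal (t ^ (q - 1))) + 4 * B * ∫⁻ x, G (t, x) := by
    intro t ht
    have ht' : 0 < t := ht
    have h1 := hK.measure_lt_le hf (t := t.toNNReal) (by simpa using ht')
    have e : ∫⁻ x, G (t, x) = (ENNReal.ofReal t ^ (2 : ℝ))⁻¹ *
        (∫⁻ x in {x | ‖f x‖ₑ ≤ ENNReal.ofReal t}, ‖f x‖ₑ ^ (2 : ℝ)) *
          ENNReal.ofReal (t ^ (q - 1)) := by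
      have hm : MeasurableSet {x | ‖f x‖ₑ ≤ ENNReal.ofReal t} := measurableSet_le hfm measurable_const
      have : ENNReal.ofReal (t ^ (q - 3)) = (ENNReal.ofReal t ^ (2 : ℝ))⁻¹ *
          ENNReal.ofReal (t ^ (q - 1)) := by
        rw [← ENNReal.rpow_neg, ENNReal.ofReal_rpow_of_pos ht', ← ENNReal.ofReal_mul (by positivity),
          ← Real.rpow_add ht']
        congr 2; ring
      rw [show (fun x => G (t, x)) = ({x | ‖f x‖ₑ ≤ ENNReal.ofReal t}).indicator
        fun x => ‖f x‖ₑ ^ (2 : ℝ) * ENNReal.ofReal (t ^ (q - 3)) from rfl, lintegral_indicator hm,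
        lintegral_mul_const _ (hfm.pow_const _), this]
      ring
    calc _ ≤ ((8 * B + 2) * volume {x | ENNReal.ofReal t < maxFn (fun x => ‖f x‖ₑ) x} +
      4 * B * ((ENNReal.ofReal t ^ (2 : ℝ))⁻¹ *
        ∫⁻ x in {x | ‖f x‖ₑ ≤ ENNReal.ofReal t}, ‖f x‖ₑ ^ (2 : ℝ))) *
          ENNReal.ofReal (t ^ (q - 1)) := by gcongr; exact h1
      _ = _ := by rw [e]; ring
  have hGx : ∀ x, ∫⁻ t in Ioi (0 : ℝ), G (t, x) ≤ ENNReal.ofReal (1 / (2 - q)) * ‖f x‖ₑ ^ q := by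
    intro x
    rcases (norm_nonneg (f x)).eq_or_lt with h0 | h0
    · have : ‖f x‖ₑ = 0 := by rw [← ofReal_norm, ← h0]; simp
      have h2 : ∀ t, G (t, x) = 0 := fun t => by
        simp only [G, indicator, this]; simp
      simp [h2]
    · have h2 : ∀ t ∈ Ioi (0 : ℝ), G (t, x) ≤ (Ici ‖f x‖).indicator
          (fun t => ENNReal.ofReal (‖f x‖ ^ (2:ℝ)) * ENNReal.ofReal (t ^ (q - 3))) t := by
        intro t ht
        have ht' : 0 < t := ht
        have hiff : (‖f x‖ₑ ≤ ENNReal.ofReal t) ↔ ‖f x‖ ≤ t := by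
          rw [← ofReal_norm, ENNReal.ofReal_le_ofReal_iff ht'.le]
        rw [← ENNReal.ofReal_rpow_of_pos h0, ofReal_norm]
        by_cases h : ‖f x‖ ≤ t
        · simp [G, indicator, hiff, h]
        · simp [G, indicator, hiff, h]
      refine (setLIntegral_mono' measurableSet_Ioi h2).trans ?_
      rw [lintegral_indicator measurableSet_Ici, Measure.restrict_restrict measurableSet_Ici,
        inter_eq_left.2 (Ici_subset_Ioi.2 h0),
        setLIntegral_congr (Ioi_ae_eq_Ici (a := ‖f x‖)).symm, lintegral_const_mul _ (by fun_prop),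
        setLIntegral_Ioi_rpow h0 (by linarith), ← ofReal_norm, ENNReal.ofReal_rpow_of_pos h0,
        ← ENNReal.ofReal_mul (by positivity), ← ENNReal.ofReal_mul
          (one_div_nonneg.2 (by linarith))]
      apply ENNReal.ofReal_le_ofReal
      rw [show q - 3 + 1 = -(2 - q) by ring, neg_div_neg_eq]
      rw [mul_div_assoc', ← Real.rpow_add h0, show 2 + -(2 - q) = q by ring]
      exact le_of_eq (by ring)
  set I := ∫⁻ x, ‖f x‖ₑ ^ q
  calc ENNReal.ofReal q * ∫⁻ t in Ioi (0 : ℝ), volume {x | ENNReal.ofReal t < ‖convOp K f x‖ₑ} *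
        ENNReal.ofReal (t ^ (q - 1))
      ≤ ENNReal.ofReal q * ∫⁻ t in Ioi (0 : ℝ), ((8 * B + 2) *
        (volume {x | ENNReal.ofReal t < maxFn (fun x => ‖f x‖ₑ) x} *
        ENNReal.ofReal (t ^ (q - 1))) + 4 * B * ∫⁻ x, G (t, x)) := by
        exact mul_le_mul_right (setLIntegral_mono' measurableSet_Ioi step) _
    _ = (8 * B + 2) * (ENNReal.ofReal q * ∫⁻ t in Ioi (0 : ℝ),
        volume {x | ENNReal.ofReal t < maxFn (fun x => ‖f x‖ₑ) x} * ENNReal.ofReal (t ^ (q - 1))) +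
        4 * B * (ENNReal.ofReal q * ∫⁻ x, ∫⁻ t in Ioi (0 : ℝ), G (t, x)) := by
        rw [lintegral_add_right _ (hG.lintegral_prod_right'.const_mul _),
          lintegral_const_mul' _ _ (by finiteness),
          lintegral_const_mul _ hG.lintegral_prod_right', lintegral_lintegral_swap
          (f := fun t x => G (t, x)) hG.aemeasurable]
        ring
    _ ≤ (8 * B + 2) * (CM * I) + 4 * B * (ENNReal.ofReal q *
        ∫⁻ x, ENNReal.ofReal (1 / (2 - q)) * ‖f x‖ₑ ^ q) := by
        rw [← lintegral_rpow_eq_layer (measurable_maxFn _) hMfin (by linarith)]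
        gcongr with x
        exact hGx x
    _ = (8 * B + 2) * (CM * I) + 4 * B * ((q / (2 - q)).toNNReal * I) := by
        rw [lintegral_const_mul _ (hfm.pow_const q), ← mul_assoc (ENNReal.ofReal q),
          ← ENNReal.ofReal_mul (by linarith), mul_one_div]
        rfl
    _ ≤ _ := by
        push_cast
        set D : ℝ≥0∞ := ((q / (2 - q)).toNNReal : ℝ≥0∞)
        calc _ = (8 * CM * B + 2 * CM + 4 * D * B) * I := by ring
          _ ≤ (8 * CM * B + 8 * CM + 4 * D * B + 4 * D) * I := by
            refine mul_le_mul_left (le_add_right (add_le_add_left (add_le_add_right ?_ _) _)) _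
            exact mul_le_mul_left (by norm_num) _
          _ = _ := by ring

lemma Nice.lintegral_rpow_ne_top {E : Type*} [NormedAddCommGroup E] {u : ℝ → E} (hu : Nice u)
    {q : ℝ} (hq : 1 ≤ q) : ∫⁻ x, ‖u x‖ₑ ^ q ≠ ∞ := by
  obtain ⟨M, hM⟩ := hu.bounded
  have h : ∀ x, ‖u x‖ₑ ^ q ≤ ENNReal.ofReal M ^ (q - 1) * ‖u x‖ₑ := fun x => by
    rw [show q = (q - 1) + 1 by ring, ENNReal.rpow_add_of_nonneg _ _ (by linarith) zero_le_one,
      ENNReal.rpow_one, show q - 1 + 1 - 1 = q - 1 by ring]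
    gcongr
    rw [← ofReal_norm]
    exact ENNReal.ofReal_le_ofReal (hM x)
  refine ((lintegral_mono h).trans_lt ?_).ne
  have hM' : ENNReal.ofReal M ^ (q - 1) ≠ ∞ :=
    ENNReal.rpow_ne_top_of_nonneg (sub_nonneg.2 hq) ENNReal.ofReal_ne_top
  rw [lintegral_const_mul' _ _ hM']
  exact ENNReal.mul_lt_top hM'.lt_top hu.integrable.2

section Adjoint

variable {E F : Type*} [NormedAddCommGroup E] [InnerProductSpace ℂ E] [CompleteSpace E]
  [NormedAddCommGroup F] [InnerProductSpace ℂ F] [CompleteSpace F]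

/-- The kernel of the adjoint convolution operator. -/
noncomputable def adjKer (K : ℝ → E →L[ℂ] F) (x : ℝ) : F →L[ℂ] E :=
  ContinuousLinearMap.adjoint (K (-x))

lemma adjKer_adjKer (K : ℝ → E →L[ℂ] F) : adjKer (adjKer K) = K := by
  ext1 x; simp [adjKer]

lemma Nice.adj {K : ℝ → E →L[ℂ] F} (hK : Nice K) : Nice (adjKer K) := by
  obtain ⟨M, hM⟩ := hK.bounded
  have hc : Continuous (adjKer K) :=
    ContinuousLinearMap.adjoint.continuous.comp (hK.continuous.comp continuous_neg)
  refine ⟨hc, ?_, M, fun x => ?_⟩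
  · exact hK.integrable.comp_neg.mono hc.aestronglyMeasurable
      (Filter.Eventually.of_forall fun x => by simp [adjKer])
  · simpa [adjKer] using hM (-x)

lemma Nice.integral_inner_convOp {K : ℝ → E →L[ℂ] F} (hK : Nice K) {f : ℝ → E} {h : ℝ → F}
    (hf : Integrable f) (hh : Integrable h) :
    ∫ x, inner ℂ (h x) (convOp K f x) = ∫ y, inner ℂ (convOp (adjKer K) h y) (f y) := by
  obtain ⟨M, hM⟩ := hK.bounded
  have e1 : ∀ x, inner ℂ (h x) (convOp K f x) = ∫ y, inner ℂ (h x) (K (x - y) (f y)) := fun x =>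
    (integral_inner (hK.integrable_apply hf x) (h x)).symm
  have e2 : ∀ y, inner ℂ (convOp (adjKer K) h y) (f y) = ∫ x, inner ℂ (h x) (K (x - y) (f y)) := by
    intro y
    rw [← inner_conj_symm, convOp, ← integral_inner (hK.adj.integrable_apply hh y) (f y),
      ← integral_conj]
    congr 1; ext x
    rw [inner_conj_symm, adjKer, ContinuousLinearMap.adjoint_inner_left, neg_sub]
  simp_rw [e1, e2]
  refine integral_integral_swap ?_
  have hint := (hh.norm.mul_prod hf.norm).const_mul M
  have hKc := hK.continuous
  refine hint.mono ?_ (Filter.Eventually.of_forall fun z => ?_)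
  · refine AEStronglyMeasurable.inner hh.aestronglyMeasurable.comp_fst ?_
    exact (ContinuousLinearMap.apply ℂ F).flip.aestronglyMeasurable_comp₂
      (by fun_prop : Continuous fun z : ℝ × ℝ => K (z.1 - z.2)).aestronglyMeasurable
      hf.aestronglyMeasurable.comp_snd
  · have hM0 : 0 ≤ M := (norm_nonneg _).trans (hM 0)
    calc _ ≤ ‖h z.1‖ * ‖K (z.1 - z.2) (f z.2)‖ := norm_inner_le_norm _ _
      _ ≤ ‖h z.1‖ * (M * ‖f z.2‖) := by
        gcongr
        exact ((K _).le_opNorm _).trans (by gcongr; exact hM _)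
      _ = M * (‖h z.1‖ * ‖f z.2‖) := by ring
      _ ≤ _ := le_abs_self _

/-- Duality: an `L^{q'}` bound for the adjoint operator gives an `L^q` bound, `q ≥ 2`. -/
lemma Nice.lintegral_convOp_rpow_le_of_adjKer {K : ℝ → E →L[ℂ] F} (hK : Nice K) {q q' : ℝ}
    (hq : 2 ≤ q) (hqq : q.HolderConjugate q') {C : ℝ≥0}
    (hC : ∀ h : ℝ → F, Nice h → ∫⁻ y, ‖convOp (adjKer K) h y‖ₑ ^ q' ≤
      C * ∫⁻ x, ‖h x‖ₑ ^ q') {f : ℝ → E} (hf : Integrable f) :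
    ∫⁻ x, ‖convOp K f x‖ₑ ^ q ≤ (C : ℝ≥0∞) ^ (q - 1) * ∫⁻ x, ‖f x‖ₑ ^ q := by
  have hT := hK.nice_convOp hf
  set u := convOp K f with hu
  have hX := hT.lintegral_rpow_ne_top (q := q) (by linarith)
  set X := ∫⁻ x, ‖u x‖ₑ ^ q with hXdef
  let h : ℝ → F := fun x => (((‖u x‖ ^ (q - 2) : ℝ)) : ℂ) • u x
  have hnh : ∀ x, ‖h x‖ = ‖u x‖ ^ (q - 1) := fun x => by
    rcases (norm_nonneg (u x)).eq_or_lt with h0 | h0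
    · simp [h, norm_smul, ← h0, Real.zero_rpow (by linarith : q - 1 ≠ 0)]
    · rw [norm_smul, Complex.norm_real, Real.norm_of_nonneg (by positivity)]
      nth_rw 2 [← Real.rpow_one ‖u x‖]
      rw [← Real.rpow_add h0]; congr 1; ring
  have hhc : Continuous h := by
    refine Continuous.smul (Complex.continuous_ofReal.comp ?_) hT.continuous
    exact hT.continuous.norm.rpow_const fun x => Or.inr (by linarith)
  obtain ⟨M, hM⟩ := hT.bounded
  have hh : Nice h := by
    refine ⟨hhc, ?_, M ^ (q - 1), fun x => ?_⟩
    · refine (hT.integrable.norm.const_mul (M ^ (q - 2))).mono hhc.aestronglyMeasurable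
        (Filter.Eventually.of_forall fun x => ?_)
      refine le_trans ?_ (le_abs_self _)
      rw [norm_smul, Complex.norm_real, Real.norm_of_nonneg (by positivity)]
      exact mul_le_mul_of_nonneg_right (Real.rpow_le_rpow (norm_nonneg _) (hM x) (by linarith))
        (norm_nonneg _)
    · rw [hnh]; exact Real.rpow_le_rpow (norm_nonneg _) (hM x) (by linarith)
  have hq0 : (0 : ℝ) < q := hqq.pos
  have hq'0 : (0 : ℝ) < q' := hqq.symm.pos
  have hhq : ∀ x, ‖h x‖ₑ ^ q' = ‖u x‖ₑ ^ q := fun x => by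
    rw [← ofReal_norm, hnh, ← ENNReal.ofReal_rpow_of_nonneg (norm_nonneg _) (by linarith),
      ofReal_norm, ← ENNReal.rpow_mul, hqq.sub_one_mul_conj]
  have e1 : X = ‖∫ x, inner ℂ (h x) (u x)‖ₑ := by
    have : ∀ x, inner ℂ (h x) (u x) = ((‖u x‖ ^ q : ℝ) : ℂ) := fun x => by
      rcases (norm_nonneg (u x)).eq_or_lt with h0 | h0
      · have h0' : u x = 0 := norm_eq_zero.1 h0.symm
        simp [h0', Real.zero_rpow hq0.ne']
      · simp only [h, inner_smul_left, Complex.conj_ofReal, inner_self_eq_norm_sq_to_K]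
        rw [show q = (q - 2) + (2 : ℕ) by push_cast; ring, Real.rpow_add h0, Real.rpow_natCast]
        push_cast
        ring_nf
        simp
    simp_rw [this]
    rw [integral_complex_ofReal, ← ofReal_norm, Complex.norm_real, Real.norm_of_nonneg (by positivity),
      integral_eq_lintegral_of_nonneg_ae (Filter.Eventually.of_forall fun x => by positivity)
        (hT.continuous.norm.rpow_const fun x => Or.inr hq0.le).aestronglyMeasurable]
    have e3 : ∀ x, ENNReal.ofReal (‖u x‖ ^ q) = ‖u x‖ₑ ^ q := fun x => by
      rw [← ENNReal.ofReal_rpow_of_nonneg (norm_nonneg _) hq0.le, ofReal_norm]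
    simp_rw [e3]
    rw [ENNReal.ofReal_toReal hX]
  have hX2 : X ≤ (C * X) ^ (1 / q') * (∫⁻ x, ‖f x‖ₑ ^ q) ^ (1 / q) := by
    have hT' := hK.adj.nice_convOp hh.integrable
    calc X = ‖∫ y, inner ℂ (convOp (adjKer K) h y) (f y)‖ₑ := by
          rw [e1, hK.integral_inner_convOp hf hh.integrable]
      _ ≤ ∫⁻ y, ‖inner ℂ (convOp (adjKer K) h y) (f y)‖ₑ :=
          enorm_integral_le_lintegral_enorm _
      _ ≤ ∫⁻ y, ‖convOp (adjKer K) h y‖ₑ * ‖f y‖ₑ :=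
          lintegral_mono fun y => by
            rw [← ofReal_norm, ← ofReal_norm, ← ofReal_norm, ← ENNReal.ofReal_mul (norm_nonneg _)]
            exact ENNReal.ofReal_le_ofReal (norm_inner_le_norm _ _)
      _ ≤ (∫⁻ y, ‖convOp (adjKer K) h y‖ₑ ^ q') ^ (1 / q') *
          (∫⁻ x, ‖f x‖ₑ ^ q) ^ (1 / q) :=
          ENNReal.lintegral_mul_le_Lp_mul_Lq _ hqq.symm hT'.continuous.enorm.measurable.aemeasurable
            hf.aestronglyMeasurable.enorm
      _ ≤ _ := by
          gcongr
          refine (hC h hh).trans_eq ?_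
          simp_rw [hhq]; rfl
  rcases eq_or_ne X 0 with hX0 | hX0
  · rw [hX0]; exact zero_le
  rw [ENNReal.mul_rpow_of_nonneg _ _ (by positivity)] at hX2
  have hXq : X ^ (1 / q) ≤ (C : ℝ≥0∞) ^ (1 / q') * (∫⁻ x, ‖f x‖ₑ ^ q) ^ (1 / q) := by
    have hpos : X ^ (1 / q') ≠ 0 := by simp [hX0, hX]
    have hfin : X ^ (1 / q') ≠ ∞ := by simp [hX0, hX]
    rw [← ENNReal.mul_le_mul_iff_right hpos hfin, ← ENNReal.rpow_add _ _ hX0 hX]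
    have : 1 / q' + 1 / q = 1 := by
      have := hqq.inv_add_inv_eq_one; rw [one_div, one_div]; linarith
    rw [this, ENNReal.rpow_one]
    exact hX2.trans_eq (by ring)
  have := ENNReal.rpow_le_rpow hXq hq0.le
  rw [ENNReal.mul_rpow_of_nonneg _ _ hq0.le, ← ENNReal.rpow_mul, ← ENNReal.rpow_mul,
    ← ENNReal.rpow_mul, one_div_mul_cancel hq0.ne', ENNReal.rpow_one, ENNReal.rpow_one] at this
  have e : 1 / q' * q = q - 1 := by
    have := hqq.inv_add_inv_eq_one
    field_simp at this ⊢
    linarith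
  rwa [e] at this

lemma IsCZ.adj {K : ℝ → E →L[ℂ] F} {B : ℝ≥0} (hK : IsCZ K B) : IsCZ (adjKer K) B := by
  refine ⟨hK.nice.adj, fun f hf hfb => ?_, fun y => ?_⟩
  · have := hK.nice.adj.lintegral_convOp_rpow_le_of_adjKer (q := 2) (q' := 2) le_rfl
      (Real.HolderConjugate.two_two) (C := B) (fun h hh => by
        rw [adjKer_adjKer]; exact hK.l2 h hh.integrable hh.bounded) hf
    rwa [show (2 : ℝ) - 1 = 1 by norm_num, ENNReal.rpow_one] at this
  · have h1 := hK.hormander (-y)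
    have hm : ∀ z : ℝ, MeasurableSet {x : ℝ | 2 * |z| ≤ |x|} := fun z =>
      measurableSet_le measurable_const measurable_norm
    rw [← lintegral_indicator (hm _)] at h1 ⊢
    rw [← lintegral_neg_eq_self] at h1
    refine le_trans (lintegral_mono fun x => ?_) h1
    simp only [indicator, mem_ofPred_eq, abs_neg]
    split_ifs
    · rw [adjKer, adjKer, ← map_sub, ← ofReal_norm, ← ofReal_norm,
        LinearIsometryEquiv.norm_map, neg_sub, sub_neg_eq_add, sub_eq_add_neg y x, add_comm y]
    · exact le_rfl

end Adjoint

/-- `L^q` bounds for Calderón–Zygmund operators, `1 < q < ∞`. -/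
lemma exists_eLpNorm_convOp_le {q : ℝ} (hq : 1 < q) :
    ∃ C : ℝ≥0, ∀ (E F : Type) [NormedAddCommGroup E] [InnerProductSpace ℂ E] [CompleteSpace E]
      [NormedAddCommGroup F] [InnerProductSpace ℂ F] [CompleteSpace F]
      (K : ℝ → E →L[ℂ] F) (B : ℝ≥0), IsCZ K B → ∀ f : ℝ → E, Nice f →
      eLpNorm (convOp K f) (ENNReal.ofReal q) volume ≤
        C * (1 + B) * eLpNorm f (ENNReal.ofReal q) volume := by
  have hq0 : 0 < q := by linarith
  have key : ∀ (E F : Type) [NormedAddCommGroup E] [NormedAddCommGroup F] (f : ℝ → E) (g : ℝ → F)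
      (D : ℝ≥0∞), ∫⁻ x, ‖g x‖ₑ ^ q ≤ D ^ q * ∫⁻ x, ‖f x‖ₑ ^ q →
      eLpNorm g (ENNReal.ofReal q) volume ≤ D * eLpNorm f (ENNReal.ofReal q) volume := by
    intro E F _ _ f g D h
    rw [eLpNorm_eq_lintegral_rpow_enorm_toReal (by simpa using hq0) (by simp),
      eLpNorm_eq_lintegral_rpow_enorm_toReal (by simpa using hq0) (by simp),
      ENNReal.toReal_ofReal hq0.le]
    have := ENNReal.rpow_le_rpow h (z := 1 / q) (by positivity)
    rwa [ENNReal.mul_rpow_of_nonneg _ _ (by positivity), ← ENNReal.rpow_mul,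
      mul_one_div_cancel hq0.ne', ENNReal.rpow_one] at this
  have pw : ∀ (D : ℝ≥0∞) (r : ℝ), 1 ≤ D → 1 ≤ r → D ≤ D ^ r := fun D r h1 h2 => by
    simpa using ENNReal.rpow_le_rpow_of_exponent_le h1 h2
  rcases lt_trichotomy q 2 with h2 | h2 | h2
  · obtain ⟨C, hC⟩ := exists_lintegral_convOp_rpow_le_of_lt_two hq h2
    refine ⟨1 + C, fun E F _ _ _ _ _ _ K B hK f hf => key _ _ _ _ _ ((hC E F K B hK f hf).trans ?_)⟩
    gcongr
    refine le_trans ?_ (pw _ q ?_ hq.le)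
    · gcongr; exact le_add_self
    · push_cast
      calc (1 : ℝ≥0∞) = 1 * 1 := (mul_one 1).symm
        _ ≤ _ := mul_le_mul' (le_add_right le_rfl) (le_add_right le_rfl)
  · subst h2
    refine ⟨1, fun E F _ _ _ _ _ _ K B hK f hf => key _ _ _ _ _
      ((hK.l2 f hf.integrable hf.bounded).trans ?_)⟩
    gcongr
    refine le_trans ?_ (pw _ 2 ?_ (by norm_num))
    · simp
    · simp
  · have hqq := (Real.HolderConjugate.conjExponent hq)
    set q' := q.conjExponent
    have hq'1 : 1 < q' := hqq.symm.lt
    have hq'2 : q' < 2 := by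
      have := hqq.inv_add_inv_eq_one
      have h3 : q⁻¹ < 2⁻¹ := by gcongr
      have h4 : 2⁻¹ < q'⁻¹ := by linarith
      exact (inv_lt_inv₀ (by norm_num) (by linarith)).1 h4
    obtain ⟨C, hC⟩ := exists_lintegral_convOp_rpow_le_of_lt_two hq'1 hq'2
    refine ⟨1 + C, fun E F _ _ _ _ _ _ K B hK f hf => key _ _ _ _ _
      ((hK.nice.lintegral_convOp_rpow_le_of_adjKer h2.le hqq (C := C * (1 + B)) (fun h hh => by
        exact_mod_cast hC F E _ B hK.adj h hh) hf.integrable).trans ?_)⟩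
    gcongr
    have h1 : (1 : ℝ≥0∞) ≤ ((1 + C : ℝ≥0) : ℝ≥0∞) * (1 + B) := by
      push_cast
      calc (1 : ℝ≥0∞) = 1 * 1 := (mul_one 1).symm
        _ ≤ _ := mul_le_mul' (le_add_right le_rfl) (le_add_right le_rfl)
    refine le_trans (ENNReal.rpow_le_rpow ?_ (by linarith))
      (ENNReal.rpow_le_rpow_of_exponent_le h1 (by linarith : q - 1 ≤ q))
    push_cast
    gcongr
    exact le_add_self

end CoifmanMeyer

namespace CoifmanMeyer
open Set
open scoped FourierTransform ContDiff

/-- The character `t ↦ e^{2πit}`. -/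
noncomputable def ch (t : ℝ) : ℂ := Complex.exp (2 * π * Complex.I * t)

lemma ch_add (a b : ℝ) : ch (a + b) = ch a * ch b := by
  rw [ch, ch, ch, ← Complex.exp_add]; push_cast; ring_nf

@[simp] lemma norm_ch (t : ℝ) : ‖ch t‖ = 1 := by
  rw [ch, show (2 * π * Complex.I * t : ℂ) = ((2 * π * t : ℝ) : ℂ) * Complex.I by push_cast; ring,
    Complex.norm_exp_ofReal_mul_I]

@[simp] lemma enorm_ch (t : ℝ) : ‖ch t‖ₑ = 1 := by rw [← ofReal_norm]; simp

@[fun_prop] lemma continuous_ch : Continuous ch := by unfold ch; fun_prop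

lemma fourier_eq_ch (f : ℝ → ℂ) (ξ : ℝ) : 𝓕 f ξ = ∫ x, ch (-(x * ξ)) * f x := by
  rw [Real.fourier_real_eq_integral_exp_smul]
  congr 1; ext x
  rw [ch, smul_eq_mul]; congr 2; push_cast; ring

lemma fourierInv_eq_ch (f : ℝ → ℂ) (x : ℝ) : 𝓕⁻ f x = ∫ ξ, ch (x * ξ) * f ξ := by
  rw [Real.fourierInv_eq_fourier_neg, fourier_eq_ch]
  congr 1; ext ξ; congr 2; ring

lemma norm_fourier_le (f : ℝ → ℂ) (ξ : ℝ) : ‖𝓕 f ξ‖ ≤ ∫ x, ‖f x‖ := by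
  rw [fourier_eq_ch]
  refine (norm_integral_le_integral_norm _).trans_eq ?_
  simp

lemma continuous_fourier {f : ℝ → ℂ} (hf : Integrable f) : Continuous (𝓕 f) := by
  have : 𝓕 f = fun ξ => ∫ x, ch (-(x * ξ)) * f x := funext (fourier_eq_ch f)
  rw [this]
  refine continuous_of_dominated (bound := fun x => ‖f x‖) (fun ξ => ?_) (fun ξ => ?_) hf.norm ?_
  · exact (by fun_prop : Continuous fun x => ch (-(x * ξ))).aestronglyMeasurable.mul
      hf.aestronglyMeasurable
  · exact Filter.Eventually.of_forall fun x => by simp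
  · exact Filter.Eventually.of_forall fun x => by fun_prop

lemma memLp_two_of_bounded {h : ℝ → ℂ} (h1 : Integrable h) {M : ℝ} (hM : ∀ x, ‖h x‖ ≤ M) :
    MemLp h 2 := by
  rw [memLp_two_iff_integrable_sq_norm h1.aestronglyMeasurable]
  refine (h1.norm.const_mul M).mono (h1.aestronglyMeasurable.norm.pow 2)
    (Filter.Eventually.of_forall fun x => ?_)
  rw [Real.norm_of_nonneg (by positivity), sq]
  exact (mul_le_mul_of_nonneg_right (hM x) (norm_nonneg _)).trans (le_abs_self _)

/-- Plancherel's theorem for integrable square-integrable functions. -/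
lemma lintegral_enorm_fourier_sq {h : ℝ → ℂ} (h1 : Integrable h) (h2 : MemLp h 2) :
    ∫⁻ ξ, ‖𝓕 h ξ‖ₑ ^ (2 : ℝ) = ∫⁻ x, ‖h x‖ₑ ^ (2 : ℝ) := by
  set H : Lp (α := ℝ) ℂ 2 volume := h2.toLp h with hH
  have hHh : H =ᵐ[volume] h := h2.coeFn_toLp
  have hflip : ∀ g : SchwartzMap ℝ ℂ, ∫ x, g x * (𝓕 H : Lp (α := ℝ) ℂ 2 volume) x = ∫ x, g x * 𝓕 h x := by
    intro g
    have e := congrArg (fun T => T g) (Lp.fourier_toTemperedDistribution_eq H)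
    simp only [TemperedDistribution.fourier_apply, Lp.toTemperedDistribution_apply,
      smul_eq_mul] at e
    rw [← e]
    have e2 : ∫ x, (𝓕 g : SchwartzMap ℝ ℂ) x * H x = ∫ x, 𝓕 (g : ℝ → ℂ) x * h x := by
      refine integral_congr_ae ?_
      filter_upwards [hHh] with x hx
      rw [hx, SchwartzMap.fourier_coe]
    rw [e2]
    simpa using! (VectorFourier.integral_fourierIntegral_smul_eq_flip (L := innerₗ ℝ)
      (e := Real.fourierChar) (f := g) (g := h) (μ := volume) (ν := volume)
      Real.continuous_fourierChar continuous_inner g.integrable h1)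
  have hae : (𝓕 H : Lp (α := ℝ) ℂ 2 volume) =ᵐ[volume] 𝓕 h := by
    refine ae_eq_of_integral_contDiff_smul_eq ((Lp.memLp (𝓕 H)).locallyIntegrable (by norm_num))
      (continuous_fourier h1).locallyIntegrable fun g hg hgc => ?_
    have hg' : ContDiff ℝ ∞ (fun x => (g x : ℂ)) := Complex.ofRealCLM.contDiff.comp hg
    have hgc' : HasCompactSupport (fun x => (g x : ℂ)) := hgc.comp_left (g := Complex.ofReal) rfl
    have := hflip (hgc'.toSchwartzMap hg')
    simpa using! this
  have hn := Lp.norm_fourier_eq H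
  rw [Lp.norm_def, Lp.norm_def, ENNReal.toReal_eq_toReal_iff' (Lp.eLpNorm_ne_top _)
    (Lp.eLpNorm_ne_top _), eLpNorm_congr_ae hae, eLpNorm_congr_ae hHh,
    eLpNorm_eq_lintegral_rpow_enorm_toReal (by simp) (by simp),
    eLpNorm_eq_lintegral_rpow_enorm_toReal (by simp) (by simp)] at hn
  simp only [ENNReal.toReal_ofNat] at hn
  exact (ENNReal.rpow_left_injective (by norm_num : (1 / 2 : ℝ) ≠ 0)) hn

/-- A Fourier multiplier with integrable symbol is convolution with the inverse transform. -/
lemma fourierInv_mul_fourier {m f : ℝ → ℂ} (hm : Integrable m) (hf : Integrable f) (x : ℝ) :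
    𝓕⁻ (fun ξ => m ξ * 𝓕 f ξ) x = ∫ y, 𝓕⁻ m (x - y) * f y := by
  have e1 : ∀ ξ, ch (x * ξ) * (m ξ * 𝓕 f ξ) =
      ∫ y, ch ((x - y) * ξ) * m ξ * f y := fun ξ => by
    rw [fourier_eq_ch, ← mul_assoc, ← integral_const_mul]
    congr 1; ext y
    rw [show (x - y) * ξ = x * ξ + -(y * ξ) by ring, ch_add]; ring
  have e2 : ∀ y, 𝓕⁻ m (x - y) * f y = ∫ ξ, ch ((x - y) * ξ) * m ξ * f y := fun y => by
    rw [fourierInv_eq_ch, integral_mul_const]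
  rw [fourierInv_eq_ch]
  simp_rw [e1, e2]
  refine integral_integral_swap ((hm.mul_prod hf).mono ?_ ?_)
  · refine AEStronglyMeasurable.mul (AEStronglyMeasurable.mul ?_ hm.aestronglyMeasurable.comp_fst)
      hf.aestronglyMeasurable.comp_snd
    exact (by fun_prop : Continuous fun z : ℝ × ℝ => ch ((x - z.2) * z.1)).aestronglyMeasurable
  · exact Filter.Eventually.of_forall fun z => by simp [Function.uncurry]

lemma fourierInv_dilate (m : ℝ → ℂ) {s : ℝ} (hs : 0 < s) (u z : ℝ) :
    𝓕⁻ (fun ξ => m (ξ / s) * ch (u * (ξ / s))) z = s * 𝓕⁻ m (s * z + u) := by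
  rw [fourierInv_eq_ch, fourierInv_eq_ch]
  have := Measure.integral_comp_div (fun ξ => ch ((s * z + u) * ξ) * m ξ) s
  rw [abs_of_pos hs, Complex.real_smul] at this
  rw [← this]
  congr 1; ext ξ
  have e : (s * z + u) * (ξ / s) = z * ξ + u * (ξ / s) := by field_simp
  rw [e, ch_add]; ring

/-- The `L²` bound for a Fourier multiplier with bounded integrable symbol. -/
lemma lintegral_enorm_conv_sq_le {m f : ℝ → ℂ} (hm : Integrable m) {M : ℝ} (hmM : ∀ ξ, ‖m ξ‖ ≤ M)
    (hf : Integrable f) :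
    ∫⁻ x, ‖∫ y, 𝓕⁻ m (x - y) * f y‖ₑ ^ (2 : ℝ) = ∫⁻ ξ, ‖m ξ * 𝓕 f ξ‖ₑ ^ (2 : ℝ) := by
  have hfc := continuous_fourier hf
  have hb := norm_fourier_le f
  have hmi : Integrable fun ξ => m ξ * 𝓕 f ξ :=
    hm.mul_bdd (c := ∫ x, ‖f x‖) hfc.aestronglyMeasurable (Filter.Eventually.of_forall hb)
  have hmi2 : MemLp (fun ξ => m ξ * 𝓕 f ξ) 2 :=
    memLp_two_of_bounded hmi (M := M * ∫ x, ‖f x‖) fun ξ => by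
      rw [norm_mul]
      exact mul_le_mul (hmM ξ) (hb ξ) (norm_nonneg _) ((norm_nonneg _).trans (hmM 0))
  simp_rw [← fourierInv_mul_fourier hm hf, Real.fourierInv_eq_fourier_neg]
  rw [lintegral_neg_eq_self (fun x => ‖𝓕 (fun ξ => m ξ * 𝓕 f ξ) x‖ₑ ^ (2 : ℝ)),
    lintegral_enorm_fourier_sq hmi hmi2]

lemma fourierInv_gaussian (x : ℝ) :
    𝓕⁻ (fun ξ : ℝ => (Real.exp (-π * ξ ^ 2) : ℂ)) x = Real.exp (-π * x ^ 2) := by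
  have h := congrFun (fourier_gaussian_pi (b := 1) (by simp)) (-x)
  rw [Real.fourierInv_eq_fourier_neg]
  push_cast
  simpa using h

lemma integrable_pow_mul_gaussian (n : ℕ) :
    Integrable fun x : ℝ => x ^ n * Real.exp (-π * x ^ 2) := by
  have := integrable_rpow_mul_exp_neg_mul_sq (b := π) Real.pi_pos (s := n)
    (by have := n.cast_nonneg (α := ℝ); linarith)
  simpa using this

lemma fourierInv_id_mul_gaussian (x : ℝ) :
    𝓕⁻ (fun ξ : ℝ => ((ξ * Real.exp (-π * ξ ^ 2) : ℝ) : ℂ)) x =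
      Complex.I * ((x * Real.exp (-π * x ^ 2) : ℝ) : ℂ) := by
  have hd : ∀ x : ℝ, HasDerivAt (fun ξ : ℝ => (Real.exp (-π * ξ ^ 2) : ℂ))
      (-2 * π * ((x * Real.exp (-π * x ^ 2) : ℝ) : ℂ)) x := fun x => by
    have h1 : HasDerivAt (fun ξ : ℝ => Real.exp (-π * ξ ^ 2))
        (Real.exp (-π * x ^ 2) * (-π * (2 * x))) x := by
      have := ((hasDerivAt_pow 2 x).const_mul (-π)).exp
      simpa using this
    convert h1.ofReal_comp using 1
    push_cast; ring
  have hg : Integrable fun ξ : ℝ => (Real.exp (-π * ξ ^ 2) : ℂ) := by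
    have := (integrable_pow_mul_gaussian 0).ofReal (𝕜 := ℂ)
    simp only [pow_zero, one_mul] at this
    exact this
  have hg1 : Integrable fun ξ : ℝ => ((ξ * Real.exp (-π * ξ ^ 2) : ℝ) : ℂ) := by
    have := (integrable_pow_mul_gaussian 1).ofReal (𝕜 := ℂ)
    simp only [pow_one] at this
    exact this
  have hde : deriv (fun ξ : ℝ => (Real.exp (-π * ξ ^ 2) : ℂ)) =
      fun x => -2 * π * ((x * Real.exp (-π * x ^ 2) : ℝ) : ℂ) := funext fun x => (hd x).deriv
  have h := congrFun (Real.fourier_deriv hg (fun x => (hd x).differentiableAt)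
    (by rw [hde]; exact hg1.const_mul _)) (-x)
  rw [hde] at h
  have h3 := fourierInv_gaussian x
  rw [Real.fourierInv_eq_fourier_neg] at h3 ⊢
  rw [h3] at h
  have h4 : 𝓕 (fun x : ℝ => -2 * π * ((x * Real.exp (-π * x ^ 2) : ℝ) : ℂ)) (-x) =
      -2 * π * 𝓕 (fun x : ℝ => ((x * Real.exp (-π * x ^ 2) : ℝ) : ℂ)) (-x) := by
    rw [fourier_eq_ch, fourier_eq_ch, ← integral_const_mul]
    congr 1; ext y; ring
  rw [h4] at h
  have hpi : (-2 * π : ℂ) ≠ 0 := by simp [Real.pi_ne_zero]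
  refine mul_left_cancel₀ hpi (h.trans ?_)
  simp only [smul_eq_mul]
  push_cast; ring

end CoifmanMeyer

namespace CoifmanMeyer
open Set

section column

variable {ι : Type} [Fintype ι]

/-- The column operator kernel with scalar entries `k j`. -/
noncomputable def colKer (k : ι → ℝ → ℂ) (x : ℝ) : ℂ →L[ℂ] EuclideanSpace ℂ ι :=
  ContinuousLinearMap.toSpanSingleton ℂ (WithLp.toLp 2 fun j => k j x)

lemma norm_toLp_le_sum (v : ι → ℂ) : ‖WithLp.toLp 2 v‖ ≤ ∑ j, ‖v j‖ := by
  rw [EuclideanSpace.norm_eq]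
  refine Real.sqrt_le_iff.2 ⟨Finset.sum_nonneg fun _ _ => norm_nonneg _, ?_⟩
  exact Finset.sum_sq_le_sq_sum_of_nonneg fun _ _ => norm_nonneg _

lemma norm_colKer_le (k : ι → ℝ → ℂ) (x : ℝ) : ‖colKer k x‖ ≤ ∑ j, ‖k j x‖ := by
  rw [colKer, ContinuousLinearMap.norm_toSpanSingleton]
  exact norm_toLp_le_sum _

lemma colKer_sub (k : ι → ℝ → ℂ) (x y : ℝ) :
    colKer k x - colKer k y = ContinuousLinearMap.toSpanSingleton ℂ
      (WithLp.toLp 2 fun j => k j x - k j y) := by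
  ext j; simp [colKer]

lemma nice_colKer {k : ι → ℝ → ℂ} (hk : ∀ j, Nice (k j)) : Nice (colKer k) := by
  have hc : Continuous (colKer k) := by
    have h : Continuous fun x => WithLp.toLp 2 fun j => k j x :=
      (PiLp.continuous_toLp 2 _).comp (continuous_pi fun j => (hk j).continuous)
    have e : colKer k = fun x => (ContinuousLinearMap.toSpanSingletonCLE (𝕜 := ℂ))
      (WithLp.toLp 2 fun j => k j x) := by
      ext; simp [colKer]
    rw [e]
    exact (ContinuousLinearEquiv.continuous _).comp h
  refine ⟨hc, ?_, ?_⟩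
  · refine (integrable_finsetSum Finset.univ fun j _ => (hk j).integrable.norm).mono'
      hc.aestronglyMeasurable (Filter.Eventually.of_forall fun x => norm_colKer_le k x)
  · choose M hM using fun j => (hk j).bounded
    exact ⟨∑ j, M j, fun x => (norm_colKer_le k x).trans (Finset.sum_le_sum fun j _ => hM j x)⟩

lemma convOp_colKer_apply {k : ι → ℝ → ℂ} (hk : ∀ j, Nice (k j)) {f : ℝ → ℂ} (hf : Integrable f)
    (x : ℝ) (j : ι) : convOp (colKer k) f x j = ∫ y, k j (x - y) * f y := by
  have h := (EuclideanSpace.proj j : EuclideanSpace ℂ ι →L[ℂ] ℂ).integral_comp_comm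
    ((nice_colKer hk).integrable_apply hf x)
  refine h.symm.trans ?_
  congr 1; ext y
  simp [colKer, mul_comm]

lemma enorm_euclidean_sq (v : EuclideanSpace ℂ ι) :
    ‖v‖ₑ ^ (2 : ℝ) = ∑ j, ‖v j‖ₑ ^ (2 : ℝ) := by
  have h := EuclideanSpace.norm_sq_eq v
  rw [← ofReal_norm, ENNReal.ofReal_rpow_of_nonneg (norm_nonneg _) (by norm_num),
    Real.rpow_two, h, ENNReal.ofReal_sum_of_nonneg fun _ _ => by positivity]
  refine Finset.sum_congr rfl fun j _ => ?_
  rw [← ofReal_norm, ENNReal.ofReal_rpow_of_nonneg (norm_nonneg _) (by norm_num), Real.rpow_two]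

lemma adjKer_colKer_apply (k : ι → ℝ → ℂ) (x : ℝ) (v : EuclideanSpace ℂ ι) :
    adjKer (colKer k) x v = ∑ j, (starRingEnd ℂ) (k j (-x)) * v j := by
  refine ext_inner_left ℂ fun w => ?_
  rw [adjKer, ContinuousLinearMap.adjoint_inner_right]
  simp only [colKer, ContinuousLinearMap.toSpanSingleton_apply, PiLp.inner_apply, inner_smul_left]
  simp [Finset.mul_sum, mul_comm, mul_left_comm]

lemma convOp_adjKer_colKer {k : ι → ℝ → ℂ} (hk : ∀ j, Nice (k j))
    (hs : ∀ j x, (starRingEnd ℂ) (k j (-x)) = k j x) {H : ℝ → EuclideanSpace ℂ ι}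
    (hH : Integrable H) (x : ℝ) :
    convOp (adjKer (colKer k)) H x = ∑ j, ∫ y, k j (x - y) * H y j := by
  rw [convOp, ← integral_finsetSum]
  · congr 1; ext y
    rw [adjKer_colKer_apply]
    simp_rw [hs]
  · intro j _
    have hHj : Integrable fun y => H y j :=
      (EuclideanSpace.proj j : EuclideanSpace ℂ ι →L[ℂ] ℂ).integrable_comp hH
    obtain ⟨M, hM⟩ := (hk j).bounded
    refine hHj.bdd_mul (c := M) ?_ (Filter.Eventually.of_forall fun y => hM _)
    exact ((hk j).continuous.comp (by fun_prop)).aestronglyMeasurable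

end column

/-- The Gaussian. -/
noncomputable def gauss (t : ℝ) : ℝ := Real.exp (-π * t ^ 2)

/-- The Gaussian multiplied by its variable. -/
noncomputable def gaussD (t : ℝ) : ℝ := t * Real.exp (-π * t ^ 2)

lemma sq_mul_gauss_le (t : ℝ) : t ^ 2 * Real.exp (-π * t ^ 2) ≤ 1 := by
  have h1 := Real.add_one_le_exp (π * t ^ 2)
  rw [show -π * t ^ 2 = -(π * t ^ 2) by ring, Real.exp_neg, mul_inv_le_iff₀ (Real.exp_pos _), one_mul]
  nlinarith [Real.pi_gt_three, sq_nonneg t]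

lemma gauss_le_one (t : ℝ) : Real.exp (-π * t ^ 2) ≤ 1 := by
  rw [Real.exp_le_one_iff]; nlinarith [Real.pi_pos, sq_nonneg t]

lemma abs_gaussD_le (t : ℝ) : |gaussD t| ≤ |t| := by
  rw [gaussD, abs_mul, abs_of_pos (Real.exp_pos _)]
  exact mul_le_of_le_one_right (abs_nonneg _) (gauss_le_one t)

lemma abs_mul_abs_gaussD_le (t : ℝ) : |t| * |gaussD t| ≤ 1 := by
  rw [gaussD, abs_mul, abs_of_pos (Real.exp_pos _), ← mul_assoc, ← sq, sq_abs]
  exact sq_mul_gauss_le t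

lemma abs_gaussD_le_one (t : ℝ) : |gaussD t| ≤ 1 := by
  rcases le_total |t| 1 with h | h
  · exact (abs_gaussD_le t).trans h
  · nlinarith [abs_mul_abs_gaussD_le t, abs_nonneg (gaussD t)]

@[fun_prop] lemma continuous_gaussD : Continuous gaussD := by unfold gaussD; fun_prop

@[fun_prop] lemma continuous_gauss : Continuous gauss := by unfold gauss; fun_prop

lemma integrable_gaussD : Integrable gaussD := by
  simpa only [gaussD, pow_one] using! integrable_pow_mul_gaussian 1

lemma integrable_gauss : Integrable gauss := by
  simpa only [gauss, pow_zero, one_mul] using! integrable_pow_mul_gaussian 0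

lemma hasDerivAt_gaussD (t : ℝ) :
    HasDerivAt gaussD ((1 - 2 * π * t ^ 2) * Real.exp (-π * t ^ 2)) t := by
  have h1 : HasDerivAt (fun t : ℝ => -π * t ^ 2) (-π * (2 * t)) t := by
    simpa using (hasDerivAt_pow 2 t).const_mul (-π)
  have := (hasDerivAt_id t).mul h1.exp
  refine this.congr_deriv ?_
  simp; ring

lemma integrable_deriv_gaussD :
    Integrable fun t : ℝ => (1 - 2 * π * t ^ 2) * Real.exp (-π * t ^ 2) := by
  have := (integrable_pow_mul_gaussian 0).sub ((integrable_pow_mul_gaussian 2).const_mul (2 * π))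
  refine this.congr (Filter.Eventually.of_forall fun t => ?_)
  simp; ring

lemma lintegral_comp_affine (f : ℝ → ℝ≥0∞) (hf : Measurable f) {s : ℝ} (hs : 0 < s) (u : ℝ) :
    ∫⁻ x, ENNReal.ofReal s * f (s * x + u) = ∫⁻ x, f x := by
  rw [lintegral_const_mul _ (by fun_prop),
    ← lintegral_add_right_eq_self f u]
  have h := Real.map_volume_mul_left (a := s) hs.ne'
  have h2 := lintegral_map (μ := volume) (f := fun x => f (x + u)) (g := fun x => s * x)
    (by fun_prop) (by fun_prop)
  rw [← h2, h, lintegral_smul_measure, smul_eq_mul, ← mul_assoc, ← ENNReal.ofReal_mul hs.le,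
    abs_of_pos (inv_pos.2 hs), mul_inv_cancel₀ hs.ne']
  simp

/-- The `L¹` modulus of continuity is controlled by the derivative. -/
lemma lintegral_enorm_sub_le {h h' : ℝ → ℝ} (hd : ∀ x, HasDerivAt h (h' x) x)
    (hc : Continuous h') (y : ℝ) :
    ∫⁻ x, ‖h (x - y) - h x‖ₑ ≤ ‖y‖ₑ * ∫⁻ x, ‖h' x‖ₑ := by
  have hm := hc.measurable
  have key : ∀ x, ‖h (x - y) - h x‖ₑ ≤ ∫⁻ t in Icc (0 : ℝ) 1, ‖y‖ₑ * ‖h' (x - t * y)‖ₑ := by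
    intro x
    have hd2 : ∀ t : ℝ, HasDerivAt (fun t => h (x - t * y)) (h' (x - t * y) * (-y)) t := fun t => by
      have h1 : HasDerivAt (fun t : ℝ => x - t * y) (-y) t := by
        simpa using ((hasDerivAt_id t).mul_const y).const_sub x
      exact (hd _).comp t h1
    have := intervalIntegral.integral_eq_sub_of_hasDerivAt (a := 0) (b := 1) (fun t _ => hd2 t)
      ((by fun_prop : Continuous fun t => h' (x - t * y) * (-y)).intervalIntegrable _ _)
    simp only [one_mul, zero_mul, sub_zero] at this
    rw [← this, intervalIntegral.integral_of_le zero_le_one, ← integral_Icc_eq_integral_Ioc]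
    refine (enorm_integral_le_lintegral_enorm _).trans_eq ?_
    congr 1; ext t
    rw [enorm_mul, enorm_neg, mul_comm]
  calc ∫⁻ x, ‖h (x - y) - h x‖ₑ
      ≤ ∫⁻ x, ∫⁻ t in Icc (0 : ℝ) 1, ‖y‖ₑ * ‖h' (x - t * y)‖ₑ := lintegral_mono key
    _ = ∫⁻ t in Icc (0 : ℝ) 1, ∫⁻ x, ‖y‖ₑ * ‖h' (x - t * y)‖ₑ :=
        lintegral_lintegral_swap (by
          refine Measurable.aemeasurable ?_
          simp only [Function.uncurry_def]
          fun_prop)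
    _ = ∫⁻ t in Icc (0 : ℝ) 1, ‖y‖ₑ * ∫⁻ x, ‖h' x‖ₑ := by
        congr 1; ext t
        rw [lintegral_const_mul _ (by fun_prop),
          lintegral_sub_right_eq_self (fun x => ‖h' x‖ₑ)]
    _ = _ := by simp

end CoifmanMeyer

namespace CoifmanMeyer
open Set
open scoped FourierTransform

lemma sum_half_pow_natAbs_le (J : Finset ℤ) : ∑ k ∈ J, (1 / 2 : ℝ) ^ k.natAbs ≤ 4 := by
  have h1 : ∀ S : Finset ℤ, Set.InjOn Int.natAbs (S : Set ℤ) → ∑ k ∈ S, (1 / 2 : ℝ) ^ k.natAbs ≤ 2 := by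
    intro S hS
    rw [← Finset.sum_image (f := fun n : ℕ => (1 / 2 : ℝ) ^ n) hS]
    exact (summable_geometric_two.sum_le_tsum _ fun _ _ => by positivity).trans_eq
      tsum_geometric_two
  rw [← Finset.sum_filter_add_sum_filter_not J (fun k => 0 ≤ k)]
  have a := h1 (J.filter fun k => 0 ≤ k) (by intro x hx y hy h; simp at hx hy; omega)
  have b := h1 (J.filter fun k => ¬ 0 ≤ k) (by intro x hx y hy h; simp at hx hy; omega)
  linarith

lemma sum_min_dyadic_le (J : Finset ℤ) {r : ℝ} (hr : 0 < r) :
    ∑ j ∈ J, min ((2 : ℝ) ^ j * r) (1 / ((2 : ℝ) ^ j * r)) ≤ 8 := by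
  obtain ⟨n, hn1, hn2⟩ := exists_mem_Ico_zpow hr (one_lt_two (α := ℝ))
  have key : ∀ j : ℤ, min ((2 : ℝ) ^ j * r) (1 / ((2 : ℝ) ^ j * r)) ≤
      2 * (1 / 2 : ℝ) ^ (j + n).natAbs := by
    intro j
    have hj : (0 : ℝ) < 2 ^ j := by positivity
    rcases le_or_gt 0 (j + n) with h | h
    · refine (min_le_right _ _).trans ?_
      have e : (1 / 2 : ℝ) ^ (j + n).natAbs = 1 / (2 ^ j * 2 ^ n) := by
        rw [← zpow_add₀ (by norm_num : (2 : ℝ) ≠ 0), one_div_pow]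
        congr 1
        rw [← zpow_natCast]; congr 1; omega
      rw [e]
      have : 1 / (2 ^ j * r) ≤ 1 / ((2 : ℝ) ^ j * 2 ^ n) := by gcongr
      have h0 : 0 < 1 / ((2 : ℝ) ^ j * 2 ^ n) := by positivity
      linarith
    · refine (min_le_left _ _).trans ?_
      have e : (1 / 2 : ℝ) ^ (j + n).natAbs = 2 ^ j * 2 ^ n := by
        rw [← zpow_add₀ (by norm_num : (2 : ℝ) ≠ 0), one_div_pow, one_div, ← zpow_natCast, ← zpow_neg]
        congr 1; omega
      rw [e]
      rw [zpow_add_one₀ (by norm_num)] at hn2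
      nlinarith
  refine (Finset.sum_le_sum fun j _ => key j).trans ?_
  rw [← Finset.mul_sum]
  have := sum_half_pow_natAbs_le (J.map (addRightEmbedding n))
  rw [Finset.sum_map] at this
  simp only [addRightEmbedding_apply] at this
  linarith

/-- The kernel of the multiplier `ξ ↦ gaussD (ξ / s) * ch (u * (ξ / s))`. -/
noncomputable def ker (s u x : ℝ) : ℂ := s * (Complex.I * (gaussD (s * x + u) : ℂ))

lemma fourierInv_gaussD_dilate {s : ℝ} (hs : 0 < s) (u z : ℝ) :
    𝓕⁻ (fun ξ : ℝ => (gaussD (ξ / s) : ℂ) * ch (u * (ξ / s))) z = ker s u z := by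
  rw [fourierInv_dilate (fun ξ => (gaussD ξ : ℂ)) hs, ker]
  simp only [gaussD]
  rw [fourierInv_id_mul_gaussian]

lemma enorm_ker (s u x : ℝ) : ‖ker s u x‖ₑ = ‖s‖ₑ * ‖gaussD (s * x + u)‖ₑ := by
  simp only [ker, enorm_mul]
  have : ‖Complex.I‖ₑ = 1 := by rw [← ofReal_norm]; simp
  have h : ∀ r : ℝ, ‖(r : ℂ)‖ₑ = ‖r‖ₑ := fun r => by rw [← ofReal_norm, ← ofReal_norm]; simp
  rw [this, h, h, one_mul]

lemma enorm_ker_sub (s u x y : ℝ) : ‖ker s u (x - y) - ker s u x‖ₑ =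
    ‖s * gaussD (s * (x - y) + u) - s * gaussD (s * x + u)‖ₑ := by
  rw [← ofReal_norm, ← ofReal_norm]
  congr 1
  have : ker s u (x - y) - ker s u x = Complex.I *
    ((s * gaussD (s * (x - y) + u) - s * gaussD (s * x + u) : ℝ) : ℂ) := by
    simp only [ker]; push_cast; ring
  rw [this, norm_mul, Complex.norm_I, one_mul, Complex.norm_real]

lemma nice_ker {s : ℝ} (hs : 0 < s) (u : ℝ) : Nice (ker s u) := by
  refine ⟨by unfold ker; fun_prop, ?_, ⟨s, fun x => ?_⟩⟩
  · have h := ((integrable_gaussD.comp_add_right u).comp_mul_left' hs.ne')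
    exact (h.ofReal (𝕜 := ℂ)).const_mul Complex.I |>.const_mul (s : ℂ)
  · simp only [ker, norm_mul, Complex.norm_I, Complex.norm_real, one_mul]
    rw [Real.norm_of_nonneg hs.le]
    exact mul_le_of_le_one_right hs.le (abs_gaussD_le_one _)

lemma conj_ker_neg (s x : ℝ) : (starRingEnd ℂ) (ker s 0 (-x)) = ker s 0 x := by
  have : gaussD (s * -x + 0) = -gaussD (s * x + 0) := by simp [gaussD]
  simp only [ker, this, map_mul, Complex.conj_ofReal, Complex.conj_I, Complex.ofReal_neg, map_neg,
    neg_mul_neg]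

lemma exists_lintegral_ker_sub_le : ∃ c : ℝ≥0, ∀ s u y : ℝ, 0 < s → y ≠ 0 →
    ∫⁻ x in {x | 2 * |y| ≤ |x|}, ‖ker s u (x - y) - ker s u x‖ₑ ≤
      c * ENNReal.ofReal (1 + |u|) * ENNReal.ofReal (min (s * |y|) (1 / (s * |y|))) := by
  obtain ⟨c₁, hc₁⟩ : ∃ c : ℝ≥0, (∫⁻ t : ℝ, ‖(1 - 2 * π * t ^ 2) * Real.exp (-π * t ^ 2)‖ₑ) = c :=
    ⟨_, (ENNReal.coe_toNNReal integrable_deriv_gaussD.2.ne).symm⟩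
  have i2 : Integrable fun t : ℝ => (1 + |t|) * gaussD t := by
    have h1 := integrable_gaussD.norm.add (integrable_pow_mul_gaussian 2)
    refine h1.mono (by fun_prop) (Filter.Eventually.of_forall fun t => ?_)
    simp only [gaussD, Pi.add_apply, Real.norm_eq_abs, abs_mul, abs_of_pos (Real.exp_pos _)]
    rw [abs_of_nonneg (a := 1 + |t|) (by positivity)]
    refine le_of_eq_of_le ?_ (le_abs_self _)
    rw [← sq_abs t]; ring
  obtain ⟨c₂, hc₂⟩ : ∃ c : ℝ≥0, (∫⁻ t : ℝ, ‖(1 + |t|) * gaussD t‖ₑ) = c :=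
    ⟨_, (ENNReal.coe_toNNReal i2.2.ne).symm⟩
  refine ⟨c₁ + 2 * c₂, fun s u y hs hy => ?_⟩
  have hy0 : 0 < |y| := abs_pos.2 hy
  have hu1 : (1 : ℝ≥0∞) ≤ ENNReal.ofReal (1 + |u|) := by
    rw [ENNReal.one_le_ofReal]; linarith [abs_nonneg u]
  have B1 : ∫⁻ x in {x | 2 * |y| ≤ |x|}, ‖ker s u (x - y) - ker s u x‖ₑ ≤
      c₁ * ENNReal.ofReal (s * |y|) := by
    refine (setLIntegral_le_lintegral _ _).trans ?_
    simp_rw [enorm_ker_sub]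
    have hd : ∀ x, HasDerivAt (fun x => s * gaussD (s * x + u))
        (s * (s * ((1 - 2 * π * (s * x + u) ^ 2) * Real.exp (-π * (s * x + u) ^ 2)))) x := fun x => by
      have h1 : HasDerivAt (fun x : ℝ => s * x + u) s x := by
        simpa using ((hasDerivAt_id x).const_mul s).add_const u
      refine (((hasDerivAt_gaussD _).comp x h1).const_mul s).congr_deriv (by ring)
    refine (lintegral_enorm_sub_le hd (by fun_prop) y).trans_eq ?_
    have h3 := lintegral_comp_affine
      (fun t => ‖(1 - 2 * π * t ^ 2) * Real.exp (-π * t ^ 2)‖ₑ) (by fun_prop) hs u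
    rw [hc₁] at h3
    have : ∀ x : ℝ, ‖s * (s * ((1 - 2 * π * (s * x + u) ^ 2) * Real.exp (-π * (s * x + u) ^ 2)))‖ₑ =
        ENNReal.ofReal s * (ENNReal.ofReal s *
          ‖(1 - 2 * π * (s * x + u) ^ 2) * Real.exp (-π * (s * x + u) ^ 2)‖ₑ) := fun x => by
      rw [enorm_mul, enorm_mul s, Real.enorm_of_nonneg hs.le]
    simp_rw [this]
    rw [lintegral_const_mul _ (by fun_prop), h3, Real.enorm_eq_ofReal_abs, ENNReal.ofReal_mul hs.le]
    ring
  have B2 : ∫⁻ x in {x | 2 * |y| ≤ |x|}, ‖ker s u (x - y) - ker s u x‖ₑ ≤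
      2 * c₂ * ENNReal.ofReal (1 + |u|) * ENNReal.ofReal (1 / (s * |y|)) := by
    have hpt : ∀ x, |y| ≤ |x| → ‖ker s u x‖ₑ ≤ ENNReal.ofReal (1 / (s * |y|)) *
        (ENNReal.ofReal (1 + |u|) *
          (ENNReal.ofReal s * ‖(1 + |s * x + u|) * gaussD (s * x + u)‖ₑ)) := fun x hx => by
      rw [enorm_ker, Real.enorm_of_nonneg hs.le, ← mul_assoc (ENNReal.ofReal (1 + |u|)),
        mul_comm (ENNReal.ofReal (1 + |u|)), mul_assoc, ← mul_assoc, mul_comm (ENNReal.ofReal (1 / _)),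
        mul_assoc]
      refine mul_le_mul_right ?_ _
      rw [enorm_mul, ← mul_assoc, ← mul_assoc]
      refine le_mul_of_one_le_left' ?_
      rw [Real.enorm_of_nonneg (by positivity), ← ENNReal.ofReal_mul (by positivity),
        ← ENNReal.ofReal_mul (by positivity), ENNReal.one_le_ofReal, mul_assoc, one_div_mul_eq_div,
        le_div_iff₀ (by positivity), one_mul]
      have e : |s * x| ≤ |s * x + u| + |u| := by
        have := abs_sub (s * x + u) u
        rwa [add_sub_cancel_right] at this
      rw [abs_mul, abs_of_pos hs] at e
      nlinarith [mul_le_mul_of_nonneg_left hx hs.le, abs_nonneg u, abs_nonneg (s * x + u)]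
    have hI := lintegral_comp_affine (fun t => ‖(1 + |t|) * gaussD t‖ₑ) (by fun_prop) hs u
    rw [hc₂] at hI
    have hset : ∫⁻ x in {x | |y| ≤ |x|}, ‖ker s u x‖ₑ ≤ ENNReal.ofReal (1 / (s * |y|)) *
        (ENNReal.ofReal (1 + |u|) * c₂) := by
      have hms : MeasurableSet {x : ℝ | |y| ≤ |x|} := measurableSet_le (by fun_prop) (by fun_prop)
      refine (setLIntegral_mono' hms (fun x hx => hpt x hx)).trans ((setLIntegral_le_lintegral _ _).trans ?_)
      rw [lintegral_const_mul _ (by fun_prop), lintegral_const_mul _ (by fun_prop), hI]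
    have hms2 : MeasurableSet {x : ℝ | 2 * |y| ≤ |x|} := measurableSet_le (by fun_prop) (by fun_prop)
    have hmk : Measurable fun x => ‖ker s u x‖ₑ := (nice_ker hs u).continuous.measurable.enorm
    calc ∫⁻ x in {x | 2 * |y| ≤ |x|}, ‖ker s u (x - y) - ker s u x‖ₑ
        ≤ ∫⁻ x in {x | 2 * |y| ≤ |x|}, (‖ker s u (x - y)‖ₑ + ‖ker s u x‖ₑ) :=
          lintegral_mono fun x => enorm_sub_le
      _ = (∫⁻ x in {x | 2 * |y| ≤ |x|}, ‖ker s u (x - y)‖ₑ) +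
          ∫⁻ x in {x | 2 * |y| ≤ |x|}, ‖ker s u x‖ₑ := lintegral_add_right _ hmk
      _ ≤ (∫⁻ x in {x | |y| ≤ |x|}, ‖ker s u x‖ₑ) + ∫⁻ x in {x | |y| ≤ |x|}, ‖ker s u x‖ₑ := by
          refine add_le_add ?_ (lintegral_mono_set fun x hx => ?_)
          · have hms : MeasurableSet {x : ℝ | |y| ≤ |x|} := measurableSet_le (by fun_prop) (by fun_prop)
            rw [← lintegral_indicator hms2, ← lintegral_indicator hms,
              ← lintegral_sub_right_eq_self (fun x => indicator {x | |y| ≤ |x|} _ x) y]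
            refine lintegral_mono fun x => ?_
            by_cases hx : 2 * |y| ≤ |x|
            · rw [indicator_of_mem (by exact hx), indicator_of_mem]
              change |y| ≤ |x - y|
              have := abs_sub_abs_le_abs_sub x y
              linarith
            · rw [indicator_of_notMem (by exact hx)]; exact zero_le
          · change |y| ≤ |x|
            have : 2 * |y| ≤ |x| := hx
            linarith
      _ ≤ _ := by
          refine (add_le_add hset hset).trans_eq ?_
          ring
  rcases min_choice (s * |y|) (1 / (s * |y|)) with h | h <;> rw [h]
  · refine B1.trans (mul_le_mul_left ?_ _)
    push_cast
    calc (c₁ : ℝ≥0∞) ≤ c₁ + 2 * c₂ := le_self_add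
      _ ≤ _ := le_mul_of_one_le_right' hu1
  · refine B2.trans (mul_le_mul_left (mul_le_mul_left ?_ _) _)
    push_cast
    exact le_add_self

/-- The kernel of the square function with dyadic scales in `J`. -/
noncomputable def sqKer (J : Finset ℤ) (u : ℝ) : ℝ → ℂ →L[ℂ] EuclideanSpace ℂ J :=
  colKer fun (j : J) => ker (2 ^ (j : ℤ)) u

lemma sum_enorm_gaussD_sq_le (J : Finset ℤ) (ξ : ℝ) :
    ∑ j : J, ‖gaussD (ξ / 2 ^ (j : ℤ))‖ₑ ^ (2 : ℝ) ≤ 8 := by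
  rcases eq_or_ne ξ 0 with rfl | hξ
  · simp [gaussD]
  have hx : 0 < 1 / |ξ| := by positivity
  have h := sum_min_dyadic_le J hx
  rw [← Finset.sum_coe_sort J (fun j => min ((2 : ℝ) ^ j * _) (1 / ((2 : ℝ) ^ j * _)))] at h
  calc ∑ j : J, ‖gaussD (ξ / 2 ^ (j : ℤ))‖ₑ ^ (2 : ℝ)
      ≤ ∑ j : J, ENNReal.ofReal (min ((2 : ℝ) ^ (j : ℤ) * (1 / |ξ|)) (1 / ((2 : ℝ) ^ (j : ℤ) * (1 / |ξ|)))) := by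
        refine Finset.sum_le_sum fun j _ => ?_
        have hj : (0 : ℝ) < 2 ^ (j : ℤ) := by positivity
        rw [Real.enorm_eq_ofReal_abs, ENNReal.ofReal_rpow_of_nonneg (abs_nonneg _) (by norm_num),
          Real.rpow_two]
        refine ENNReal.ofReal_le_ofReal ?_
        set t := ξ / 2 ^ (j : ℤ) with ht
        have e : |t| = |ξ| / 2 ^ (j : ℤ) := by rw [ht, abs_div, abs_of_pos hj]
        have hξ' : 0 < |ξ| := abs_pos.2 hξ
        have e1 : (2 : ℝ) ^ (j : ℤ) * (1 / |ξ|) = 1 / |t| := by rw [e]; field_simp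
        rw [e1, one_div_one_div]
        have ht0 : 0 < |t| := by rw [e]; positivity
        have h1 : |gaussD t| ^ 2 ≤ |gaussD t| := by
          nlinarith [abs_gaussD_le_one t, abs_nonneg (gaussD t)]
        refine h1.trans (le_min ?_ (abs_gaussD_le t))
        rw [le_div_iff₀ ht0, mul_comm]
        exact abs_mul_abs_gaussD_le t
    _ = ENNReal.ofReal (∑ j : J, min ((2 : ℝ) ^ (j : ℤ) * (1 / |ξ|)) (1 / ((2 : ℝ) ^ (j : ℤ) * (1 / |ξ|)))) :=
        (ENNReal.ofReal_sum_of_nonneg fun j _ => by positivity).symm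
    _ ≤ 8 := by
        refine (ENNReal.ofReal_le_ofReal h).trans (by norm_num)

lemma lintegral_convOp_sqKer_sq_le (J : Finset ℤ) (u : ℝ) {f : ℝ → ℂ} (hf : Integrable f)
    (hb : ∃ M, ∀ x, ‖f x‖ ≤ M) :
    ∫⁻ x, ‖convOp (sqKer J u) f x‖ₑ ^ (2 : ℝ) ≤ 8 * ∫⁻ x, ‖f x‖ₑ ^ (2 : ℝ) := by
  obtain ⟨M, hM⟩ := hb
  have hk : ∀ j : J, Nice (ker (2 ^ (j : ℤ)) u) := fun j => nice_ker (by positivity) u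
  have hcf := continuous_fourier hf
  simp_rw [enorm_euclidean_sq, sqKer, convOp_colKer_apply hk hf]
  have hm : ∀ j : J, Measurable fun x => ‖∫ y, ker (2 ^ (j : ℤ)) u (x - y) * f y‖ₑ ^ (2 : ℝ) := by
    intro j
    have := (nice_colKer hk).continuous_convOp hf
    have h2 : Continuous fun x => convOp (colKer fun (j : J) => ker (2 ^ (j : ℤ)) u) f x j :=
      (EuclideanSpace.proj j : EuclideanSpace ℂ J →L[ℂ] ℂ).continuous.comp this
    simp_rw [convOp_colKer_apply hk hf] at h2
    exact h2.measurable.enorm.pow_const _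
  rw [lintegral_finsetSum _ fun j _ => hm j]
  have key : ∀ j : J, ∫⁻ x, ‖∫ y, ker (2 ^ (j : ℤ)) u (x - y) * f y‖ₑ ^ (2 : ℝ) =
      ∫⁻ ξ, ‖gaussD (ξ / 2 ^ (j : ℤ))‖ₑ ^ (2 : ℝ) * ‖𝓕 f ξ‖ₑ ^ (2 : ℝ) := fun j => by
    have hj : (0 : ℝ) < 2 ^ (j : ℤ) := by positivity
    have hi : Integrable fun ξ : ℝ => (gaussD (ξ / 2 ^ (j : ℤ)) : ℂ) * ch (u * (ξ / 2 ^ (j : ℤ))) := by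
      refine ((integrable_gaussD.comp_div hj.ne').ofReal (𝕜 := ℂ)).mul_bdd (c := 1) ?_
        (Filter.Eventually.of_forall fun x => by simp)
      exact Continuous.aestronglyMeasurable (by fun_prop)
    have := lintegral_enorm_conv_sq_le hi (M := 1) (fun ξ => by
      rw [norm_mul, norm_ch, mul_one, Complex.norm_real]; exact abs_gaussD_le_one _) hf
    simp_rw [fourierInv_gaussD_dilate hj] at this
    rw [this]
    congr 1; ext ξ
    rw [enorm_mul, enorm_mul, enorm_ch, mul_one, ENNReal.mul_rpow_of_nonneg _ _ (by norm_num),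
      ← ofReal_norm (gaussD _), ← ofReal_norm (gaussD _ : ℂ), Complex.norm_real]
  simp_rw [key]
  rw [← lintegral_finsetSum _ fun j _ => by
    have := hcf.measurable
    exact ((by fun_prop : Continuous fun ξ : ℝ => gaussD (ξ / 2 ^ (j : ℤ))).measurable.enorm.pow_const _).mul
      (this.enorm.pow_const _)]
  rw [← lintegral_enorm_fourier_sq hf (memLp_two_of_bounded hf hM), ← lintegral_const_mul _
    (hcf.measurable.enorm.pow_const _)]
  refine lintegral_mono fun ξ => ?_
  rw [← Finset.sum_mul]
  exact mul_le_mul_left (sum_enorm_gaussD_sq_le J ξ) _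

/-- The square function kernels are Calderón–Zygmund, uniformly in the set of scales. -/
lemma exists_isCZ_sqKer : ∃ c : ℝ≥0, ∀ (J : Finset ℤ) (u : ℝ),
    IsCZ (sqKer J u) (c * (1 + ‖u‖₊)) := by
  obtain ⟨c, hc⟩ := exists_lintegral_ker_sub_le
  have hk : ∀ (J : Finset ℤ) (u : ℝ) (j : J), Nice (ker (2 ^ (j : ℤ)) u) :=
    fun J u j => nice_ker (by positivity) u
  refine ⟨8 + c * 8, fun J u => ⟨nice_colKer (hk J u), fun f hf hb => ?_, fun y => ?_⟩⟩
  · refine (lintegral_convOp_sqKer_sq_le J u hf hb).trans (mul_le_mul_left ?_ _)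
    push_cast
    calc (8 : ℝ≥0∞) ≤ 8 + c * 8 := le_self_add
      _ ≤ _ := le_mul_of_one_le_right' le_self_add
  · rcases eq_or_ne y 0 with rfl | hy
    · have : ∀ x, ‖sqKer J u (x - 0) - sqKer J u x‖ₑ = 0 := fun x => by
        rw [sub_zero, sub_self, ← ofReal_norm, norm_zero, ENNReal.ofReal_zero]
      rw [lintegral_congr this]; simp
    have hu : ENNReal.ofReal (1 + |u|) = 1 + (‖u‖₊ : ℝ≥0∞) := by
      rw [ENNReal.ofReal_add zero_le_one (abs_nonneg _), ENNReal.ofReal_one, ← Real.norm_eq_abs,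
        ofReal_norm]; rfl
    calc ∫⁻ x in {x | 2 * |y| ≤ |x|}, ‖sqKer J u (x - y) - sqKer J u x‖ₑ
        ≤ ∫⁻ x in {x | 2 * |y| ≤ |x|}, ∑ j : J, ‖ker (2 ^ (j : ℤ)) u (x - y) - ker (2 ^ (j : ℤ)) u x‖ₑ := by
          refine lintegral_mono fun x => ?_
          rw [sqKer, colKer_sub, ← ofReal_norm, ContinuousLinearMap.norm_toSpanSingleton]
          refine (ENNReal.ofReal_le_ofReal (norm_toLp_le_sum _)).trans_eq ?_
          rw [ENNReal.ofReal_sum_of_nonneg fun j _ => norm_nonneg _]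
          simp_rw [ofReal_norm]
      _ = ∑ j : J, ∫⁻ x in {x | 2 * |y| ≤ |x|}, ‖ker (2 ^ (j : ℤ)) u (x - y) - ker (2 ^ (j : ℤ)) u x‖ₑ := by
          refine lintegral_finsetSum _ fun j _ => ?_
          have := (hk J u j).continuous
          exact (by fun_prop : Continuous fun x =>
            ker (2 ^ (j : ℤ)) u (x - y) - ker (2 ^ (j : ℤ)) u x).measurable.enorm
      _ ≤ ∑ j : J, c * ENNReal.ofReal (1 + |u|) *
          ENNReal.ofReal (min (2 ^ (j : ℤ) * |y|) (1 / (2 ^ (j : ℤ) * |y|))) :=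
          Finset.sum_le_sum fun j _ => hc _ u y (by positivity) hy
      _ = c * ENNReal.ofReal (1 + |u|) *
          ENNReal.ofReal (∑ j : J, min ((2 : ℝ) ^ (j : ℤ) * |y|) (1 / (2 ^ (j : ℤ) * |y|))) := by
          rw [← Finset.mul_sum, ENNReal.ofReal_sum_of_nonneg fun j _ => by positivity]
      _ ≤ c * ENNReal.ofReal (1 + |u|) * 8 := by
          refine mul_le_mul_right ?_ _
          have h := sum_min_dyadic_le J (abs_pos.2 hy)
          rw [← Finset.sum_coe_sort J (fun j => min ((2 : ℝ) ^ j * _) (1 / ((2 : ℝ) ^ j * _)))] at h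
          refine (ENNReal.ofReal_le_ofReal h).trans (by norm_num)
      _ ≤ _ := by
          rw [hu]; push_cast
          rw [mul_right_comm]
          exact mul_le_mul_left le_add_self _

/-- The `L^q` norm of an extended nonnegative function. -/
noncomputable def lpn (q : ℝ) (F : ℝ → ℝ≥0∞) : ℝ≥0∞ := (∫⁻ x, F x ^ q) ^ (1 / q)

lemma eLpNorm_eq_lpn {E : Type*} [NormedAddCommGroup E] {q : ℝ} (hq : 0 < q) (f : ℝ → E) :
    eLpNorm f (ENNReal.ofReal q) volume = lpn q fun x => ‖f x‖ₑ := by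
  rw [eLpNorm_eq_lintegral_rpow_enorm_toReal (by simpa using hq) (by simp),
    ENNReal.toReal_ofReal hq.le, lpn]

lemma lpn_mono {q : ℝ} (hq : 0 < q) {F G : ℝ → ℝ≥0∞} (h : ∀ x, F x ≤ G x) : lpn q F ≤ lpn q G := by
  unfold lpn
  gcongr with x
  exact h x

lemma lpn_const_mul {q : ℝ} (hq : 0 < q) {c : ℝ≥0∞} (hc : c ≠ ∞) (F : ℝ → ℝ≥0∞) :
    lpn q (fun x => c * F x) = c * lpn q F := by
  unfold lpn
  simp_rw [ENNReal.mul_rpow_of_nonneg _ _ hq.le]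
  rw [lintegral_const_mul' _ _ (ENNReal.rpow_ne_top_of_nonneg hq.le hc),
    ENNReal.mul_rpow_of_nonneg _ _ (by positivity), ← ENNReal.rpow_mul, mul_one_div_cancel hq.ne',
    ENNReal.rpow_one]

lemma lpn_mul_le {p p₁ p₂ : ℝ} (hp : 0 < p) (hp₁ : 0 < p₁) (hp₂ : 0 < p₂)
    (h : 1 / p = 1 / p₁ + 1 / p₂) {F G : ℝ → ℝ≥0∞} (hF : Measurable F) (hG : Measurable G) :
    lpn p (fun x => F x * G x) ≤ lpn p₁ F * lpn p₂ G := by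
  have hlt : p < p₁ := by
    have h2 : 0 < 1 / p₂ := by positivity
    exact lt_of_one_div_lt_one_div hp₁ (by linarith)
  exact ENNReal.lintegral_Lp_mul_le_Lq_mul_Lr hp hlt h volume hF.aemeasurable hG.aemeasurable

lemma Nice.clm_comp {E F : Type*} [NormedAddCommGroup E] [NormedSpace ℂ E] [NormedAddCommGroup F]
    [NormedSpace ℂ F] {f : ℝ → E} (hf : Nice f) (T : E →L[ℂ] F) : Nice fun x => T (f x) := by
  obtain ⟨M, hM⟩ := hf.bounded
  exact ⟨T.continuous.comp hf.continuous, T.integrable_comp hf.integrable,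
    ‖T‖ * M, fun x => (T.le_opNorm _).trans (mul_le_mul_of_nonneg_left (hM x) (norm_nonneg _))⟩

lemma nice_conv {k f : ℝ → ℂ} (hk : Nice k) (hf : Integrable f) :
    Nice fun x => ∫ y, k (x - y) * f y := by
  have h := ((nice_colKer (ι := Unit) (k := fun _ => k) fun _ => hk).nice_convOp hf).clm_comp
    (EuclideanSpace.proj () : EuclideanSpace ℂ Unit →L[ℂ] ℂ)
  have e : (fun x => ∫ y, k (x - y) * f y) = fun x =>
      (EuclideanSpace.proj () : EuclideanSpace ℂ Unit →L[ℂ] ℂ) (convOp (colKer fun _ => k) f x) := by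
    ext x
    exact (convOp_colKer_apply (fun _ => hk) hf x ()).symm
  rw [e]; exact h

lemma Nice.mul {f g : ℝ → ℂ} (hf : Nice f) (hg : Nice g) : Nice fun x => f x * g x := by
  obtain ⟨M, hM⟩ := hf.bounded
  obtain ⟨N, hN⟩ := hg.bounded
  refine ⟨hf.continuous.mul hg.continuous, hf.integrable.mul_bdd (c := N)
    hg.continuous.aestronglyMeasurable (Filter.Eventually.of_forall hN), M * N, fun x => ?_⟩
  rw [norm_mul]
  exact mul_le_mul (hM x) (hN x) (norm_nonneg _) ((norm_nonneg _).trans (hM 0))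

lemma Nice.const_mul {f : ℝ → ℂ} (hf : Nice f) (c : ℂ) : Nice fun x => c * f x := by
  obtain ⟨M, hM⟩ := hf.bounded
  refine ⟨hf.continuous.const_mul c, hf.integrable.const_mul c, ‖c‖ * M, fun x => ?_⟩
  rw [norm_mul]
  exact mul_le_mul_of_nonneg_left (hM x) (norm_nonneg _)

lemma nice_toLp {ι : Type} [Fintype ι] {h : ι → ℝ → ℂ} (hh : ∀ j, Nice (h j)) :
    Nice fun x => (WithLp.toLp 2 fun j => h j x : EuclideanSpace ℂ ι) := by
  have hc : Continuous fun x => (WithLp.toLp 2 fun j => h j x : EuclideanSpace ℂ ι) :=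
    (PiLp.continuous_toLp 2 _).comp (continuous_pi fun j => (hh j).continuous)
  choose M hM using fun j => (hh j).bounded
  refine ⟨hc, ?_, ∑ j, M j, fun x => (norm_toLp_le_sum _).trans
    (Finset.sum_le_sum fun j _ => hM j x)⟩
  exact (integrable_finsetSum Finset.univ fun j _ => (hh j).integrable.norm).mono'
    hc.aestronglyMeasurable (Filter.Eventually.of_forall fun x => norm_toLp_le_sum _)

/-- The frequency-localised piece of `f` with symbol `gaussD (ξ / s) * ch (u * (ξ / s))`. -/
noncomputable def band (s u : ℝ) (f : ℝ → ℂ) (x : ℝ) : ℂ := ∫ y, ker s u (x - y) * f y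

/-- The kernel of the multiplier `ξ ↦ gauss (ξ / s) * ch (u * (ξ / s))`. -/
noncomputable def avgKer (s u x : ℝ) : ℂ := s * (gauss (s * x + u) : ℂ)

/-- The Gaussian average of `f`, with symbol `gauss (ξ / s) * ch (u * (ξ / s))`. -/
noncomputable def avg (s u : ℝ) (f : ℝ → ℂ) (x : ℝ) : ℂ := ∫ y, avgKer s u (x - y) * f y

lemma fourierInv_gauss_dilate {s : ℝ} (hs : 0 < s) (u z : ℝ) :
    𝓕⁻ (fun ξ : ℝ => (gauss (ξ / s) : ℂ) * ch (u * (ξ / s))) z = avgKer s u z := by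
  rw [fourierInv_dilate (fun ξ => (gauss ξ : ℂ)) hs, avgKer]
  simp only [gauss]
  rw [fourierInv_gaussian]

lemma gauss_nonneg (t : ℝ) : 0 ≤ gauss t := (Real.exp_pos _).le

lemma nice_avgKer {s : ℝ} (hs : 0 < s) (u : ℝ) : Nice (avgKer s u) := by
  refine ⟨by unfold avgKer; fun_prop, ?_, ⟨s, fun x => ?_⟩⟩
  · have h := ((integrable_gauss.comp_add_right u).comp_mul_left' hs.ne')
    exact (h.ofReal (𝕜 := ℂ)).const_mul (s : ℂ)
  · simp only [avgKer, norm_mul, Complex.norm_real]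
    rw [Real.norm_of_nonneg hs.le, Real.norm_of_nonneg (gauss_nonneg _)]
    exact mul_le_of_le_one_right hs.le (gauss_le_one _)

lemma nice_band {s : ℝ} (hs : 0 < s) (u : ℝ) {f : ℝ → ℂ} (hf : Integrable f) : Nice (band s u f) :=
  nice_conv (nice_ker hs u) hf

lemma nice_avg {s : ℝ} (hs : 0 < s) (u : ℝ) {f : ℝ → ℂ} (hf : Integrable f) : Nice (avg s u f) :=
  nice_conv (nice_avgKer hs u) hf

lemma enorm_convOp_sqKer_sq (J : Finset ℤ) (u : ℝ) {f : ℝ → ℂ} (hf : Integrable f) (x : ℝ) :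
    ‖convOp (sqKer J u) f x‖ₑ ^ (2 : ℝ) = ∑ j : J, ‖band (2 ^ (j : ℤ)) u f x‖ₑ ^ (2 : ℝ) := by
  rw [enorm_euclidean_sq]
  simp_rw [sqKer, convOp_colKer_apply (fun j : J => nice_ker (s := 2 ^ (j : ℤ)) (by positivity) u) hf, band]

/-- The square function bound. -/
lemma exists_lpn_sqKer_le {q : ℝ} (hq : 1 < q) : ∃ C : ℝ≥0, ∀ (J : Finset ℤ) (u : ℝ) (f : ℝ → ℂ),
    Nice f → lpn q (fun x => ‖convOp (sqKer J u) f x‖ₑ) ≤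
      C * (1 + ‖u‖ₑ) * lpn q (fun x => ‖f x‖ₑ) := by
  obtain ⟨c, hc⟩ := exists_isCZ_sqKer
  obtain ⟨C, hC⟩ := exists_eLpNorm_convOp_le hq
  refine ⟨C * (1 + c), fun J u f hf => ?_⟩
  have := hC _ _ _ _ (hc J u) f hf
  rw [eLpNorm_eq_lpn (by linarith), eLpNorm_eq_lpn (by linarith)] at this
  refine this.trans (mul_le_mul_left ?_ _)
  push_cast
  rw [mul_assoc (C : ℝ≥0∞)]
  refine mul_le_mul_right ?_ _
  rw [add_mul, one_mul]
  exact add_le_add_left le_self_add _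

/-- The dual square function bound. -/
lemma exists_lpn_sum_band_le {q : ℝ} (hq : 1 < q) : ∃ C : ℝ≥0, ∀ (J : Finset ℤ)
    (H : ℝ → EuclideanSpace ℂ J), Nice H →
    lpn q (fun x => ‖∑ j : J, band (2 ^ (j : ℤ)) 0 (fun y => H y j) x‖ₑ) ≤
      C * lpn q (fun x => ‖H x‖ₑ) := by
  obtain ⟨c, hc⟩ := exists_isCZ_sqKer
  obtain ⟨C, hC⟩ := exists_eLpNorm_convOp_le hq
  refine ⟨C * (1 + c), fun J H hH => ?_⟩
  have := hC _ _ _ _ (hc J 0).adj H hH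
  rw [eLpNorm_eq_lpn (by linarith), eLpNorm_eq_lpn (by linarith)] at this
  simp_rw [sqKer, convOp_adjKer_colKer (fun j : J => nice_ker (s := 2 ^ (j : ℤ)) (by positivity) 0)
    (fun j x => conj_ker_neg _ x) hH.integrable] at this
  refine this.trans (mul_le_mul_left ?_ _)
  simp

lemma gauss_add_le (t v : ℝ) : gauss (t + v) ≤ 2 * (1 + v ^ 2) * (1 / (1 + t ^ 2)) := by
  have h1 := Real.add_one_le_exp (π * (t + v) ^ 2)
  rw [gauss, show -π * (t + v) ^ 2 = -(π * (t + v) ^ 2) by ring, Real.exp_neg, mul_one_div,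
    le_div_iff₀ (by positivity), inv_mul_le_iff₀ (Real.exp_pos _)]
  have h2 : 1 + t ^ 2 ≤ (1 + (t + v) ^ 2) * (2 * (1 + v ^ 2)) := by
    nlinarith [sq_nonneg (t + 2 * v), mul_nonneg (sq_nonneg (t + v)) (sq_nonneg v)]
  refine h2.trans (mul_le_mul_of_nonneg_right ?_ (by positivity))
  nlinarith [Real.pi_gt_three, sq_nonneg (t + v)]

lemma ofReal_inv_one_add_sq_le (t : ℝ) : ENNReal.ofReal (1 / (1 + t ^ 2)) ≤
    ∑' k : ℕ, ENNReal.ofReal (4 * (1 / 4) ^ k) * indicator {t : ℝ | |t| < 2 ^ k} 1 t := by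
  obtain ⟨n, hn⟩ : ∃ n : ℕ, |t| < 2 ^ n := pow_unbounded_of_one_lt _ one_lt_two
  classical
  have hex : ∃ n : ℕ, |t| < 2 ^ n := ⟨n, hn⟩
  have hm := Nat.find_spec hex
  set m := Nat.find hex with hmdef
  refine le_trans ?_ (ENNReal.le_tsum m)
  rw [indicator_of_mem (by exact hm), Pi.one_apply, mul_one]
  refine ENNReal.ofReal_le_ofReal ?_
  rcases Nat.eq_zero_or_pos m with h0 | h0
  · rw [h0, div_le_iff₀ (by positivity)]; nlinarith [sq_nonneg t]
  · have := Nat.find_min hex (m := m - 1) (by omega)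
    obtain ⟨l, hl⟩ : ∃ l, m = l + 1 := ⟨m - 1, by omega⟩
    rw [hl, Nat.add_sub_cancel, not_lt] at this
    rw [hl, pow_succ (1 / 4 : ℝ), div_le_iff₀ (by positivity)]
    have h4 : (1 / 4 : ℝ) ^ l * ((2 : ℝ) ^ l) ^ 2 = 1 := by
      rw [← pow_mul, mul_comm l, pow_mul, ← mul_pow]; norm_num
    have h5 : ((2 : ℝ) ^ l) ^ 2 ≤ t ^ 2 := by rw [← sq_abs t]; gcongr
    have h6 : (0 : ℝ) < (1 / 4) ^ l := by positivity
    nlinarith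

/-- Gaussian averages are controlled by the maximal function. -/
lemma enorm_avg_le {s : ℝ} (hs : 0 < s) (v : ℝ) (g : ℝ → ℂ) (hg : Measurable g) (x : ℝ) :
    ‖avg s v g x‖ₑ ≤ 32 * (1 + ‖v‖ₑ ^ 2) * maxFn (fun y => ‖g y‖ₑ) x := by
  have hv : ENNReal.ofReal (2 * (1 + v ^ 2)) = 2 * (1 + ‖v‖ₑ ^ 2) := by
    rw [ENNReal.ofReal_mul (by norm_num), ENNReal.ofReal_add zero_le_one (sq_nonneg _),
      ← sq_abs, ENNReal.ofReal_pow (abs_nonneg _), ← Real.norm_eq_abs, ofReal_norm]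
    simp
  have hpt : ∀ y, ‖avgKer s v (x - y) * g y‖ₑ ≤ 2 * (1 + ‖v‖ₑ ^ 2) * ∑' k : ℕ,
      ENNReal.ofReal (4 * (1 / 4) ^ k * s) *
        indicator (Ioo (x - 2 ^ k / s) (x + 2 ^ k / s)) (fun y => ‖g y‖ₑ) y := by
    intro y
    have h1 : ‖avgKer s v (x - y)‖ₑ ≤ ENNReal.ofReal s * (2 * (1 + ‖v‖ₑ ^ 2) *
        ENNReal.ofReal (1 / (1 + (s * (x - y)) ^ 2))) := by
      rw [← hv, ← ENNReal.ofReal_mul (by positivity), ← ENNReal.ofReal_mul hs.le, ← ofReal_norm]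
      refine ENNReal.ofReal_le_ofReal ?_
      rw [avgKer, norm_mul, Complex.norm_real, Complex.norm_real, Real.norm_of_nonneg hs.le,
        Real.norm_of_nonneg (gauss_nonneg _)]
      exact mul_le_mul_of_nonneg_left (gauss_add_le _ _) hs.le
    rw [enorm_mul]
    refine (mul_le_mul_left (h1.trans (mul_le_mul_right (mul_le_mul_right
      (ofReal_inv_one_add_sq_le _) _) _)) _).trans_eq ?_
    rw [mul_comm (ENNReal.ofReal s), mul_assoc, mul_assoc, ← ENNReal.tsum_mul_right]
    congr 2; ext k
    have hset : s * (x - y) ∈ {t : ℝ | |t| < 2 ^ k} ↔ y ∈ Ioo (x - 2 ^ k / s) (x + 2 ^ k / s) := by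
      change |s * (x - y)| < 2 ^ k ↔ _
      rw [abs_mul, abs_of_pos hs, ← lt_div_iff₀' hs, abs_lt, mem_Ioo]
      constructor <;> rintro ⟨a, b⟩ <;> constructor <;> linarith
    by_cases hy : y ∈ Ioo (x - 2 ^ k / s) (x + 2 ^ k / s)
    · rw [indicator_of_mem hy, indicator_of_mem (hset.2 hy), Pi.one_apply, mul_one,
        ENNReal.ofReal_mul (p := 4 * (1 / 4) ^ k) (by positivity)]; ring
    · rw [indicator_of_notMem hy, indicator_of_notMem (fun h => hy (hset.1 h))]; simp
  have hmi : ∀ k : ℕ, Measurable fun y => ENNReal.ofReal (4 * (1 / 4) ^ k * s) *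
        indicator (Ioo (x - 2 ^ k / s) (x + 2 ^ k / s)) (fun y => ‖g y‖ₑ) y := fun k =>
    (hg.enorm.indicator measurableSet_Ioo).const_mul _
  calc ‖avg s v g x‖ₑ ≤ ∫⁻ y, ‖avgKer s v (x - y) * g y‖ₑ := enorm_integral_le_lintegral_enorm _
    _ ≤ _ := lintegral_mono hpt
    _ = 2 * (1 + ‖v‖ₑ ^ 2) * ∑' k : ℕ, ENNReal.ofReal (4 * (1 / 4) ^ k * s) *
          ∫⁻ y in Ioo (x - 2 ^ k / s) (x + 2 ^ k / s), ‖g y‖ₑ := by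
        rw [lintegral_const_mul _ (Measurable.tsum hmi),
          lintegral_tsum fun k => (hmi k).aemeasurable]
        congr 2; ext k
        rw [lintegral_const_mul _ (hg.enorm.indicator measurableSet_Ioo),
          lintegral_indicator measurableSet_Ioo]
    _ ≤ 2 * (1 + ‖v‖ₑ ^ 2) * ∑' k : ℕ, ENNReal.ofReal (8 * (1 / 2) ^ k) *
          maxFn (fun y => ‖g y‖ₑ) x := by
        refine mul_le_mul_right (ENNReal.tsum_le_tsum fun k => ?_) _
        have hx : x ∈ Ioo (x - 2 ^ k / s) (x + 2 ^ k / s) := by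
          have : 0 < 2 ^ k / s := by positivity
          constructor <;> linarith
        refine (mul_le_mul_right (setLIntegral_Ioo_le_maxFn _ hx) _).trans_eq ?_
        rw [mul_left_comm, ← ENNReal.ofReal_mul (by positivity), mul_comm]
        congr 2
        have h4 : (1 / 4 : ℝ) ^ k * (2 : ℝ) ^ k = (1 / 2) ^ k := by
          rw [← mul_pow]; norm_num
        field_simp
        rw [← h4]; field_simp; ring
    _ = _ := by
        rw [ENNReal.tsum_mul_right, ← ENNReal.ofReal_tsum_of_nonneg (fun k => by positivity)
          (summable_geometric_two.mul_left 8), tsum_mul_left, tsum_geometric_two]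
        have : ENNReal.ofReal (8 * 2) = 16 := by norm_num
        rw [this, ← mul_assoc]
        congr 1
        rw [mul_right_comm]; norm_num

lemma Nice.exists_nnreal_bound {E : Type*} [NormedAddCommGroup E] {f : ℝ → E} (hf : Nice f) :
    ∃ K : ℝ≥0, ∀ x, ‖f x‖ₑ ≤ K := by
  obtain ⟨M, hM⟩ := hf.bounded
  refine ⟨M.toNNReal, fun x => ?_⟩
  rw [← ofReal_norm]
  exact ENNReal.ofReal_le_ofReal (hM x)

lemma exists_lpn_maxFn_le {q : ℝ} (hq : 1 < q) : ∃ C : ℝ≥0, ∀ g : ℝ → ℂ, Nice g →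
    lpn q (maxFn fun x => ‖g x‖ₑ) ≤ C * lpn q (fun x => ‖g x‖ₑ) := by
  obtain ⟨C, hC⟩ := exists_lintegral_maxFn_rpow_le hq
  refine ⟨C ^ (1 / q), fun g hg => ?_⟩
  obtain ⟨K, hK⟩ := hg.exists_nnreal_bound
  have := hC _ hg.continuous.measurable.enorm K hK
  unfold lpn
  rw [ENNReal.coe_rpow_of_nonneg _ (by positivity), ← ENNReal.mul_rpow_of_nonneg _ _ (by positivity)]
  exact ENNReal.rpow_le_rpow this (by positivity)

end CoifmanMeyer

namespace CoifmanMeyer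
open Set

/-- The diagonal paraproduct. -/
noncomputable def paraHH (J : Finset ℤ) (c : J → ℂ) (u v : ℝ) (f g : ℝ → ℂ) (x : ℝ) : ℂ :=
  ∑ j : J, c j * (band (2 ^ (j : ℤ)) u f x * band (2 ^ (j : ℤ)) v g x)

/-- The low-high paraproduct. -/
noncomputable def paraHL (J : Finset ℤ) (c : J → ℂ) (u v : ℝ) (f g : ℝ → ℂ) (x : ℝ) : ℂ :=
  ∑ j : J, band (2 ^ (j : ℤ)) 0
    (fun y => c j * (band (2 ^ (j : ℤ)) u f y * avg (2 ^ (j : ℤ)) v g y)) x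

lemma measurable_enorm_convOp_sqKer (J : Finset ℤ) (u : ℝ) {f : ℝ → ℂ} (hf : Integrable f) :
    Measurable fun x => ‖convOp (sqKer J u) f x‖ₑ :=
  ((nice_colKer fun j : J => nice_ker (s := 2 ^ (j : ℤ)) (by positivity) u).continuous_convOp
    hf).measurable.enorm

lemma exists_lpn_paraHH_le {p p₁ p₂ : ℝ} (hp : 1 < p) (hp₁ : 1 < p₁) (hp₂ : 1 < p₂)
    (h : 1 / p = 1 / p₁ + 1 / p₂) : ∃ C : ℝ≥0, ∀ (J : Finset ℤ) (c : J → ℂ) (M : ℝ≥0) (u v : ℝ)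
    (f g : ℝ → ℂ), (∀ j, ‖c j‖ₑ ≤ M) → Nice f → Nice g →
    lpn p (fun x => ‖paraHH J c u v f g x‖ₑ) ≤ C * M * ((1 + ‖u‖ₑ) * (1 + ‖v‖ₑ)) *
      (lpn p₁ (fun x => ‖f x‖ₑ) * lpn p₂ (fun x => ‖g x‖ₑ)) := by
  obtain ⟨C₁, h₁⟩ := exists_lpn_sqKer_le hp₁
  obtain ⟨C₂, h₂⟩ := exists_lpn_sqKer_le hp₂
  refine ⟨C₁ * C₂, fun J c M u v f g hc hf hg => ?_⟩
  have hpt : ∀ x, ‖paraHH J c u v f g x‖ₑ ≤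
      M * (‖convOp (sqKer J u) f x‖ₑ * ‖convOp (sqKer J v) g x‖ₑ) := fun x => by
    calc ‖paraHH J c u v f g x‖ₑ
        ≤ ∑ j : J, ‖c j * (band (2 ^ (j : ℤ)) u f x * band (2 ^ (j : ℤ)) v g x)‖ₑ :=
          enorm_sum_le _ _
      _ ≤ ∑ j : J, M * (‖band (2 ^ (j : ℤ)) u f x‖ₑ * ‖band (2 ^ (j : ℤ)) v g x‖ₑ) := by
          refine Finset.sum_le_sum fun j _ => ?_
          rw [enorm_mul, enorm_mul]
          exact mul_le_mul_left (hc j) _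
      _ ≤ _ := by
          rw [← Finset.mul_sum]
          refine mul_le_mul_right ((ENNReal.inner_le_Lp_mul_Lq _ _ _
            (Real.HolderConjugate.two_two)).trans_eq ?_) _
          rw [← enorm_convOp_sqKer_sq J u hf.integrable, ← enorm_convOp_sqKer_sq J v hg.integrable,
            ← ENNReal.rpow_mul, ← ENNReal.rpow_mul]
          norm_num
  refine (lpn_mono (by linarith) hpt).trans ?_
  rw [lpn_const_mul (by linarith) ENNReal.coe_ne_top]
  refine (mul_le_mul_right (lpn_mul_le (by linarith) (by linarith) (by linarith) h
    (measurable_enorm_convOp_sqKer J u hf.integrable)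
    (measurable_enorm_convOp_sqKer J v hg.integrable)) _).trans ?_
  refine (mul_le_mul_right (mul_le_mul' (h₁ J u f hf) (h₂ J v g hg)) _).trans_eq ?_
  push_cast
  ring

lemma exists_lpn_paraHL_le {p p₁ p₂ : ℝ} (hp : 1 < p) (hp₁ : 1 < p₁) (hp₂ : 1 < p₂)
    (h : 1 / p = 1 / p₁ + 1 / p₂) : ∃ C : ℝ≥0, ∀ (J : Finset ℤ) (c : J → ℂ) (M : ℝ≥0) (u v : ℝ)
    (f g : ℝ → ℂ), (∀ j, ‖c j‖ₑ ≤ M) → Nice f → Nice g →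
    lpn p (fun x => ‖paraHL J c u v f g x‖ₑ) ≤ C * M * ((1 + ‖u‖ₑ) * (1 + ‖v‖ₑ ^ 2)) *
      (lpn p₁ (fun x => ‖f x‖ₑ) * lpn p₂ (fun x => ‖g x‖ₑ)) := by
  obtain ⟨C₀, h₀⟩ := exists_lpn_sum_band_le hp
  obtain ⟨C₁, h₁⟩ := exists_lpn_sqKer_le hp₁
  obtain ⟨C₂, h₂⟩ := exists_lpn_maxFn_le hp₂
  refine ⟨32 * C₀ * C₁ * C₂, fun J c M u v f g hc hf hg => ?_⟩
  set H : ℝ → EuclideanSpace ℂ J := fun y => WithLp.toLp 2 fun j =>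
    c j * (band (2 ^ (j : ℤ)) u f y * avg (2 ^ (j : ℤ)) v g y) with hH
  have hHn : Nice H := nice_toLp fun j => ((nice_band (by positivity) u hf.integrable).mul
    (nice_avg (by positivity) v hg.integrable)).const_mul (c j)
  have hpt : ∀ x, ‖H x‖ₑ ≤ (M * (32 * (1 + ‖v‖ₑ ^ 2))) *
      (‖convOp (sqKer J u) f x‖ₑ * maxFn (fun y => ‖g y‖ₑ) x) := fun x => by
    rw [← ENNReal.rpow_le_rpow_iff (z := 2) (by norm_num), enorm_euclidean_sq]
    calc ∑ j : J, ‖H x j‖ₑ ^ (2 : ℝ)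
        ≤ ∑ j : J, (M * (32 * (1 + ‖v‖ₑ ^ 2)) * maxFn (fun y => ‖g y‖ₑ) x) ^ (2 : ℝ) *
            ‖band (2 ^ (j : ℤ)) u f x‖ₑ ^ (2 : ℝ) := by
          refine Finset.sum_le_sum fun j _ => ?_
          rw [← ENNReal.mul_rpow_of_nonneg _ _ (by norm_num)]
          refine ENNReal.rpow_le_rpow ?_ (by norm_num)
          simp only [hH]
          rw [enorm_mul, enorm_mul]
          refine (mul_le_mul' (hc j) (mul_le_mul_right (enorm_avg_le (by positivity) v g
            hg.continuous.measurable x) _)).trans_eq ?_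
          ring
      _ = _ := by
          rw [← Finset.mul_sum, ← enorm_convOp_sqKer_sq J u hf.integrable,
            ← ENNReal.mul_rpow_of_nonneg _ _ (by norm_num)]
          congr 1; ring
  have := h₀ J H hHn
  refine this.trans ((mul_le_mul_right (lpn_mono (by linarith) hpt) _).trans ?_)
  have htop : (M * (32 * (1 + ‖v‖ₑ ^ 2)) : ℝ≥0∞) ≠ ∞ := by
    refine ENNReal.mul_ne_top ENNReal.coe_ne_top (ENNReal.mul_ne_top (by norm_num) ?_)
    exact ENNReal.add_ne_top.2 ⟨by norm_num, ENNReal.pow_ne_top enorm_ne_top⟩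
  rw [lpn_const_mul (by linarith) htop]
  refine (mul_le_mul_right (mul_le_mul_right (lpn_mul_le (by linarith) (by linarith) (by linarith) h
    (measurable_enorm_convOp_sqKer J u hf.integrable) (measurable_maxFn _)) _) _).trans ?_
  refine (mul_le_mul_right (mul_le_mul_right (mul_le_mul' (h₁ J u f hf) (h₂ g hg)) _) _).trans_eq ?_
  push_cast
  ring

end CoifmanMeyer

namespace CoifmanMeyer
open Set
open scoped FourierTransform ContDiff

lemma hasDerivAt_slice_fst {m : ℝ → ℝ → ℂ} {x y : ℝ}
    (h : DifferentiableAt ℝ (fun q : ℝ × ℝ => m q.1 q.2) (x, y)) :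
    HasDerivAt (fun t => m t y) (fderiv ℝ (fun q : ℝ × ℝ => m q.1 q.2) (x, y) (1, 0)) x := by
  have h1 : HasDerivAt (fun t : ℝ => (t, y)) ((1 : ℝ), (0 : ℝ)) x :=
    (hasDerivAt_id x).prodMk (hasDerivAt_const x y)
  exact h.hasFDerivAt.comp_hasDerivAt x h1

lemma hasDerivAt_slice_snd {m : ℝ → ℝ → ℂ} {x y : ℝ}
    (h : DifferentiableAt ℝ (fun q : ℝ × ℝ => m q.1 q.2) (x, y)) :
    HasDerivAt (fun t => m x t) (fderiv ℝ (fun q : ℝ × ℝ => m q.1 q.2) (x, y) (0, 1)) y := by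
  have h1 : HasDerivAt (fun t : ℝ => (x, t)) ((0 : ℝ), (1 : ℝ)) y :=
    (hasDerivAt_const y x).prodMk (hasDerivAt_id y)
  exact h.hasFDerivAt.comp_hasDerivAt y h1

lemma contDiffOn_pd1 {m : ℝ → ℝ → ℂ} {k n : WithTop ℕ∞} (hk : k + 1 ≤ n) {U : Set (ℝ × ℝ)}
    (hU : IsOpen U) (h : ContDiffOn ℝ n (fun q : ℝ × ℝ => m q.1 q.2) U) :
    ContDiffOn ℝ k (fun q : ℝ × ℝ => pd1 m q.1 q.2) U := by
  refine ((h.fderiv_of_isOpen hU hk).clm_apply (contDiffOn_const (c := ((1 : ℝ), (0 : ℝ))))).congr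
    fun q hq => ?_
  exact (hasDerivAt_slice_fst (((h.differentiableOn (by
    rintro rfl; simp at hk)).differentiableAt (hU.mem_nhds hq)))).deriv

lemma contDiffOn_pd2 {m : ℝ → ℝ → ℂ} {k n : WithTop ℕ∞} (hk : k + 1 ≤ n) {U : Set (ℝ × ℝ)}
    (hU : IsOpen U) (h : ContDiffOn ℝ n (fun q : ℝ × ℝ => m q.1 q.2) U) :
    ContDiffOn ℝ k (fun q : ℝ × ℝ => pd2 m q.1 q.2) U := by
  refine ((h.fderiv_of_isOpen hU hk).clm_apply (contDiffOn_const (c := ((0 : ℝ), (1 : ℝ))))).congr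
    fun q hq => ?_
  exact (hasDerivAt_slice_snd (((h.differentiableOn (by
    rintro rfl; simp at hk)).differentiableAt (hU.mem_nhds hq)))).deriv

/-- The punctured plane. -/
def puncturedPlane : Set (ℝ × ℝ) := {q | q ≠ 0}

lemma isOpen_puncturedPlane : IsOpen puncturedPlane := isOpen_ne

/-- Smooth functions on the plane supported in a compact subset of the punctured plane. -/
structure TestFn (W : ℝ → ℝ → ℂ) : Prop where
  smooth : ContDiff ℝ ∞ fun q : ℝ × ℝ => W q.1 q.2
  vanish : ∃ r R : ℝ, 0 < r ∧ ∀ q : ℝ × ℝ, (‖q‖ < r ∨ R < ‖q‖) → W q.1 q.2 = 0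

/-- Symbols satisfying the Hörmander–Mikhlin conditions of order `7`. -/
structure IsSym (A : ℝ) (φ : ℝ → ℝ → ℂ) : Prop where
  contDiffOn : ContDiffOn ℝ 7 (fun q : ℝ × ℝ => φ q.1 q.2) puncturedPlane
  bound : ∀ a b : ℕ, a + b ≤ 7 → ∀ x y : ℝ, (x, y) ≠ ((0 : ℝ), (0 : ℝ)) →
    Real.sqrt (x ^ 2 + y ^ 2) ^ (a + b) * ‖mpd a b φ x y‖ ≤ A

lemma TestFn.pd1 {W : ℝ → ℝ → ℂ} (hW : TestFn W) : TestFn (pd1 W) := by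
  obtain ⟨r, R, hr, h⟩ := hW.vanish
  refine ⟨contDiffOn_univ.1 (contDiffOn_pd1 (by simp) isOpen_univ hW.smooth.contDiffOn), r, R, hr,
    fun q hq => ?_⟩
  have hc : Continuous fun t : ℝ => ‖(t, q.2)‖ := by fun_prop
  have : ∀ᶠ t in nhds q.1, W t q.2 = 0 := by
    rcases hq with hq | hq
    · filter_upwards [hc.continuousAt.eventually_lt continuousAt_const hq] with t ht
      exact h (t, q.2) (Or.inl ht)
    · filter_upwards [continuousAt_const.eventually_lt hc.continuousAt hq] with t ht
      exact h (t, q.2) (Or.inr ht)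
  exact (Filter.EventuallyEq.deriv_eq this).trans (deriv_const _ _)

lemma TestFn.pd2 {W : ℝ → ℝ → ℂ} (hW : TestFn W) : TestFn (pd2 W) := by
  obtain ⟨r, R, hr, h⟩ := hW.vanish
  refine ⟨contDiffOn_univ.1 (contDiffOn_pd2 (by simp) isOpen_univ hW.smooth.contDiffOn), r, R, hr,
    fun q hq => ?_⟩
  have hc : Continuous fun t : ℝ => ‖(q.1, t)‖ := by fun_prop
  have : ∀ᶠ t in nhds q.2, W q.1 t = 0 := by
    rcases hq with hq | hq
    · filter_upwards [hc.continuousAt.eventually_lt continuousAt_const hq] with t ht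
      exact h (q.1, t) (Or.inl ht)
    · filter_upwards [continuousAt_const.eventually_lt hc.continuousAt hq] with t ht
      exact h (q.1, t) (Or.inr ht)
  exact (Filter.EventuallyEq.deriv_eq this).trans (deriv_const _ _)

lemma IsSym.contDiffOn_mpd {A : ℝ} {φ : ℝ → ℝ → ℂ} (hφ : IsSym A φ) :
    ∀ (a b n : ℕ), a + b + n ≤ 7 →
      ContDiffOn ℝ n (fun q : ℝ × ℝ => mpd a b φ q.1 q.2) puncturedPlane := by
  intro a
  induction a with
  | zero =>
    intro b
    induction b with
    | zero => exact fun n hn => hφ.contDiffOn.of_le (by exact_mod_cast (by omega : n ≤ 7))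
    | succ b ih =>
      intro n hn
      have := contDiffOn_pd2 (k := n) (n := (n + 1 : ℕ)) (by simp) isOpen_puncturedPlane
        (ih (n + 1) (by omega))
      simpa [mpd, Function.iterate_succ_apply'] using this
  | succ a ih =>
    intro b n hn
    have := contDiffOn_pd1 (k := n) (n := (n + 1 : ℕ)) (by simp) isOpen_puncturedPlane
      (ih b (n + 1) (by omega))
    simpa [mpd, Function.iterate_succ_apply'] using this

lemma TestFn.continuous_mul {W ψ : ℝ → ℝ → ℂ} (hW : TestFn W)
    (hψ : ContinuousOn (fun q : ℝ × ℝ => ψ q.1 q.2) puncturedPlane) :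
    Continuous fun q : ℝ × ℝ => W q.1 q.2 * ψ q.1 q.2 := by
  obtain ⟨r, R, hr, h⟩ := hW.vanish
  refine continuous_iff_continuousAt.2 fun q => ?_
  rcases eq_or_ne q 0 with rfl | hq
  · refine (continuousAt_const (y := (0 : ℂ))).congr ?_
    filter_upwards [Metric.ball_mem_nhds (0 : ℝ × ℝ) hr] with z hz
    rw [h z (Or.inl (by simpa using hz)), zero_mul]
  · exact hW.smooth.continuous.continuousAt.mul
      (hψ.continuousAt (isOpen_puncturedPlane.mem_nhds hq))

lemma TestFn.hasCompactSupport_mul {W : ℝ → ℝ → ℂ} (hW : TestFn W) (ψ : ℝ → ℝ → ℂ) :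
    HasCompactSupport fun q : ℝ × ℝ => W q.1 q.2 * ψ q.1 q.2 := by
  obtain ⟨r, R, hr, h⟩ := hW.vanish
  refine HasCompactSupport.of_support_subset_isCompact (isCompact_closedBall (0 : ℝ × ℝ) R)
    fun q hq => ?_
  by_contra hq'
  rw [mem_closedBall_zero_iff, not_le] at hq'
  simp [h q (Or.inr hq')] at hq

lemma HasCompactSupport.slice_snd {m : ℝ → ℝ → ℂ}
    (h : HasCompactSupport fun q : ℝ × ℝ => m q.1 q.2) (x : ℝ) : HasCompactSupport (m x) := by
  refine HasCompactSupport.of_support_subset_isCompact (h.isCompact.image continuous_snd)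
    fun y hy => ⟨(x, y), subset_tsupport _ hy, rfl⟩

lemma HasCompactSupport.slice_fst {m : ℝ → ℝ → ℂ}
    (h : HasCompactSupport fun q : ℝ × ℝ => m q.1 q.2) (y : ℝ) :
    HasCompactSupport fun x => m x y := by
  refine HasCompactSupport.of_support_subset_isCompact (h.isCompact.image continuous_fst)
    fun x hx => ⟨(x, y), subset_tsupport (fun q : ℝ × ℝ => m q.1 q.2) hx, rfl⟩

/-- The Fourier transform of a function on the plane. -/
noncomputable def osc (m : ℝ → ℝ → ℂ) (u v : ℝ) : ℂ :=
  ∫ q : ℝ × ℝ, ch (-(u * q.1 + v * q.2)) * m q.1 q.2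

section osc

variable {m : ℝ → ℝ → ℂ} (hm : Continuous fun q : ℝ × ℝ => m q.1 q.2)
  (hc : HasCompactSupport fun q : ℝ × ℝ => m q.1 q.2)

include hm hc

lemma integrable_osc (u v : ℝ) :
    Integrable fun q : ℝ × ℝ => ch (-(u * q.1 + v * q.2)) * m q.1 q.2 :=
  Continuous.integrable_of_hasCompactSupport (by fun_prop) (hc.mul_left)

lemma osc_eq_snd (u v : ℝ) : osc m u v = ∫ x, ch (-(u * x)) * 𝓕 (m x) v := by
  rw [osc, Measure.volume_eq_prod, integral_prod _ (integrable_osc hm hc u v)]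
  congr 1; ext x
  rw [fourier_eq_ch, ← integral_const_mul]
  congr 1; ext y
  rw [neg_add, ch_add, mul_comm v y]; ring

lemma osc_eq_fst (u v : ℝ) : osc m u v = ∫ y, ch (-(v * y)) * 𝓕 (fun x => m x y) u := by
  rw [osc, Measure.volume_eq_prod, integral_prod_symm _ (integrable_osc hm hc u v)]
  congr 1; ext y
  rw [fourier_eq_ch, ← integral_const_mul]
  congr 1; ext x
  rw [neg_add, ch_add, mul_comm u x]; ring

omit hm hc in
lemma norm_osc_le (u v : ℝ) : ‖osc m u v‖ ≤ ∫ q : ℝ × ℝ, ‖m q.1 q.2‖ := by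
  rw [osc]
  refine (norm_integral_le_integral_norm _).trans_eq ?_
  simp

lemma continuous_osc : Continuous fun z : ℝ × ℝ => osc m z.1 z.2 := by
  unfold osc
  refine continuous_of_dominated (bound := fun q => ‖m q.1 q.2‖) (fun z => ?_) (fun z => ?_)
    (hm.integrable_of_hasCompactSupport hc).norm ?_
  · exact Continuous.aestronglyMeasurable (by fun_prop)
  · exact Filter.Eventually.of_forall fun x => by simp
  · exact Filter.Eventually.of_forall fun x => by fun_prop

end osc

section parts

variable {m m' : ℝ → ℝ → ℂ} (hm : Continuous fun q : ℝ × ℝ => m q.1 q.2)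
  (hc : HasCompactSupport fun q : ℝ × ℝ => m q.1 q.2)
  (hm' : Continuous fun q : ℝ × ℝ => m' q.1 q.2)
  (hc' : HasCompactSupport fun q : ℝ × ℝ => m' q.1 q.2)

include hm hc hm' hc'

lemma osc_of_hasDerivAt_fst (hd : ∀ x y, HasDerivAt (fun t => m t y) (m' x y) x) (u v : ℝ) :
    2 * π * Complex.I * u * osc m u v = osc m' u v := by
  rw [osc_eq_fst hm hc, osc_eq_fst hm' hc', ← integral_const_mul]
  congr 1; ext y
  have hd' : deriv (fun x => m x y) = fun x => m' x y := funext fun x => (hd x y).deriv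
  have hp : Continuous fun x : ℝ => (x, y) := by fun_prop
  have hF := congrFun (Real.fourier_deriv (f := fun x => m x y)
    ((hm.comp hp).integrable_of_hasCompactSupport (HasCompactSupport.slice_fst hc y))
    (fun x => (hd x y).differentiableAt)
    (by rw [hd']
        exact (hm'.comp hp).integrable_of_hasCompactSupport (HasCompactSupport.slice_fst hc' y))) u
  rw [hd'] at hF
  rw [hF, smul_eq_mul]; ring

lemma osc_of_hasDerivAt_snd (hd : ∀ x y, HasDerivAt (m x) (m' x y) y) (u v : ℝ) :
    2 * π * Complex.I * v * osc m u v = osc m' u v := by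
  rw [osc_eq_snd hm hc, osc_eq_snd hm' hc', ← integral_const_mul]
  congr 1; ext x
  have hd' : deriv (m x) = m' x := funext fun y => (hd x y).deriv
  have hp : Continuous fun y : ℝ => (x, y) := by fun_prop
  have hF := congrFun (Real.fourier_deriv (f := m x)
    ((hm.comp hp).integrable_of_hasCompactSupport (HasCompactSupport.slice_snd hc x))
    (fun y => (hd x y).differentiableAt)
    (by rw [hd']
        exact (hm'.comp hp).integrable_of_hasCompactSupport (HasCompactSupport.slice_snd hc' x))) v
  rw [hd'] at hF
  rw [hF, smul_eq_mul]; ring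

lemma osc_add (u v : ℝ) : osc m u v + osc m' u v = osc (fun x y => m x y + m' x y) u v := by
  unfold osc
  rw [← integral_add (integrable_osc hm hc u v) (integrable_osc hm' hc' u v)]
  congr 1; ext q
  rw [mul_add]

end parts

lemma TestFn.hasDerivAt_mul_fst {W ψ : ℝ → ℝ → ℂ} (hW : TestFn W)
    (hψ : ContDiffOn ℝ 1 (fun q : ℝ × ℝ => ψ q.1 q.2) puncturedPlane) (x y : ℝ) :
    HasDerivAt (fun t => W t y * ψ t y) (_root_.pd1 W x y * ψ x y + W x y * _root_.pd1 ψ x y) x := by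
  have h1 : HasDerivAt (fun t => W t y) (_root_.pd1 W x y) x :=
    (hasDerivAt_slice_fst (hW.smooth.differentiable (by simp) _)).differentiableAt.hasDerivAt
  by_cases hq : ((x, y) : ℝ × ℝ) = 0
  · obtain ⟨r, R, hr, h⟩ := hW.vanish
    obtain ⟨r', R', hr', h'⟩ := hW.pd1.vanish
    have e1 : W x y = 0 := h (x, y) (Or.inl (by simpa [hq] using hr))
    have e2 : _root_.pd1 W x y = 0 := h' (x, y) (Or.inl (by simpa [hq] using hr'))
    rw [e1, e2, zero_mul, zero_mul, add_zero]
    refine (hasDerivAt_const x (0 : ℂ)).congr_of_eventuallyEq ?_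
    have hc : Continuous fun t : ℝ => ‖(t, y)‖ := by fun_prop
    filter_upwards [hc.continuousAt.eventually_lt continuousAt_const
      (show ‖(x, y)‖ < r by rw [hq, norm_zero]; exact hr)] with t ht
    rw [h (t, y) (Or.inl ht), zero_mul]
  · have h2 : HasDerivAt (fun t => ψ t y) (_root_.pd1 ψ x y) x :=
      (hasDerivAt_slice_fst ((hψ.differentiableOn (by simp)).differentiableAt
        (isOpen_puncturedPlane.mem_nhds hq))).differentiableAt.hasDerivAt
    exact h1.mul h2

lemma TestFn.hasDerivAt_mul_snd {W ψ : ℝ → ℝ → ℂ} (hW : TestFn W)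
    (hψ : ContDiffOn ℝ 1 (fun q : ℝ × ℝ => ψ q.1 q.2) puncturedPlane) (x y : ℝ) :
    HasDerivAt (fun t => W x t * ψ x t) (_root_.pd2 W x y * ψ x y + W x y * _root_.pd2 ψ x y) y := by
  have h1 : HasDerivAt (fun t => W x t) (_root_.pd2 W x y) y :=
    (hasDerivAt_slice_snd (hW.smooth.differentiable (by simp) _)).differentiableAt.hasDerivAt
  by_cases hq : ((x, y) : ℝ × ℝ) = 0
  · obtain ⟨r, R, hr, h⟩ := hW.vanish
    obtain ⟨r', R', hr', h'⟩ := hW.pd2.vanish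
    have e1 : W x y = 0 := h (x, y) (Or.inl (by simpa [hq] using hr))
    have e2 : _root_.pd2 W x y = 0 := h' (x, y) (Or.inl (by simpa [hq] using hr'))
    rw [e1, e2, zero_mul, zero_mul, add_zero]
    refine (hasDerivAt_const y (0 : ℂ)).congr_of_eventuallyEq ?_
    have hc : Continuous fun t : ℝ => ‖(x, t)‖ := by fun_prop
    filter_upwards [hc.continuousAt.eventually_lt continuousAt_const
      (show ‖(x, y)‖ < r by rw [hq, norm_zero]; exact hr)] with t ht
    rw [h (x, t) (Or.inl ht), zero_mul]
  · have h2 : HasDerivAt (fun t => ψ x t) (_root_.pd2 ψ x y) y :=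
      (hasDerivAt_slice_snd ((hψ.differentiableOn (by simp)).differentiableAt
        (isOpen_puncturedPlane.mem_nhds hq))).differentiableAt.hasDerivAt
    exact h1.mul h2

lemma TestFn.osc_pd1 {W ψ : ℝ → ℝ → ℂ} (hW : TestFn W)
    (hψ : ContDiffOn ℝ 1 (fun q : ℝ × ℝ => ψ q.1 q.2) puncturedPlane) (u v : ℝ) :
    2 * π * Complex.I * u * osc (fun x y => W x y * ψ x y) u v =
      osc (fun x y => _root_.pd1 W x y * ψ x y) u v + osc (fun x y => W x y * _root_.pd1 ψ x y) u v := by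
  have hψ0 := hψ.continuousOn
  have hψ1 : ContinuousOn (fun q : ℝ × ℝ => _root_.pd1 ψ q.1 q.2) puncturedPlane :=
    (contDiffOn_pd1 (k := 0) (by simp) isOpen_puncturedPlane hψ).continuousOn
  have c0 := hW.continuous_mul hψ0
  have c1 := hW.pd1.continuous_mul hψ0
  have c2 := hW.continuous_mul hψ1
  have s0 := hW.hasCompactSupport_mul ψ
  have s1 := hW.pd1.hasCompactSupport_mul ψ
  have s2 := hW.hasCompactSupport_mul (_root_.pd1 ψ)
  rw [osc_add (m := fun x y => _root_.pd1 W x y * ψ x y)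
    (m' := fun x y => W x y * _root_.pd1 ψ x y) c1 s1 c2 s2]
  exact osc_of_hasDerivAt_fst (m := fun x y => W x y * ψ x y)
    (m' := fun x y => _root_.pd1 W x y * ψ x y + W x y * _root_.pd1 ψ x y)
    c0 s0 (c1.add c2) (s1.add s2) (hW.hasDerivAt_mul_fst hψ) u v

lemma TestFn.osc_pd2 {W ψ : ℝ → ℝ → ℂ} (hW : TestFn W)
    (hψ : ContDiffOn ℝ 1 (fun q : ℝ × ℝ => ψ q.1 q.2) puncturedPlane) (u v : ℝ) :
    2 * π * Complex.I * v * osc (fun x y => W x y * ψ x y) u v =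
      osc (fun x y => _root_.pd2 W x y * ψ x y) u v + osc (fun x y => W x y * _root_.pd2 ψ x y) u v := by
  have hψ0 := hψ.continuousOn
  have hψ1 : ContinuousOn (fun q : ℝ × ℝ => _root_.pd2 ψ q.1 q.2) puncturedPlane :=
    (contDiffOn_pd2 (k := 0) (by simp) isOpen_puncturedPlane hψ).continuousOn
  have c0 := hW.continuous_mul hψ0
  have c1 := hW.pd2.continuous_mul hψ0
  have c2 := hW.continuous_mul hψ1
  have s0 := hW.hasCompactSupport_mul ψ
  have s1 := hW.pd2.hasCompactSupport_mul ψ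
  have s2 := hW.hasCompactSupport_mul (_root_.pd2 ψ)
  rw [osc_add (m := fun x y => _root_.pd2 W x y * ψ x y)
    (m' := fun x y => W x y * _root_.pd2 ψ x y) c1 s1 c2 s2]
  exact osc_of_hasDerivAt_snd (m := fun x y => W x y * ψ x y)
    (m' := fun x y => _root_.pd2 W x y * ψ x y + W x y * _root_.pd2 ψ x y)
    c0 s0 (c1.add c2) (s1.add s2) (hW.hasDerivAt_mul_snd hψ) u v

lemma IsSym.nonneg {A : ℝ} {φ : ℝ → ℝ → ℂ} (hφ : IsSym A φ) : 0 ≤ A :=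
  le_trans (by positivity) (hφ.bound 0 0 (by norm_num) 1 0 (by simp))

lemma norm_le_sqrt_add_sq (x y : ℝ) : ‖((x, y) : ℝ × ℝ)‖ ≤ √(x ^ 2 + y ^ 2) := by
  rw [Prod.norm_mk, max_le_iff, Real.norm_eq_abs, Real.norm_eq_abs]
  exact ⟨Real.abs_le_sqrt (by nlinarith [sq_nonneg y]), Real.abs_le_sqrt (by nlinarith [sq_nonneg x])⟩

lemma TestFn.exists_norm_osc_le {W : ℝ → ℝ → ℂ} (hW : TestFn W) (a b : ℕ) (hab : a + b ≤ 7) :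
    ∃ C : ℝ, ∀ A φ, IsSym A φ → ∀ u v,
      ‖osc (fun x y => W x y * mpd a b φ x y) u v‖ ≤ C * A := by
  obtain ⟨r, R, hr, h⟩ := hW.vanish
  have hWi : Integrable fun q : ℝ × ℝ => W q.1 q.2 := by
    refine hW.smooth.continuous.integrable_of_hasCompactSupport ?_
    simpa using hW.hasCompactSupport_mul (fun _ _ => 1)
  refine ⟨(r ^ (a + b))⁻¹ * ∫ q : ℝ × ℝ, ‖W q.1 q.2‖, fun A φ hφ u v => ?_⟩
  refine (norm_osc_le _ _).trans ?_
  have hc := hW.continuous_mul (hφ.contDiffOn_mpd a b 0 (by omega)).continuousOn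
  have hs := hW.hasCompactSupport_mul (mpd a b φ)
  calc ∫ q : ℝ × ℝ, ‖W q.1 q.2 * mpd a b φ q.1 q.2‖
      ≤ ∫ q : ℝ × ℝ, ((r ^ (a + b))⁻¹ * A) * ‖W q.1 q.2‖ := by
        refine integral_mono (hc.integrable_of_hasCompactSupport hs).norm
          (hWi.norm.const_mul _) fun q => ?_
        obtain ⟨x, y⟩ := q
        dsimp only
        rw [norm_mul, mul_comm]
        by_cases hq : ‖((x, y) : ℝ × ℝ)‖ < r
        · rw [h (x, y) (Or.inl hq)]; simp
        · refine mul_le_mul_of_nonneg_right ?_ (norm_nonneg _)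
          have hq0 : (x, y) ≠ ((0 : ℝ), (0 : ℝ)) := by
            rintro e
            rw [e] at hq
            exact hq (by simpa using hr)
          have h1 := hφ.bound a b hab x y hq0
          have h2 : r ^ (a + b) ≤ √(x ^ 2 + y ^ 2) ^ (a + b) :=
            pow_le_pow_left₀ hr.le ((not_lt.1 hq).trans (norm_le_sqrt_add_sq x y)) _
          rw [le_inv_mul_iff₀ (by positivity)]
          exact (mul_le_mul_of_nonneg_right h2 (norm_nonneg _)).trans h1
    _ = _ := by rw [integral_const_mul]; ring

lemma norm_two_pi_I_mul (u : ℝ) (z : ℂ) : |u| * ‖z‖ ≤ ‖2 * π * Complex.I * u * z‖ := by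
  rw [norm_mul]
  refine mul_le_mul_of_nonneg_right ?_ (norm_nonneg _)
  simp only [norm_mul, Complex.norm_ofNat, Complex.norm_real, Complex.norm_I, mul_one,
    Real.norm_eq_abs, abs_of_pos Real.pi_pos]
  nlinarith [Real.pi_gt_three, abs_nonneg u]

lemma exists_pow_mul_norm_osc_le_fst (n : ℕ) : ∀ {W : ℝ → ℝ → ℂ}, TestFn W → ∀ a b : ℕ,
    a + b + n ≤ 7 → ∃ C : ℝ, ∀ A φ, IsSym A φ → ∀ u v,
      |u| ^ n * ‖osc (fun x y => W x y * mpd a b φ x y) u v‖ ≤ C * A := by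
  induction n with
  | zero => intro W hW a b hab; simpa using hW.exists_norm_osc_le a b hab
  | succ n ih =>
    intro W hW a b hab
    obtain ⟨C₁, h₁⟩ := ih hW.pd1 a b (by omega)
    obtain ⟨C₂, h₂⟩ := ih hW (a + 1) b (by omega)
    refine ⟨C₁ + C₂, fun A φ hφ u v => ?_⟩
    have e := hW.osc_pd1 (hφ.contDiffOn_mpd a b 1 (by omega)) u v
    have e' : mpd (a + 1) b φ = pd1 (mpd a b φ) := by
      simp [mpd, Function.iterate_succ_apply']
    have h₂' := h₂ A φ hφ u v
    rw [e'] at h₂'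
    calc _ = |u| ^ n * (|u| * ‖osc (fun x y => W x y * mpd a b φ x y) u v‖) := by ring
      _ ≤ |u| ^ n * ‖2 * π * Complex.I * u * osc (fun x y => W x y * mpd a b φ x y) u v‖ := by
        gcongr; exact norm_two_pi_I_mul _ _
      _ ≤ |u| ^ n * (‖osc (fun x y => pd1 W x y * mpd a b φ x y) u v‖
          + ‖osc (fun x y => W x y * pd1 (mpd a b φ) x y) u v‖) := by
        rw [e]; gcongr; exact norm_add_le _ _
      _ ≤ _ := by
        rw [mul_add, add_mul]
        exact add_le_add (h₁ A φ hφ u v) h₂'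

lemma exists_pow_mul_norm_osc_le (k n : ℕ) : ∀ {W : ℝ → ℝ → ℂ}, TestFn W → ∀ b : ℕ,
    b + k + n ≤ 7 → ∃ C : ℝ, ∀ A φ, IsSym A φ → ∀ u v,
      |v| ^ k * |u| ^ n * ‖osc (fun x y => W x y * mpd 0 b φ x y) u v‖ ≤ C * A := by
  induction k with
  | zero =>
    intro W hW b hb
    simpa using exists_pow_mul_norm_osc_le_fst n hW 0 b (by omega)
  | succ k ih =>
    intro W hW b hb
    obtain ⟨C₁, h₁⟩ := ih hW.pd2 b (by omega)
    obtain ⟨C₂, h₂⟩ := ih hW (b + 1) (by omega)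
    refine ⟨C₁ + C₂, fun A φ hφ u v => ?_⟩
    have e := hW.osc_pd2 (hφ.contDiffOn_mpd 0 b 1 (by omega)) u v
    have e' : mpd 0 (b + 1) φ = pd2 (mpd 0 b φ) := by
      simp [mpd, Function.iterate_succ_apply']
    have h₂' := h₂ A φ hφ u v
    rw [e'] at h₂'
    calc _ = |v| ^ k * |u| ^ n * (|v| * ‖osc (fun x y => W x y * mpd 0 b φ x y) u v‖) := by ring
      _ ≤ |v| ^ k * |u| ^ n *
          ‖2 * π * Complex.I * v * osc (fun x y => W x y * mpd 0 b φ x y) u v‖ := by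
        gcongr; exact norm_two_pi_I_mul _ _
      _ ≤ |v| ^ k * |u| ^ n * (‖osc (fun x y => pd2 W x y * mpd 0 b φ x y) u v‖
          + ‖osc (fun x y => W x y * pd2 (mpd 0 b φ) x y) u v‖) := by
        rw [e]; gcongr; exact norm_add_le _ _
      _ ≤ _ := by
        rw [mul_add, add_mul]
        exact add_le_add (h₁ A φ hφ u v) h₂'

lemma one_add_abs_mul_le (t : ℝ) : (1 + |t|) * (1 + t ^ 2) ≤ 4 * (1 + |t| ^ 3) := by
  rw [← sq_abs t]
  have := abs_nonneg t
  nlinarith [mul_nonneg this (sq_nonneg (|t| - 1)), sq_nonneg (|t| - 1),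
    mul_nonneg (add_nonneg zero_le_one this) (sq_nonneg (|t| - 1))]

lemma one_add_sq_mul_le (t : ℝ) : (1 + t ^ 2) * (1 + t ^ 2) ≤ 4 * (1 + |t| ^ 4) := by
  have : |t| ^ 4 = t ^ 4 := by
    rw [show 4 = 2 * 2 by norm_num, pow_mul, pow_mul, sq_abs]
  rw [this]
  nlinarith [sq_nonneg (t ^ 2 - 1)]

lemma TestFn.exists_decay {W : ℝ → ℝ → ℂ} (hW : TestFn W) :
    ∃ C : ℝ, 0 ≤ C ∧ ∀ A φ, IsSym A φ → ∀ u v,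
      (1 + |u|) * (1 + v ^ 2) * ‖osc (fun x y => W x y * φ x y) u v‖ ≤
          C * A * ((1 + u ^ 2)⁻¹ * (1 + v ^ 2)⁻¹) ∧
      (1 + |v|) * (1 + u ^ 2) * ‖osc (fun x y => W x y * φ x y) u v‖ ≤
          C * A * ((1 + u ^ 2)⁻¹ * (1 + v ^ 2)⁻¹) := by
  obtain ⟨C1, h1⟩ := exists_pow_mul_norm_osc_le 0 0 hW 0 (by norm_num)
  obtain ⟨C2, h2⟩ := exists_pow_mul_norm_osc_le 4 0 hW 0 (by norm_num)
  obtain ⟨C3, h3⟩ := exists_pow_mul_norm_osc_le 0 3 hW 0 (by norm_num)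
  obtain ⟨C4, h4⟩ := exists_pow_mul_norm_osc_le 4 3 hW 0 (by norm_num)
  obtain ⟨C5, h5⟩ := exists_pow_mul_norm_osc_le 3 0 hW 0 (by norm_num)
  obtain ⟨C6, h6⟩ := exists_pow_mul_norm_osc_le 0 4 hW 0 (by norm_num)
  obtain ⟨C7, h7⟩ := exists_pow_mul_norm_osc_le 3 4 hW 0 (by norm_num)
  refine ⟨16 * (|C1| + |C2| + |C3| + |C4| + |C5| + |C6| + |C7|), by positivity,
    fun A φ hφ u v => ?_⟩
  have e : mpd 0 0 φ = φ := rfl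
  have hA := hφ.nonneg
  replace h1 := h1 A φ hφ u v
  replace h2 := h2 A φ hφ u v
  replace h3 := h3 A φ hφ u v
  replace h4 := h4 A φ hφ u v
  replace h5 := h5 A φ hφ u v
  replace h6 := h6 A φ hφ u v
  replace h7 := h7 A φ hφ u v
  rw [e] at h1 h2 h3 h4 h5 h6 h7
  set X := ‖osc (fun x y => W x y * φ x y) u v‖
  have hX : 0 ≤ X := norm_nonneg _
  have l (c : ℝ) : c * A ≤ |c| * A := mul_le_mul_of_nonneg_right (le_abs_self c) hA
  have hl (c : ℝ) : 0 ≤ |c| * A := by positivity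
  rw [← mul_inv, ← div_eq_mul_inv, le_div_iff₀ (by positivity), le_div_iff₀ (by positivity)]
  constructor
  · calc _ = (((1 + |u|) * (1 + u ^ 2)) * ((1 + v ^ 2) * (1 + v ^ 2))) * X := by ring
      _ ≤ ((4 * (1 + |u| ^ 3)) * (4 * (1 + |v| ^ 4))) * X := by
        exact mul_le_mul_of_nonneg_right (mul_le_mul (one_add_abs_mul_le u)
          (one_add_sq_mul_le v) (by positivity) (by positivity)) hX
      _ ≤ _ := by
        linarith [l C1, l C2, l C3, l C4, hl C5, hl C6, hl C7]
  · calc _ = (((1 + |v|) * (1 + v ^ 2)) * ((1 + u ^ 2) * (1 + u ^ 2))) * X := by ring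
      _ ≤ ((4 * (1 + |v| ^ 3)) * (4 * (1 + |u| ^ 4))) * X := by
        exact mul_le_mul_of_nonneg_right (mul_le_mul (one_add_abs_mul_le v)
          (one_add_sq_mul_le u) (by positivity) (by positivity)) hX
      _ ≤ _ := by
        linarith [l C1, l C5, l C6, l C7, hl C2, hl C3, hl C4]

lemma mpd_dilate (s : ℝ) (φ : ℝ → ℝ → ℂ) (a b : ℕ) :
    mpd a b (fun x y => φ (s * x) (s * y)) =
      fun x y => (s : ℂ) ^ (a + b) * mpd a b φ (s * x) (s * y) := by
  induction a with
  | zero =>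
    induction b with
    | zero => simp [mpd]
    | succ b ih =>
      have e (ψ : ℝ → ℝ → ℂ) : mpd 0 (b + 1) ψ = pd2 (mpd 0 b ψ) := by
        simp [mpd, Function.iterate_succ_apply']
      rw [e, ih, e]
      funext x y
      rw [pd2, deriv_const_mul_field, deriv_comp_mul_left s (fun t => mpd 0 b φ (s * x) t) y, pd2,
        Complex.real_smul]
      ring
  | succ a ih =>
    have e (ψ : ℝ → ℝ → ℂ) : mpd (a + 1) b ψ = pd1 (mpd a b ψ) := by
      simp [mpd, Function.iterate_succ_apply']
    rw [e, ih, e]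
    funext x y
    rw [pd1, deriv_const_mul_field, deriv_comp_mul_left s (fun t => mpd a b φ t (s * y)) x, pd1,
      Complex.real_smul]
    ring

lemma IsSym.dilate {A : ℝ} {φ : ℝ → ℝ → ℂ} (hφ : IsSym A φ) {s : ℝ} (hs : 0 < s) :
    IsSym A fun x y => φ (s * x) (s * y) where
  contDiffOn := by
    have : ContDiff ℝ 7 fun q : ℝ × ℝ => ((s * q.1, s * q.2) : ℝ × ℝ) := by fun_prop
    refine hφ.contDiffOn.comp this.contDiffOn fun q hq => ?_
    simp only [puncturedPlane, mem_ofPred_eq, ne_eq, Prod.ext_iff] at hq ⊢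
    simpa [hs.ne'] using hq
  bound a b hab x y hxy := by
    rw [mpd_dilate]
    have := hφ.bound a b hab (s * x) (s * y) (by
      simp only [ne_eq, Prod.ext_iff] at hxy ⊢
      simpa [hs.ne'] using hxy)
    refine le_trans (le_of_eq ?_) this
    rw [norm_mul, norm_pow, Complex.norm_real, Real.norm_eq_abs, abs_of_pos hs,
      show (s * x) ^ 2 + (s * y) ^ 2 = s ^ 2 * (x ^ 2 + y ^ 2) by ring,
      Real.sqrt_mul (sq_nonneg s), Real.sqrt_sq hs.le, mul_pow]
    ring

lemma integrable_weight :
    Integrable fun z : ℝ × ℝ => (1 + z.1 ^ 2)⁻¹ * (1 + z.2 ^ 2)⁻¹ :=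
  integrable_inv_one_add_sq.mul_prod integrable_inv_one_add_sq

lemma integrable_of_decay {c : ℝ → ℝ → ℂ} (hc : Continuous fun z : ℝ × ℝ => c z.1 z.2)
    {D : ℝ} (hD : ∀ u v, ‖c u v‖ ≤ D * ((1 + u ^ 2)⁻¹ * (1 + v ^ 2)⁻¹)) :
    Integrable fun z : ℝ × ℝ => c z.1 z.2 :=
  (integrable_weight.const_mul D).mono' hc.aestronglyMeasurable
    (Filter.Eventually.of_forall fun z => hD z.1 z.2)

lemma eq_integral_osc {m : ℝ → ℝ → ℂ} (hm : Continuous fun q : ℝ × ℝ => m q.1 q.2)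
    (hc : HasCompactSupport fun q : ℝ × ℝ => m q.1 q.2) {D : ℝ}
    (hD : ∀ u v, ‖osc m u v‖ ≤ D * ((1 + u ^ 2)⁻¹ * (1 + v ^ 2)⁻¹)) (ξ η : ℝ) :
    m ξ η = ∫ z : ℝ × ℝ, osc m z.1 z.2 * ch (z.1 * ξ + z.2 * η) := by
  have hcosc := continuous_osc hm hc
  have hslice : ∀ ξ : ℝ, Integrable (m ξ) := fun ξ =>
    (hm.comp (by fun_prop : Continuous fun y : ℝ => (ξ, y))).integrable_of_hasCompactSupport
      (HasCompactSupport.slice_snd hc ξ)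
  have hh : ∀ v ξ, 𝓕 (m ξ) v = ∫ u, ch (u * ξ) * osc m u v := by
    intro v ξ
    have h0 : ∀ x, x ∉ Prod.fst '' tsupport (fun q : ℝ × ℝ => m q.1 q.2) → m x = 0 := by
      intro x hx
      funext y
      by_contra hy
      exact hx ⟨(x, y), subset_tsupport (fun q : ℝ × ℝ => m q.1 q.2) hy, rfl⟩
    have hcont : Continuous fun x => 𝓕 (m x) v := by
      simp_rw [fourier_eq_ch]
      rw [← continuousOn_univ]
      refine continuousOn_integral_of_compact_support
        (hc.isCompact.image continuous_snd) ?_ ?_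
      · refine Continuous.continuousOn ?_
        have : Continuous fun q : ℝ × ℝ => ch (-(q.2 * v)) * m q.1 q.2 := by fun_prop
        exact this
      · intro x y _ hy
        have : m x y = 0 := by
          by_contra h
          exact hy ⟨(x, y), subset_tsupport (fun q : ℝ × ℝ => m q.1 q.2) h, rfl⟩
        rw [this, mul_zero]
    have hsupp : HasCompactSupport fun x => 𝓕 (m x) v := by
      refine HasCompactSupport.intro (hc.isCompact.image continuous_fst) fun x hx => ?_
      rw [h0 x hx, fourier_eq_ch]
      simp
    have hF : 𝓕 (fun x => 𝓕 (m x) v) = fun u => osc m u v := by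
      funext u
      rw [osc_eq_snd hm hc, fourier_eq_ch]
      simp_rw [mul_comm]
    have hint : Integrable fun u => osc m u v := by
      refine (integrable_inv_one_add_sq.const_mul (D * (1 + v ^ 2)⁻¹)).mono'
        (hcosc.comp (by fun_prop : Continuous fun u : ℝ => (u, v))).aestronglyMeasurable
        (Filter.Eventually.of_forall fun u => (hD u v).trans_eq (by ring))
    have := congrFun (hcont.fourierInv_fourier_eq (hcont.integrable_of_hasCompactSupport hsupp)
      (by rw [hF]; exact hint)) ξ
    rw [hF, fourierInv_eq_ch] at this
    rw [← this]
    simp_rw [mul_comm]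
  have hbound : ∀ v, ‖𝓕 (m ξ) v‖ ≤ (D * ∫ u : ℝ, (1 + u ^ 2)⁻¹) * (1 + v ^ 2)⁻¹ := by
    intro v
    rw [hh]
    refine (norm_integral_le_of_norm_le (g := fun u => (D * (1 + v ^ 2)⁻¹) * (1 + u ^ 2)⁻¹)
      (integrable_inv_one_add_sq.const_mul _) (Filter.Eventually.of_forall fun u => ?_)).trans_eq ?_
    · rw [norm_mul, norm_ch, one_mul]
      exact (hD u v).trans_eq (by ring)
    · rw [integral_const_mul]; ring
  have hFi : Integrable (𝓕 (m ξ)) :=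
    (integrable_inv_one_add_sq.const_mul _).mono' (continuous_fourier (hslice ξ)).aestronglyMeasurable
      (Filter.Eventually.of_forall hbound)
  have h1 := congrFun ((hm.comp (by fun_prop : Continuous fun y : ℝ => (ξ, y))).fourierInv_fourier_eq
    (hslice ξ) hFi) η
  have h2 : 𝓕⁻ (𝓕 (m ξ)) η = m ξ η := h1
  have hi : Integrable fun z : ℝ × ℝ => osc m z.1 z.2 * ch (z.1 * ξ + z.2 * η) := by
    refine (integrable_of_decay hcosc hD).norm.mono'
      (Continuous.aestronglyMeasurable (by fun_prop)) (Filter.Eventually.of_forall fun z => by simp)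
  rw [← h2, fourierInv_eq_ch, Measure.volume_eq_prod, integral_prod_symm _ hi]
  congr 1; ext v
  rw [hh, ← integral_const_mul]
  congr 1; ext u
  rw [ch_add, mul_comm η v]; ring_nf

lemma testFn_of_contDiffOn {χ F : ℝ × ℝ → ℝ} (hχ : ContDiff ℝ ∞ χ) {r R : ℝ} (hr : 0 < r)
    (h : ∀ q, (‖q‖ < r ∨ R < ‖q‖) → χ q = 0) (hF : ContDiffOn ℝ ∞ F puncturedPlane) :
    TestFn fun x y => ((χ (x, y) * F (x, y) : ℝ) : ℂ) where
  smooth := by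
    refine Complex.ofRealCLM.contDiff.comp (g := fun t : ℝ => (t : ℂ)) (f := fun q : ℝ × ℝ => χ q * F q) ?_
    refine contDiff_iff_contDiffAt.2 fun q => ?_
    rcases eq_or_ne q 0 with rfl | hq
    · refine (contDiffAt_const (c := (0 : ℝ))).congr_of_eventuallyEq ?_
      filter_upwards [Metric.ball_mem_nhds (0 : ℝ × ℝ) hr] with z hz
      rw [h z (Or.inl (by simpa using hz)), zero_mul]
    · exact hχ.contDiffAt.mul (hF.contDiffAt (isOpen_puncturedPlane.mem_nhds hq))
  vanish := ⟨r, R, hr, fun q hq => by simp [h q hq]⟩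

/-- The quadratic form normalising the partition of the frequency plane. -/
def quartic (q : ℝ × ℝ) : ℝ :=
  q.1 ^ 2 * q.2 ^ 2 + q.1 ^ 2 * (q.1 + q.2) ^ 2 + q.2 ^ 2 * (q.1 + q.2) ^ 2

lemma quartic_pos {q : ℝ × ℝ} (hq : q ≠ 0) : 0 < quartic q := by
  obtain ⟨x, y⟩ := q
  unfold quartic
  dsimp only
  by_cases hx : x = 0
  · have hy : y ≠ 0 := fun hy => hq (by rw [hx, hy]; rfl)
    subst hx
    have : 0 < y ^ 2 := by positivity
    nlinarith
  · have h1 : 0 < x ^ 2 := by positivity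
    by_cases hy : y = 0
    · subst hy; nlinarith
    · have h2 : 0 < y ^ 2 := by positivity
      positivity

/-- The integers in `[-N, N)`. -/
def dyadicIndices (N : ℕ) : Finset ℤ :=
  (Finset.range (2 * N)).map ⟨fun k : ℕ => (k : ℤ) - N, fun a b h => by simpa using h⟩

lemma sum_dyadicIndices (N : ℕ) (f : ℤ → ℝ) :
    ∑ j ∈ dyadicIndices N, f j = ∑ k ∈ Finset.range (2 * N), f ((k : ℤ) - N) := by
  rw [dyadicIndices, Finset.sum_map]; rfl

lemma exists_partition : ∃ (χ W₁ W₂ W₃ : ℝ → ℝ → ℂ) (J : ℕ → Finset ℤ),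
    TestFn W₁ ∧ TestFn W₂ ∧ TestFn W₃ ∧
    (∀ x y, χ x y = gaussD x * gaussD y * W₁ x y + gaussD x * gauss y * gaussD (x + y) * W₂ x y +
      gauss x * gaussD y * gaussD (x + y) * W₃ x y) ∧
    (∀ N x y, ‖∑ j ∈ J N, χ (x / 2 ^ j) (y / 2 ^ j)‖ ≤ 1) ∧
    ∀ x y, ((x, y) : ℝ × ℝ) ≠ 0 →
      Filter.Tendsto (fun N => ∑ j ∈ J N, χ (x / 2 ^ j) (y / 2 ^ j)) Filter.atTop (nhds 1) := by
  let β : ContDiffBump (0 : ℝ × ℝ) := ⟨1, 2, one_pos, one_lt_two⟩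
  have hβ1 : ∀ q : ℝ × ℝ, ‖q‖ ≤ 1 → β q = 1 := fun q hq =>
    β.one_of_mem_closedBall (by simpa using hq)
  have hβ0 : ∀ q : ℝ × ℝ, 2 ≤ ‖q‖ → β q = 0 := fun q hq =>
    β.zero_of_le_dist (by simpa using hq)
  let χ : ℝ × ℝ → ℝ := fun q => β ((1 / 2 : ℝ) • q) - β q
  have hχs : ContDiff ℝ ∞ χ := by
    have h1 : ContDiff ℝ ∞ (β : ℝ × ℝ → ℝ) := β.contDiff
    exact (h1.comp (contDiff_const_smul (1 / 2 : ℝ))).sub h1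
  have hχ0 : ∀ q : ℝ × ℝ, (‖q‖ < 1 ∨ 4 < ‖q‖) → χ q = 0 := by
    intro q hq
    have e : ‖(1 / 2 : ℝ) • q‖ = 1 / 2 * ‖q‖ := by rw [norm_smul]; norm_num
    rcases hq with hq | hq
    · have h0 := norm_nonneg q
      simp only [χ]
      rw [hβ1 q hq.le, hβ1 _ (by rw [e]; linarith), sub_self]
    · simp only [χ]
      rw [hβ0 q (by linarith), hβ0 _ (by rw [e]; linarith), sub_self]
  let F₁ : ℝ × ℝ → ℝ := fun q => q.1 * q.2 * exp (π * (q.1 ^ 2 + q.2 ^ 2)) / quartic q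
  let F₂ : ℝ × ℝ → ℝ := fun q =>
    q.1 * (q.1 + q.2) * exp (π * (q.1 ^ 2 + q.2 ^ 2 + (q.1 + q.2) ^ 2)) / quartic q
  let F₃ : ℝ × ℝ → ℝ := fun q =>
    q.2 * (q.1 + q.2) * exp (π * (q.1 ^ 2 + q.2 ^ 2 + (q.1 + q.2) ^ 2)) / quartic q
  have hD : ∀ q ∈ puncturedPlane, quartic q ≠ 0 := fun q hq => (quartic_pos hq).ne'
  have hDs : ContDiff ℝ ∞ quartic := by unfold quartic; fun_prop
  have hF₁ : ContDiffOn ℝ ∞ F₁ puncturedPlane :=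
    (by fun_prop : ContDiff ℝ ∞ fun q : ℝ × ℝ => q.1 * q.2 * exp (π * (q.1 ^ 2 + q.2 ^ 2))).contDiffOn.div
      hDs.contDiffOn hD
  have hF₂ : ContDiffOn ℝ ∞ F₂ puncturedPlane :=
    (by fun_prop : ContDiff ℝ ∞ fun q : ℝ × ℝ =>
      q.1 * (q.1 + q.2) * exp (π * (q.1 ^ 2 + q.2 ^ 2 + (q.1 + q.2) ^ 2))).contDiffOn.div
      hDs.contDiffOn hD
  have hF₃ : ContDiffOn ℝ ∞ F₃ puncturedPlane :=
    (by fun_prop : ContDiff ℝ ∞ fun q : ℝ × ℝ =>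
      q.2 * (q.1 + q.2) * exp (π * (q.1 ^ 2 + q.2 ^ 2 + (q.1 + q.2) ^ 2))).contDiffOn.div
      hDs.contDiffOn hD
  have hsum : ∀ (N : ℕ) (x y : ℝ),
      ∑ j ∈ dyadicIndices N, χ (x / 2 ^ j, y / 2 ^ j) = β (((2 : ℝ) ^ N)⁻¹ • (x, y)) - β ((2 : ℝ) ^ N • (x, y)) := by
    intro N x y
    have h2 : (2 : ℝ) ≠ 0 := two_ne_zero
    rw [sum_dyadicIndices]
    rw [Finset.sum_congr rfl (g := fun k : ℕ =>
      β (((2 : ℝ) ^ ((k + 1 : ℕ) - N : ℤ))⁻¹ • (x, y)) - β (((2 : ℝ) ^ ((k : ℕ) - N : ℤ))⁻¹ • (x, y)))]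
    · rw [Finset.sum_range_sub (f := fun k : ℕ => β (((2 : ℝ) ^ ((k : ℕ) - N : ℤ))⁻¹ • (x, y)))]
      congr 3
      · congr 1
        rw [show ((2 * N : ℕ) - N : ℤ) = N by push_cast; ring, zpow_natCast]
      · rw [show ((0 : ℕ) - N : ℤ) = -N by simp, zpow_neg, inv_inv, zpow_natCast]
    · intro k _
      have e (t : ℝ) : (1 / 2 : ℝ) * (t / 2 ^ ((k : ℤ) - N)) = ((2 : ℝ) ^ ((k + 1 : ℕ) - N : ℤ))⁻¹ * t := by
        rw [show ((k + 1 : ℕ) - N : ℤ) = ((k : ℤ) - N) + 1 by push_cast; ring, zpow_add₀ h2, zpow_one,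
          mul_inv]
        ring
      simp only [χ, Prod.smul_mk, smul_eq_mul, e]
      simp only [div_eq_inv_mul]
  refine ⟨fun x y => (χ (x, y) : ℂ), _, _, _, dyadicIndices, testFn_of_contDiffOn hχs one_pos hχ0 hF₁,
    testFn_of_contDiffOn hχs one_pos hχ0 hF₂, testFn_of_contDiffOn hχs one_pos hχ0 hF₃, ?_, ?_, ?_⟩
  · intro x y
    simp only [← Complex.ofReal_mul, ← Complex.ofReal_add]
    refine congrArg Complex.ofReal ?_
    rcases eq_or_ne ((x, y) : ℝ × ℝ) 0 with h | h
    · rw [hχ0 (x, y) (Or.inl (by rw [h]; simp))]; simp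
    · have hq := quartic_pos h
      have e1 : exp (π * (x ^ 2 + y ^ 2)) * (exp (-π * x ^ 2) * exp (-π * y ^ 2)) = 1 := by
        rw [← exp_add, ← exp_add, ← exp_zero]; congr 1; ring
      have e2 : exp (π * (x ^ 2 + y ^ 2 + (x + y) ^ 2)) *
          (exp (-π * x ^ 2) * exp (-π * y ^ 2) * exp (-π * (x + y) ^ 2)) = 1 := by
        rw [← exp_add, ← exp_add, ← exp_add, ← exp_zero]; congr 1; ring
      simp only [F₁, F₂, F₃, gaussD, gauss]
      calc χ (x, y) = χ (x, y) * (quartic (x, y) / quartic (x, y)) := by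
            rw [div_self hq.ne', mul_one]
        _ = χ (x, y) * (x ^ 2 * y ^ 2 * 1 + x ^ 2 * (x + y) ^ 2 * 1 + y ^ 2 * (x + y) ^ 2 * 1)
            / quartic (x, y) := by rw [mul_div_assoc]; simp only [mul_one]; rfl
        _ = _ := by
          nth_rw 1 [← e1]
          nth_rw 1 [← e2]
          nth_rw 1 [← e2]
          ring
  · intro N x y
    rw [← Complex.ofReal_sum, Complex.norm_real, hsum, Real.norm_eq_abs, abs_le]
    constructor <;> linarith [β.nonneg' (((2 : ℝ) ^ N)⁻¹ • (x, y)), β.nonneg' ((2 : ℝ) ^ N • (x, y)),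
      β.le_one (x := ((2 : ℝ) ^ N)⁻¹ • (x, y)), β.le_one (x := (2 : ℝ) ^ N • (x, y))]
  · intro x y hxy
    have hpow := tendsto_pow_atTop_atTop_of_one_lt (one_lt_two (α := ℝ))
    have hn : 0 < ‖((x, y) : ℝ × ℝ)‖ := norm_pos_iff.2 hxy
    refine Filter.Tendsto.congr' ?_ tendsto_const_nhds
    filter_upwards [hpow.eventually_ge_atTop (2 / ‖((x, y) : ℝ × ℝ)‖),
      hpow.eventually_ge_atTop ‖((x, y) : ℝ × ℝ)‖] with N h1 h2
    rw [← Complex.ofReal_sum, hsum, hβ1, hβ0]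
    · simp
    · rw [norm_smul, norm_pow, Real.norm_ofNat]
      rwa [div_le_iff₀ hn] at h1
    · rw [norm_smul, norm_inv, norm_pow, Real.norm_ofNat]
      rwa [inv_mul_le_iff₀ (by positivity), mul_one]

lemma band_eq_integral_fourier {s : ℝ} (hs : 0 < s) (u : ℝ) {f : ℝ → ℂ} (hf : Integrable f) (x : ℝ) :
    band s u f x = ∫ ξ, ch (x * ξ) * ((gaussD (ξ / s) : ℂ) * ch (u * (ξ / s)) * 𝓕 f ξ) := by
  have hi : Integrable fun ξ : ℝ => (gaussD (ξ / s) : ℂ) * ch (u * (ξ / s)) := by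
    refine ((integrable_gaussD.comp_div hs.ne').ofReal (𝕜 := ℂ)).mul_bdd (c := 1) ?_
      (Filter.Eventually.of_forall fun x => by simp)
    exact Continuous.aestronglyMeasurable (by fun_prop)
  rw [← fourierInv_eq_ch, fourierInv_mul_fourier hi hf]
  simp_rw [fourierInv_gaussD_dilate hs]
  rfl

lemma avg_eq_integral_fourier {s : ℝ} (hs : 0 < s) (u : ℝ) {f : ℝ → ℂ} (hf : Integrable f) (x : ℝ) :
    avg s u f x = ∫ ξ, ch (x * ξ) * ((gauss (ξ / s) : ℂ) * ch (u * (ξ / s)) * 𝓕 f ξ) := by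
  have hi : Integrable fun ξ : ℝ => (gauss (ξ / s) : ℂ) * ch (u * (ξ / s)) := by
    refine ((integrable_gauss.comp_div hs.ne').ofReal (𝕜 := ℂ)).mul_bdd (c := 1) ?_
      (Filter.Eventually.of_forall fun x => by simp)
    exact Continuous.aestronglyMeasurable (by fun_prop)
  rw [← fourierInv_eq_ch, fourierInv_mul_fourier hi hf]
  simp_rw [fourierInv_gauss_dilate hs]
  rfl

lemma fourier_ker {s : ℝ} (hs : 0 < s) (ζ : ℝ) : 𝓕 (ker s 0) ζ = gaussD (ζ / s) := by
  have e : ker s 0 = 𝓕⁻ fun ξ : ℝ => (gaussD (ξ / s) : ℂ) := by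
    funext z
    rw [← fourierInv_gaussD_dilate hs]
    simp [ch]
  have hi : Integrable fun ξ : ℝ => (gaussD (ξ / s) : ℂ) :=
    (integrable_gaussD.comp_div hs.ne').ofReal
  have hk := (nice_ker hs 0).integrable
  rw [e] at hk
  rw [e, Continuous.fourier_fourierInv_eq (by fun_prop) hi]
  have h2 : 𝓕 (fun ξ : ℝ => (gaussD (ξ / s) : ℂ)) = fun x => 𝓕⁻ (fun ξ : ℝ => (gaussD (ξ / s) : ℂ)) (-x) := by
    funext x; rw [Real.fourierInv_eq_fourier_neg, neg_neg]
  rw [h2]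
  exact hk.comp_neg

lemma integral_ch_mul_integral_ch (a b : ℝ → ℂ) (x : ℝ) :
    (∫ ξ, ch (x * ξ) * a ξ) * (∫ η, ch (x * η) * b η) =
      ∫ q : ℝ × ℝ, ch (x * (q.1 + q.2)) * (a q.1 * b q.2) := by
  rw [← integral_prod_mul]
  congr 1; funext q
  rw [mul_add, ch_add]; ring

lemma integrable_bdd_mul_ch {P b : ℝ × ℝ → ℂ} (hP : Integrable P) (hb : Continuous b) {M : ℝ}
    (hM : ∀ q, ‖b q‖ ≤ M) : Integrable fun q => b q * P q :=
  hP.bdd_mul hb.aestronglyMeasurable (Filter.Eventually.of_forall hM)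

lemma band_integral_ch {s : ℝ} (hs : 0 < s) {P : ℝ × ℝ → ℂ} (hP : Integrable P) (x : ℝ) :
    band s 0 (fun y => ∫ q, ch (y * (q.1 + q.2)) * P q) x =
      ∫ q, ch (x * (q.1 + q.2)) * ((gaussD ((q.1 + q.2) / s) : ℂ) * P q) := by
  have hk := ((nice_ker hs 0).integrable).comp_sub_left x
  have hint : Integrable (Function.uncurry fun (y : ℝ) (q : ℝ × ℝ) =>
      ker s 0 (x - y) * (ch (y * (q.1 + q.2)) * P q)) (volume.prod volume) := by
    have h1 := (hk.mul_prod hP).bdd_mul (f := fun z : ℝ × ℝ × ℝ => ch (z.1 * (z.2.1 + z.2.2))) (c := 1)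
      (Continuous.aestronglyMeasurable (by fun_prop)) (Filter.Eventually.of_forall fun z => by simp)
    refine h1.congr (Filter.Eventually.of_forall fun z => ?_)
    simp only [Function.uncurry]
    ring
  have e : band s 0 (fun y => ∫ q, ch (y * (q.1 + q.2)) * P q) x =
      ∫ y, ∫ q, ker s 0 (x - y) * (ch (y * (q.1 + q.2)) * P q) := by
    rw [band]
    simp_rw [integral_const_mul]
  rw [e, integral_integral_swap hint]
  congr 1; funext q
  rw [← fourier_ker hs, fourier_eq_ch, ← integral_sub_left_eq_self _ volume x, ← mul_assoc,
    ← integral_const_mul, ← integral_mul_const]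
  congr 1; funext y
  rw [show ch ((x - y) * (q.1 + q.2)) = ch (x * (q.1 + q.2)) * ch (-(y * (q.1 + q.2))) by
    rw [← ch_add]; congr 1; ring, sub_sub_cancel]
  ring

lemma integral_synthesis {c H : ℝ × ℝ → ℂ} (hc : Integrable c) (hH : Integrable H) (s : ℝ) :
    Integrable (fun z => c z * ∫ q, ch (z.1 * (q.1 / s) + z.2 * (q.2 / s)) * H q) ∧
    ∫ q, (∫ z, c z * ch (z.1 * (q.1 / s) + z.2 * (q.2 / s))) * H q =
      ∫ z, c z * ∫ q, ch (z.1 * (q.1 / s) + z.2 * (q.2 / s)) * H q := by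
  have hint : Integrable (Function.uncurry fun (z q : ℝ × ℝ) =>
      c z * (ch (z.1 * (q.1 / s) + z.2 * (q.2 / s)) * H q)) (volume.prod volume) := by
    have h1 := (hc.mul_prod hH).bdd_mul
      (f := fun w : (ℝ × ℝ) × (ℝ × ℝ) => ch (w.1.1 * (w.2.1 / s) + w.1.2 * (w.2.2 / s))) (c := 1)
      (Continuous.aestronglyMeasurable (by fun_prop)) (Filter.Eventually.of_forall fun z => by simp)
    refine h1.congr (Filter.Eventually.of_forall fun z => ?_)
    simp only [Function.uncurry]
    ring
  have e : (fun z => c z * ∫ q, ch (z.1 * (q.1 / s) + z.2 * (q.2 / s)) * H q) =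
      fun z => ∫ q, c z * (ch (z.1 * (q.1 / s) + z.2 * (q.2 / s)) * H q) := by
    funext z; rw [integral_const_mul]
  rw [e]
  refine ⟨hint.integral_prod_left, ?_⟩
  rw [integral_integral_swap hint]
  congr 1; funext q
  rw [← integral_mul_const]
  congr 1; funext z
  ring

end CoifmanMeyer

namespace CoifmanMeyer
open Set

/-- A form of Minkowski's integral inequality. -/
lemma lpn_lintegral_le {α : Type*} [MeasureSpace α] [SFinite (volume : Measure α)] {p : ℝ}
    (hp : 1 < p) {G : α → ℝ → ℝ≥0∞} (hG : Measurable (Function.uncurry G)) {w : α → ℝ≥0∞}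
    (hw : Measurable w) (hw0 : ∀ z, w z ≠ 0) (hwt : ∀ z, w z ≠ ∞) {D : ℝ≥0∞}
    (h : ∀ z, lpn p (G z) ≤ D * w z) :
    lpn p (fun x => ∫⁻ z, G z x) ≤ D * ∫⁻ z, w z := by
  have hp0 : 0 < p := by linarith
  have hpq := Real.HolderConjugate.conjExponent hp
  set q := p.conjExponent
  have hq0 : 0 < q := hpq.symm.pos
  have hpq1 : p * (1 / q) = p - 1 := by
    have := hpq.inv_add_inv_eq_one
    field_simp at this ⊢
    linarith
  have hGz : ∀ z, ∫⁻ x, G z x ^ p ≤ D ^ p * w z ^ p := fun z => by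
    have := h z
    rwa [lpn, one_div, ENNReal.rpow_inv_le_iff hp0, ENNReal.mul_rpow_of_nonneg _ _ hp0.le] at this
  have hGm : Measurable fun a : ℝ × α => G a.2 a.1 := hG.comp measurable_swap
  have key : ∀ x, (∫⁻ z, G z x) ^ p ≤
      (∫⁻ z, w z ^ (1 - p) * G z x ^ p) * (∫⁻ z, w z) ^ (p - 1) := fun x => by
    have hx : Measurable fun z => G z x := hG.comp (measurable_id.prodMk measurable_const)
    have e : ∀ z, G z x = (w z ^ (-(1 / q)) * G z x) * w z ^ (1 / q) := fun z => by
      rw [mul_right_comm, ← ENNReal.rpow_add _ _ (hw0 z) (hwt z), neg_add_cancel, ENNReal.rpow_zero,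
        one_mul]
    have H := ENNReal.lintegral_mul_le_Lp_mul_Lq volume hpq
      (f := fun z => w z ^ (-(1 / q)) * G z x) (g := fun z => w z ^ (1 / q))
      ((hw.pow_const _).mul hx).aemeasurable (hw.pow_const _).aemeasurable
    refine (ENNReal.rpow_le_rpow ((lintegral_congr e).trans_le H) hp0.le).trans_eq ?_
    rw [ENNReal.mul_rpow_of_nonneg _ _ hp0.le, ← ENNReal.rpow_mul, ← ENNReal.rpow_mul,
      one_div_mul_cancel hp0.ne', ENNReal.rpow_one, mul_comm (1 / q) p, hpq1]
    congr 1
    · refine lintegral_congr fun z => ?_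
      rw [ENNReal.mul_rpow_of_nonneg _ _ hp0.le, ← ENNReal.rpow_mul, neg_mul, mul_comm (1 / q), hpq1,
        neg_sub]
    · congr 1
      refine lintegral_congr fun z => ?_
      rw [← ENNReal.rpow_mul, one_div_mul_cancel hq0.ne', ENNReal.rpow_one]
  rw [lpn, one_div, ENNReal.rpow_inv_le_iff hp0]
  calc ∫⁻ x, (∫⁻ z, G z x) ^ p
      ≤ ∫⁻ x, (∫⁻ z, w z ^ (1 - p) * G z x ^ p) * (∫⁻ z, w z) ^ (p - 1) := lintegral_mono key
    _ = (∫⁻ x, ∫⁻ z, w z ^ (1 - p) * G z x ^ p) * (∫⁻ z, w z) ^ (p - 1) := by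
        refine lintegral_mul_const _ (Measurable.lintegral_prod_right' (f := fun a : ℝ × α =>
          w a.2 ^ (1 - p) * G a.2 a.1 ^ p) ?_)
        exact ((hw.comp measurable_snd).pow_const _).mul (hGm.pow_const _)
    _ = (∫⁻ z, w z ^ (1 - p) * ∫⁻ x, G z x ^ p) * (∫⁻ z, w z) ^ (p - 1) := by
        congr 1
        rw [lintegral_lintegral_swap]
        · refine lintegral_congr fun z => ?_
          refine lintegral_const_mul _ ?_
          exact (hG.comp (measurable_const.prodMk measurable_id)).pow_const _
        · exact (((hw.comp measurable_snd).pow_const _).mul (hGm.pow_const _)).aemeasurable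
    _ ≤ (∫⁻ z, D ^ p * w z) * (∫⁻ z, w z) ^ (p - 1) := by
        refine mul_le_mul_left (lintegral_mono fun z => ?_) _
        refine (mul_le_mul_right (hGz z) _).trans_eq ?_
        rw [mul_left_comm, ← ENNReal.rpow_add _ _ (hw0 z) (hwt z), sub_add_cancel, ENNReal.rpow_one]
    _ = (D * ∫⁻ z, w z) ^ p := by
        rw [lintegral_const_mul _ hw, ENNReal.mul_rpow_of_nonneg _ _ hp0.le, mul_assoc]
        congr 1
        nth_rw 1 [← ENNReal.rpow_one (∫⁻ z, w z)]
        rw [← ENNReal.rpow_add_of_nonneg _ _ zero_le_one (by linarith), add_sub_cancel]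

lemma lpn_add_le {p : ℝ} (hp : 1 ≤ p) {F G : ℝ → ℝ≥0∞} (hF : Measurable F) (hG : Measurable G) :
    lpn p (fun x => F x + G x) ≤ lpn p F + lpn p G :=
  ENNReal.lintegral_Lp_add_le hF.aemeasurable hG.aemeasurable hp

section measurability

variable {α : Type*} [MeasurableSpace α]

lemma measurable_integral_mul {k h : α → ℝ → ℂ} (hk : Measurable (Function.uncurry k))
    (hh : Measurable (Function.uncurry h)) : Measurable fun a => ∫ y, k a y * h a y :=
  (StronglyMeasurable.integral_prod_right (f := fun a y => k a y * h a y)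
    (hk.mul hh).stronglyMeasurable).measurable

lemma measurable_band {s : ℝ} {u x : α → ℝ} (hu : Measurable u) (hx : Measurable x)
    {h : α → ℝ → ℂ} (hh : Measurable (Function.uncurry h)) :
    Measurable fun a => band s (u a) (h a) (x a) := by
  have hk : Measurable fun b : α × ℝ => ker s (u b.1) (x b.1 - b.2) := by
    have := continuous_gaussD.measurable
    unfold ker
    fun_prop
  exact measurable_integral_mul (k := fun a y => ker s (u a) (x a - y)) hk hh

lemma measurable_avg {s : ℝ} {u x : α → ℝ} (hu : Measurable u) (hx : Measurable x)
    {h : α → ℝ → ℂ} (hh : Measurable (Function.uncurry h)) :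
    Measurable fun a => avg s (u a) (h a) (x a) := by
  have hk : Measurable fun b : α × ℝ => avgKer s (u b.1) (x b.1 - b.2) := by
    have := continuous_gauss.measurable
    unfold avgKer
    fun_prop
  exact measurable_integral_mul (k := fun a y => avgKer s (u a) (x a - y)) hk hh

lemma measurable_paraHH (J : Finset ℤ) {c : J → α → ℂ} (hc : ∀ j, Measurable (c j))
    {u v x : α → ℝ} (hu : Measurable u) (hv : Measurable v) (hx : Measurable x) {f g : ℝ → ℂ}
    (hf : Measurable f) (hg : Measurable g) :
    Measurable fun a => paraHH J (fun j => c j a) (u a) (v a) f g (x a) := by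
  refine Finset.measurable_sum _ fun j _ => (hc j).mul (Measurable.mul ?_ ?_)
  · exact measurable_band (h := fun _ => f) hu hx (hf.comp measurable_snd)
  · exact measurable_band (h := fun _ => g) hv hx (hg.comp measurable_snd)

lemma measurable_paraHL (J : Finset ℤ) {c : J → α → ℂ} (hc : ∀ j, Measurable (c j))
    {u v x : α → ℝ} (hu : Measurable u) (hv : Measurable v) (hx : Measurable x) {f g : ℝ → ℂ}
    (hf : Measurable f) (hg : Measurable g) :
    Measurable fun a => paraHL J (fun j => c j a) (u a) (v a) f g (x a) := by
  refine Finset.measurable_sum _ fun j _ => measurable_band (u := fun _ => 0) measurable_const hx ?_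
  refine ((hc j).comp measurable_fst).mul (Measurable.mul ?_ ?_)
  · exact measurable_band (α := α × ℝ) (h := fun _ => f) (hu.comp measurable_fst) measurable_snd
      (hf.comp measurable_snd)
  · exact measurable_avg (α := α × ℝ) (h := fun _ => g) (hv.comp measurable_fst) measurable_snd
      (hg.comp measurable_snd)

end measurability

end CoifmanMeyer

namespace CoifmanMeyer
open Set
open scoped FourierTransform ContDiff

/-- The Fourier coefficients of a symbol localised by `W` at the scale `s`. -/
noncomputable def locCoeff (W φ : ℝ → ℝ → ℂ) (s : ℝ) (z : ℝ × ℝ) : ℂ :=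
  osc (fun x y => W x y * φ (s * x) (s * y)) z.1 z.2

lemma continuous_locCoeff {W φ : ℝ → ℝ → ℂ} (hW : TestFn W) {A : ℝ} (hφ : IsSym A φ) {s : ℝ}
    (hs : 0 < s) : Continuous (locCoeff W φ s) :=
  continuous_osc (m := fun x y => W x y * φ (s * x) (s * y))
    (hW.continuous_mul (ψ := fun x y => φ (s * x) (s * y)) (hφ.dilate hs).contDiffOn.continuousOn)
    (hW.hasCompactSupport_mul fun x y => φ (s * x) (s * y))

lemma integral_localised {W φ : ℝ → ℝ → ℂ} (hW : TestFn W) {A : ℝ} (hφ : IsSym A φ) {s : ℝ}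
    (hs : 0 < s) {E : ℝ × ℝ → ℂ} (hE : Integrable E) :
    Integrable (fun z => locCoeff W φ s z * ∫ q, ch (z.1 * (q.1 / s) + z.2 * (q.2 / s)) * E q) ∧
    Integrable (fun q => W (q.1 / s) (q.2 / s) * φ q.1 q.2 * E q) ∧
    ∫ q, W (q.1 / s) (q.2 / s) * φ q.1 q.2 * E q =
      ∫ z, locCoeff W φ s z * ∫ q, ch (z.1 * (q.1 / s) + z.2 * (q.2 / s)) * E q := by
  have hφs := hφ.dilate hs
  have hm := hW.continuous_mul (ψ := fun x y => φ (s * x) (s * y)) hφs.contDiffOn.continuousOn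
  have hc := hW.hasCompactSupport_mul fun x y => φ (s * x) (s * y)
  obtain ⟨C, hC, h⟩ := hW.exists_decay
  have hD : ∀ u v, ‖osc (fun x y => W x y * φ (s * x) (s * y)) u v‖ ≤
      C * A * ((1 + u ^ 2)⁻¹ * (1 + v ^ 2)⁻¹) := fun u v => by
    refine le_trans (le_mul_of_one_le_left (norm_nonneg _) ?_) (h A _ hφs u v).1
    exact one_le_mul_of_one_le_of_one_le (by simp) (by nlinarith [sq_nonneg v])
  have hci : Integrable (locCoeff W φ s) := integrable_of_decay
    (c := osc fun x y => W x y * φ (s * x) (s * y)) (continuous_osc hm hc) hD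
  have e : ∀ q : ℝ × ℝ, W (q.1 / s) (q.2 / s) * φ q.1 q.2 =
      ∫ z, locCoeff W φ s z * ch (z.1 * (q.1 / s) + z.2 * (q.2 / s)) := fun q => by
    have := eq_integral_osc (m := fun x y => W x y * φ (s * x) (s * y)) hm hc hD (q.1 / s) (q.2 / s)
    simp only [mul_div_cancel₀ _ hs.ne'] at this
    exact this
  have hS := integral_synthesis hci hE s
  refine ⟨hS.1, ?_, ?_⟩
  · obtain ⟨M, hM⟩ := hm.bounded_above_of_compact_support hc
    have hcont : Continuous fun q : ℝ × ℝ => W (q.1 / s) (q.2 / s) * φ q.1 q.2 := by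
      have := hm.comp (by fun_prop : Continuous fun q : ℝ × ℝ => (q.1 / s, q.2 / s))
      simpa only [Function.comp_def, mul_div_cancel₀ _ hs.ne'] using this
    refine integrable_bdd_mul_ch hE hcont (M := M) fun q => ?_
    have := hM (q.1 / s, q.2 / s)
    simpa only [mul_div_cancel₀ _ hs.ne'] using this
  · rw [← hS.2]
    simp_rw [e]

section scale

variable {s : ℝ} (hs : 0 < s) {f g : ℝ → ℂ} (hf : Integrable f) (hg : Integrable g)
  (hF : Integrable (𝓕 f)) (hG : Integrable (𝓕 g))

include hF in
lemma integrable_gaussD_fourier (u : ℝ) :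
    Integrable fun ξ : ℝ => (gaussD (ξ / s) : ℂ) * ch (u * (ξ / s)) * 𝓕 f ξ :=
  hF.bdd_mul (c := 1) (Continuous.aestronglyMeasurable (by fun_prop))
    (Filter.Eventually.of_forall fun ξ => by
      rw [norm_mul, norm_ch, mul_one, Complex.norm_real]; exact abs_gaussD_le_one _)

include hF in
lemma integrable_gauss_fourier (u : ℝ) :
    Integrable fun ξ : ℝ => (gauss (ξ / s) : ℂ) * ch (u * (ξ / s)) * 𝓕 f ξ :=
  hF.bdd_mul (c := 1) (Continuous.aestronglyMeasurable (by fun_prop))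
    (Filter.Eventually.of_forall fun ξ => by
      rw [norm_mul, norm_ch, mul_one, Complex.norm_real, Real.norm_of_nonneg (gauss_nonneg _)]
      exact gauss_le_one _)

include hs hf hg in
lemma band_mul_band (u v x : ℝ) : band s u f x * band s v g x =
    ∫ q : ℝ × ℝ, ch (u * (q.1 / s) + v * (q.2 / s)) * (ch (x * (q.1 + q.2)) *
      ((gaussD (q.1 / s) : ℂ) * (gaussD (q.2 / s) : ℂ) * (𝓕 f q.1 * 𝓕 g q.2))) := by
  rw [band_eq_integral_fourier hs u hf, band_eq_integral_fourier hs v hg,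
    integral_ch_mul_integral_ch]
  congr 1; funext q
  rw [ch_add (u * (q.1 / s))]; ring

include hs hf hg hF hG in
lemma band_band_mul_avg (u v x : ℝ) : band s 0 (fun y => band s u f y * avg s v g y) x =
    ∫ q : ℝ × ℝ, ch (u * (q.1 / s) + v * (q.2 / s)) * (ch (x * (q.1 + q.2)) *
      ((gaussD (q.1 / s) : ℂ) * (gauss (q.2 / s) : ℂ) * (gaussD ((q.1 + q.2) / s) : ℂ) *
        (𝓕 f q.1 * 𝓕 g q.2))) := by
  simp_rw [band_eq_integral_fourier hs u hf, avg_eq_integral_fourier hs v hg,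
    integral_ch_mul_integral_ch]
  rw [band_integral_ch hs
    ((integrable_gaussD_fourier hF u).mul_prod (integrable_gauss_fourier hG v))]
  congr 1; funext q
  rw [ch_add (u * (q.1 / s))]; ring

include hs hf hg hF hG in
lemma band_avg_mul_band (u v x : ℝ) : band s 0 (fun y => band s v g y * avg s u f y) x =
    ∫ q : ℝ × ℝ, ch (u * (q.1 / s) + v * (q.2 / s)) * (ch (x * (q.1 + q.2)) *
      ((gauss (q.1 / s) : ℂ) * (gaussD (q.2 / s) : ℂ) * (gaussD ((q.1 + q.2) / s) : ℂ) *
        (𝓕 f q.1 * 𝓕 g q.2))) := by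
  simp_rw [mul_comm (band s v g _), band_eq_integral_fourier hs v hg,
    avg_eq_integral_fourier hs u hf, integral_ch_mul_integral_ch]
  rw [band_integral_ch hs
    ((integrable_gauss_fourier hF u).mul_prod (integrable_gaussD_fourier hG v))]
  congr 1; funext q
  rw [ch_add (u * (q.1 / s))]; ring

include hF hG in
lemma integrable_symbol_mul (x : ℝ) {a b c : ℝ × ℝ → ℝ} (ha : Continuous a) (hb : Continuous b)
    (hc : Continuous c) (ha1 : ∀ q, ‖a q‖ ≤ 1) (hb1 : ∀ q, ‖b q‖ ≤ 1) (hc1 : ∀ q, ‖c q‖ ≤ 1) :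
    Integrable fun q : ℝ × ℝ => ch (x * (q.1 + q.2)) *
      ((a q : ℂ) * (b q : ℂ) * (c q : ℂ) * (𝓕 f q.1 * 𝓕 g q.2)) := by
  have hFG := hF.mul_prod hG
  have := integrable_bdd_mul_ch (b := fun q : ℝ × ℝ => ch (x * (q.1 + q.2)) *
      ((a q : ℂ) * (b q : ℂ) * (c q : ℂ))) hFG (by fun_prop) (M := 1) fun q => by
    rw [norm_mul, norm_ch, one_mul, norm_mul, norm_mul, Complex.norm_real, Complex.norm_real,
      Complex.norm_real]
    exact mul_le_one₀ (mul_le_one₀ (ha1 q) (norm_nonneg _) (hb1 q)) (norm_nonneg _) (hc1 q)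
  simpa only [mul_assoc] using this

end scale

/-- The bilinear operator with symbol `φ` localised to the dyadic annulus of size `2 ^ j`. -/
noncomputable def piece (χ φ : ℝ → ℝ → ℂ) (f g : ℝ → ℂ) (j : ℤ) (x : ℝ) : ℂ :=
  ∫ q : ℝ × ℝ, χ (q.1 / 2 ^ j) (q.2 / 2 ^ j) * φ q.1 q.2 *
    (ch (x * (q.1 + q.2)) * (𝓕 f q.1 * 𝓕 g q.2))

section decomposition

variable {χ W₁ W₂ W₃ φ : ℝ → ℝ → ℂ} (hW₁ : TestFn W₁) (hW₂ : TestFn W₂) (hW₃ : TestFn W₃)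
  (hχ : ∀ x y, χ x y = gaussD x * gaussD y * W₁ x y + gaussD x * gauss y * gaussD (x + y) * W₂ x y +
      gauss x * gaussD y * gaussD (x + y) * W₃ x y)
  {A : ℝ} (hφ : IsSym A φ) {f g : ℝ → ℂ} (hf : Integrable f) (hg : Integrable g)
  (hF : Integrable (𝓕 f)) (hG : Integrable (𝓕 g))

include hW₁ hW₂ hW₃ hχ hφ hf hg hF hG

lemma piece_eq (j : ℤ) (x : ℝ) :
    (Integrable fun q : ℝ × ℝ => χ (q.1 / 2 ^ j) (q.2 / 2 ^ j) * φ q.1 q.2 *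
      (ch (x * (q.1 + q.2)) * (𝓕 f q.1 * 𝓕 g q.2))) ∧
    (Integrable fun z : ℝ × ℝ => locCoeff W₁ φ (2 ^ j) z *
      (band (2 ^ j) z.1 f x * band (2 ^ j) z.2 g x)) ∧
    (Integrable fun z : ℝ × ℝ => band (2 ^ j) 0 (fun y => locCoeff W₂ φ (2 ^ j) z *
      (band (2 ^ j) z.1 f y * avg (2 ^ j) z.2 g y)) x) ∧
    (Integrable fun z : ℝ × ℝ => band (2 ^ j) 0 (fun y => locCoeff W₃ φ (2 ^ j) z *
      (band (2 ^ j) z.2 g y * avg (2 ^ j) z.1 f y)) x) ∧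
    piece χ φ f g j x = (∫ z : ℝ × ℝ, locCoeff W₁ φ (2 ^ j) z *
      (band (2 ^ j) z.1 f x * band (2 ^ j) z.2 g x)) +
    (∫ z : ℝ × ℝ, band (2 ^ j) 0 (fun y => locCoeff W₂ φ (2 ^ j) z *
      (band (2 ^ j) z.1 f y * avg (2 ^ j) z.2 g y)) x) +
    ∫ z : ℝ × ℝ, band (2 ^ j) 0 (fun y => locCoeff W₃ φ (2 ^ j) z *
      (band (2 ^ j) z.2 g y * avg (2 ^ j) z.1 f y)) x := by
  have hs : (0 : ℝ) < 2 ^ j := by positivity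
  have hpull : ∀ (c : ℂ) (h : ℝ → ℂ), band (2 ^ j) 0 (fun y => c * h y) x =
      c * band (2 ^ j) 0 h x := fun c h => by
    unfold band
    rw [← integral_const_mul]
    congr 1; funext y; ring
  simp_rw [hpull, band_mul_band hs hf hg, band_band_mul_avg hs hf hg hF hG,
    band_avg_mul_band hs hf hg hF hG]
  have b1 : ∀ t, ‖gaussD t‖ ≤ 1 := abs_gaussD_le_one
  have b2 : ∀ t, ‖gauss t‖ ≤ 1 := fun t => by
    rw [Real.norm_of_nonneg (gauss_nonneg _)]; exact gauss_le_one _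
  have E₁ := integrable_symbol_mul hF hG x (a := fun q => gaussD (q.1 / 2 ^ j))
    (b := fun q => gaussD (q.2 / 2 ^ j)) (c := fun _ => 1) (by fun_prop) (by fun_prop) (by fun_prop)
    (fun _ => b1 _) (fun _ => b1 _) (fun _ => by simp)
  have E₂ := integrable_symbol_mul hF hG x (a := fun q => gaussD (q.1 / 2 ^ j))
    (b := fun q => gauss (q.2 / 2 ^ j)) (c := fun q => gaussD ((q.1 + q.2) / 2 ^ j))
    (by fun_prop) (by fun_prop) (by fun_prop) (fun _ => b1 _) (fun _ => b2 _) (fun _ => b1 _)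
  have E₃ := integrable_symbol_mul hF hG x (a := fun q => gauss (q.1 / 2 ^ j))
    (b := fun q => gaussD (q.2 / 2 ^ j)) (c := fun q => gaussD ((q.1 + q.2) / 2 ^ j))
    (by fun_prop) (by fun_prop) (by fun_prop) (fun _ => b2 _) (fun _ => b1 _) (fun _ => b1 _)
  simp only [Complex.ofReal_one, mul_one] at E₁
  obtain ⟨i1, k1, e1⟩ := integral_localised hW₁ hφ hs E₁
  obtain ⟨i2, k2, e2⟩ := integral_localised hW₂ hφ hs E₂
  obtain ⟨i3, k3, e3⟩ := integral_localised hW₃ hφ hs E₃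
  have hsum : ∀ q : ℝ × ℝ, χ (q.1 / 2 ^ j) (q.2 / 2 ^ j) * φ q.1 q.2 *
      (ch (x * (q.1 + q.2)) * (𝓕 f q.1 * 𝓕 g q.2)) = _ + _ + _ := fun q => by
    rw [hχ, ← add_div, add_mul, add_mul, add_mul, add_mul]
  have k1' := k1.congr (g := fun q => gaussD (q.1 / 2 ^ j) * gaussD (q.2 / 2 ^ j) *
    W₁ (q.1 / 2 ^ j) (q.2 / 2 ^ j) * φ q.1 q.2 * (ch (x * (q.1 + q.2)) * (𝓕 f q.1 * 𝓕 g q.2)))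
    (Filter.Eventually.of_forall fun q => by ring)
  have k2' := k2.congr (g := fun q => gaussD (q.1 / 2 ^ j) * gauss (q.2 / 2 ^ j) *
    gaussD ((q.1 + q.2) / 2 ^ j) * W₂ (q.1 / 2 ^ j) (q.2 / 2 ^ j) * φ q.1 q.2 *
    (ch (x * (q.1 + q.2)) * (𝓕 f q.1 * 𝓕 g q.2)))
    (Filter.Eventually.of_forall fun q => by ring)
  have k3' := k3.congr (g := fun q => gauss (q.1 / 2 ^ j) * gaussD (q.2 / 2 ^ j) *
    gaussD ((q.1 + q.2) / 2 ^ j) * W₃ (q.1 / 2 ^ j) (q.2 / 2 ^ j) * φ q.1 q.2 *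
    (ch (x * (q.1 + q.2)) * (𝓕 f q.1 * 𝓕 g q.2)))
    (Filter.Eventually.of_forall fun q => by ring)
  have k12 := k1'.add k2'
  refine ⟨(k12.add k3').congr (Filter.Eventually.of_forall fun q => (hsum q).symm), i1, i2, i3, ?_⟩
  rw [← e1, ← e2, ← e3, piece]
  simp_rw [hsum]
  refine (integral_add k12 k3').trans ?_
  congr 1
  on_goal 1 => refine (integral_add k1' k2').trans ?_
  · congr 1 <;> (congr 1; funext q; ring)
  · congr 1; funext q; ring

lemma sum_piece_eq (J : Finset ℤ) (x : ℝ) :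
    ∑ j ∈ J, piece χ φ f g j x =
      (∫ z : ℝ × ℝ, paraHH J (fun j => locCoeff W₁ φ (2 ^ (j : ℤ)) z) z.1 z.2 f g x) +
      (∫ z : ℝ × ℝ, paraHL J (fun j => locCoeff W₂ φ (2 ^ (j : ℤ)) z) z.1 z.2 f g x) +
      ∫ z : ℝ × ℝ, paraHL J (fun j => locCoeff W₃ φ (2 ^ (j : ℤ)) z) z.2 z.1 g f x := by
  have h := fun j : ℤ => piece_eq hW₁ hW₂ hW₃ hχ hφ hf hg hF hG j x
  simp only [paraHH, paraHL]
  rw [integral_finsetSum (Finset.univ : Finset J) fun j _ => (h (j : ℤ)).2.1,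
    integral_finsetSum (Finset.univ : Finset J) fun j _ => (h (j : ℤ)).2.2.1,
    integral_finsetSum (Finset.univ : Finset J) fun j _ => (h (j : ℤ)).2.2.2.1,
    ← Finset.sum_add_distrib, ← Finset.sum_add_distrib, ← Finset.sum_coe_sort]
  exact Finset.sum_congr rfl fun j _ => (h (j : ℤ)).2.2.2.2

end decomposition

lemma one_add_enorm (u : ℝ) : 1 + ‖u‖ₑ = ENNReal.ofReal (1 + |u|) := by
  rw [ENNReal.ofReal_add zero_le_one (abs_nonneg u), ENNReal.ofReal_one, ← Real.norm_eq_abs,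
    ofReal_norm]

lemma one_add_enorm_sq (u : ℝ) : 1 + ‖u‖ₑ ^ 2 = ENNReal.ofReal (1 + u ^ 2) := by
  rw [ENNReal.ofReal_add zero_le_one (sq_nonneg u), ENNReal.ofReal_one, ← sq_abs,
    ENNReal.ofReal_pow (abs_nonneg u), ← Real.norm_eq_abs, ofReal_norm]

/-- An integrable weight on the plane. -/
noncomputable def weight (z : ℝ × ℝ) : ℝ≥0∞ := ENNReal.ofReal ((1 + z.1 ^ 2)⁻¹ * (1 + z.2 ^ 2)⁻¹)

lemma measurable_weight : Measurable weight := by unfold weight; fun_prop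

lemma weight_ne_zero (z : ℝ × ℝ) : weight z ≠ 0 := by
  rw [weight, ne_eq, ENNReal.ofReal_eq_zero, not_le]; positivity

lemma lintegral_weight_ne_top : ∫⁻ z, weight z ≠ ⊤ :=
  integrable_weight.lintegral_lt_top.ne

lemma lpn_integral_le {p : ℝ} (hp : 1 < p) {P : ℝ × ℝ → ℝ → ℂ}
    (hP : Measurable (Function.uncurry P)) {D : ℝ≥0∞}
    (h : ∀ z, lpn p (fun x => ‖P z x‖ₑ) ≤ D * weight z) :
    lpn p (fun x => ‖∫ z, P z x‖ₑ) ≤ D * ∫⁻ z, weight z :=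
  (lpn_mono (by linarith) fun _ => enorm_integral_le_lintegral_enorm _).trans
    (lpn_lintegral_le hp (G := fun z x => ‖P z x‖ₑ) hP.enorm measurable_weight weight_ne_zero
      (fun _ => ENNReal.ofReal_ne_top) h)

lemma le_of_decay {ι : Type*} {Φ : (ι → ℂ) → ℝ≥0∞} {C : ℝ≥0} {r B : ℝ} {E : ℝ≥0∞} (hr : 0 < r)
    (h : ∀ (c : ι → ℂ) (M : ℝ≥0), (∀ j, ‖c j‖ₑ ≤ M) → Φ c ≤ C * M * ENNReal.ofReal r * E)
    {c : ι → ℂ} (hc : ∀ j, r * ‖c j‖ ≤ B) : Φ c ≤ C * ENNReal.ofReal B * E := by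
  refine (h c (B / r).toNNReal fun j => ?_).trans_eq ?_
  · rw [← ofReal_norm]
    exact ENNReal.ofReal_le_ofReal ((le_div_iff₀' hr).2 (hc j))
  · rw [mul_assoc (C : ℝ≥0∞), ← ENNReal.ofReal, ← ENNReal.ofReal_mul' hr.le, div_mul_cancel₀ _ hr.ne']

section localised

variable {p p₁ p₂ : ℝ} (hp : 1 < p) (hp₁ : 1 < p₁) (hp₂ : 1 < p₂) (h : 1 / p = 1 / p₁ + 1 / p₂)
  {W : ℝ → ℝ → ℂ} (hW : TestFn W)

include hp hp₁ hp₂ h hW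

lemma exists_lpn_paraHL_locCoeff_le : ∃ D : ℝ≥0, ∀ (A : ℝ) (φ : ℝ → ℝ → ℂ), IsSym A φ →
    ∀ (J : Finset ℤ) (f g : ℝ → ℂ), Nice f → Nice g → ∀ z : ℝ × ℝ,
    lpn p (fun x => ‖paraHL J (fun j => locCoeff W φ (2 ^ (j : ℤ)) z) z.1 z.2 f g x‖ₑ) ≤
      D * ENNReal.ofReal A * (lpn p₁ (fun x => ‖f x‖ₑ) * lpn p₂ (fun x => ‖g x‖ₑ)) * weight z ∧
    lpn p (fun x => ‖paraHL J (fun j => locCoeff W φ (2 ^ (j : ℤ)) z) z.2 z.1 f g x‖ₑ) ≤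
      D * ENNReal.ofReal A * (lpn p₁ (fun x => ‖f x‖ₑ) * lpn p₂ (fun x => ‖g x‖ₑ)) * weight z := by
  obtain ⟨C, hC⟩ := exists_lpn_paraHL_le hp hp₁ hp₂ h
  obtain ⟨K, hK0, hK⟩ := hW.exists_decay
  refine ⟨C * K.toNNReal, fun A φ hφ J f g hf hg z => ?_⟩
  have key : ∀ u v : ℝ, (∀ j : J, (1 + |u|) * (1 + v ^ 2) * ‖locCoeff W φ (2 ^ (j : ℤ)) z‖ ≤
      K * A * ((1 + z.1 ^ 2)⁻¹ * (1 + z.2 ^ 2)⁻¹)) →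
      lpn p (fun x => ‖paraHL J (fun j => locCoeff W φ (2 ^ (j : ℤ)) z) u v f g x‖ₑ) ≤
      (C * K.toNNReal : ℝ≥0) * ENNReal.ofReal A *
        (lpn p₁ (fun x => ‖f x‖ₑ) * lpn p₂ (fun x => ‖g x‖ₑ)) * weight z := fun u v huv => by
    refine (le_of_decay (Φ := fun c => lpn p (fun x => ‖paraHL J c u v f g x‖ₑ)) (C := C)
      (r := (1 + |u|) * (1 + v ^ 2)) (E := lpn p₁ (fun x => ‖f x‖ₑ) * lpn p₂ (fun x => ‖g x‖ₑ))
      (by positivity) (fun c M hc => ?_) huv).trans_eq ?_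
    · have := hC J c M u v f g hc hf hg
      rwa [one_add_enorm, one_add_enorm_sq, ← ENNReal.ofReal_mul (by positivity)] at this
    · rw [ENNReal.ofReal_mul (mul_nonneg hK0 hφ.nonneg), ENNReal.ofReal_mul hK0, ENNReal.coe_mul,
        weight, ← ENNReal.ofReal]
      ring
  exact ⟨key _ _ fun j => (hK A _ (hφ.dilate (by positivity : (0 : ℝ) < 2 ^ (j : ℤ))) z.1 z.2).1,
    key _ _ fun j => (hK A _ (hφ.dilate (by positivity : (0 : ℝ) < 2 ^ (j : ℤ))) z.1 z.2).2⟩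

lemma exists_lpn_paraHH_locCoeff_le : ∃ D : ℝ≥0, ∀ (A : ℝ) (φ : ℝ → ℝ → ℂ), IsSym A φ →
    ∀ (J : Finset ℤ) (f g : ℝ → ℂ), Nice f → Nice g → ∀ z : ℝ × ℝ,
    lpn p (fun x => ‖paraHH J (fun j => locCoeff W φ (2 ^ (j : ℤ)) z) z.1 z.2 f g x‖ₑ) ≤
      D * ENNReal.ofReal A * (lpn p₁ (fun x => ‖f x‖ₑ) * lpn p₂ (fun x => ‖g x‖ₑ)) * weight z := by
  obtain ⟨C, hC⟩ := exists_lpn_paraHH_le hp hp₁ hp₂ h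
  obtain ⟨K, hK0, hK⟩ := hW.exists_decay
  refine ⟨C * (2 * K).toNNReal, fun A φ hφ J f g hf hg z => ?_⟩
  refine (le_of_decay (Φ := fun c => lpn p (fun x => ‖paraHH J c z.1 z.2 f g x‖ₑ)) (C := C)
    (r := (1 + |z.1|) * (1 + |z.2|)) (E := lpn p₁ (fun x => ‖f x‖ₑ) * lpn p₂ (fun x => ‖g x‖ₑ))
    (B := 2 * K * A * ((1 + z.1 ^ 2)⁻¹ * (1 + z.2 ^ 2)⁻¹))
    (by positivity) (fun c M hc => ?_) fun j => ?_).trans_eq ?_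
  · have := hC J c M z.1 z.2 f g hc hf hg
    rwa [one_add_enorm, one_add_enorm, ← ENNReal.ofReal_mul (by positivity)] at this
  · have h1 := (hK A _ (hφ.dilate (by positivity : (0 : ℝ) < 2 ^ (j : ℤ))) z.1 z.2).1
    have h2 : 1 + |z.2| ≤ 2 * (1 + z.2 ^ 2) := by
      rw [← sq_abs]; nlinarith [sq_nonneg (|z.2| - 1)]
    calc (1 + |z.1|) * (1 + |z.2|) * ‖locCoeff W φ (2 ^ (j : ℤ)) z‖
        ≤ (1 + |z.1|) * (2 * (1 + z.2 ^ 2)) * ‖locCoeff W φ (2 ^ (j : ℤ)) z‖ := by gcongr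
      _ = 2 * ((1 + |z.1|) * (1 + z.2 ^ 2) * ‖locCoeff W φ (2 ^ (j : ℤ)) z‖) := by ring
      _ ≤ 2 * (K * A * ((1 + z.1 ^ 2)⁻¹ * (1 + z.2 ^ 2)⁻¹)) := by exact mul_le_mul_of_nonneg_left h1 zero_le_two
      _ = _ := by ring
  · have hK2 : 0 ≤ 2 * K := by positivity
    rw [ENNReal.ofReal_mul (mul_nonneg hK2 hφ.nonneg), ENNReal.ofReal_mul hK2, ENNReal.coe_mul,
      weight, ← ENNReal.ofReal]
    ring

omit hW in
lemma exists_lpn_sum_piece_le {χ W₁ W₂ W₃ : ℝ → ℝ → ℂ} (hW₁ : TestFn W₁) (hW₂ : TestFn W₂)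
    (hW₃ : TestFn W₃) (hχ : ∀ x y, χ x y = gaussD x * gaussD y * W₁ x y +
      gaussD x * gauss y * gaussD (x + y) * W₂ x y +
      gauss x * gaussD y * gaussD (x + y) * W₃ x y) :
    ∃ D : ℝ≥0, ∀ (A : ℝ) (φ : ℝ → ℝ → ℂ), IsSym A φ → ∀ (J : Finset ℤ) (f g : ℝ → ℂ), Nice f →
      Nice g → Integrable (𝓕 f) → Integrable (𝓕 g) →
      lpn p (fun x => ‖∑ j ∈ J, piece χ φ f g j x‖ₑ) ≤
        D * ENNReal.ofReal A * (lpn p₁ (fun x => ‖f x‖ₑ) * lpn p₂ (fun x => ‖g x‖ₑ)) := by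
  obtain ⟨D₁, h₁⟩ := exists_lpn_paraHH_locCoeff_le hp hp₁ hp₂ h hW₁
  obtain ⟨D₂, h₂⟩ := exists_lpn_paraHL_locCoeff_le hp hp₁ hp₂ h hW₂
  obtain ⟨D₃, h₃⟩ := exists_lpn_paraHL_locCoeff_le hp hp₂ hp₁ (h.trans (add_comm _ _)) hW₃
  refine ⟨(D₁ + D₂ + D₃) * (∫⁻ z, weight z).toNNReal, fun A φ hφ J f g hf hg hF hG => ?_⟩
  have hmf := hf.continuous.measurable
  have hmg := hg.continuous.measurable
  have hm : ∀ {W}, TestFn W → ∀ j : J, Measurable fun a : (ℝ × ℝ) × ℝ =>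
      locCoeff W φ (2 ^ (j : ℤ)) a.1 := fun hW j =>
    ((continuous_locCoeff hW hφ (by positivity)).comp continuous_fst).measurable
  have m₁ : Measurable (Function.uncurry fun z : ℝ × ℝ =>
      paraHH J (fun j => locCoeff W₁ φ (2 ^ (j : ℤ)) z) z.1 z.2 f g) := measurable_paraHH J (hm hW₁) (u := fun a => a.1.1) (v := fun a => a.1.2)
    (x := fun a => a.2) (by fun_prop) (by fun_prop) (by fun_prop) hmf hmg
  have m₂ : Measurable (Function.uncurry fun z : ℝ × ℝ =>
      paraHL J (fun j => locCoeff W₂ φ (2 ^ (j : ℤ)) z) z.1 z.2 f g) := measurable_paraHL J (hm hW₂) (u := fun a => a.1.1) (v := fun a => a.1.2)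
    (x := fun a => a.2) (by fun_prop) (by fun_prop) (by fun_prop) hmf hmg
  have m₃ : Measurable (Function.uncurry fun z : ℝ × ℝ =>
      paraHL J (fun j => locCoeff W₃ φ (2 ^ (j : ℤ)) z) z.2 z.1 g f) := measurable_paraHL J (hm hW₃) (u := fun a => a.1.2) (v := fun a => a.1.1)
    (x := fun a => a.2) (by fun_prop) (by fun_prop) (by fun_prop) hmg hmf
  have n : ∀ {P : ℝ × ℝ → ℝ → ℂ}, Measurable (Function.uncurry P) →
      Measurable fun x => ‖∫ z, P z x‖ₑ := fun {P} hP =>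
    (StronglyMeasurable.integral_prod_right' (f := fun a : ℝ × (ℝ × ℝ) => P a.2 a.1)
      (hP.comp measurable_swap).stronglyMeasurable).measurable.enorm
  simp_rw [sum_piece_eq hW₁ hW₂ hW₃ hχ hφ hf.integrable hg.integrable hF hG]
  have hp0 : 0 < p := by linarith
  refine (lpn_mono hp0 fun x => (enorm_add_le _ _).trans
    (add_le_add_left (enorm_add_le _ _) _)).trans ?_
  refine (lpn_add_le hp.le ((n m₁).add (n m₂)) (n m₃)).trans ?_
  refine (add_le_add_left (lpn_add_le hp.le (n m₁) (n m₂)) _).trans ?_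
  refine (add_le_add (add_le_add (lpn_integral_le hp m₁ (h₁ A φ hφ J f g hf hg))
    (lpn_integral_le hp m₂ fun z => (h₂ A φ hφ J f g hf hg z).1))
    (lpn_integral_le hp m₃ fun z => (h₃ A φ hφ J g f hg hf z).2)).trans_eq ?_
  rw [ENNReal.coe_mul, ENNReal.coe_toNNReal lintegral_weight_ne_top, ENNReal.coe_add,
    ENNReal.coe_add]
  ring

end localised

lemma continuous_integral_mul_ch {K : ℝ × ℝ → ℂ} (hK : Integrable K) :
    Continuous fun x : ℝ => ∫ q : ℝ × ℝ, K q * ch (x * (q.1 + q.2)) := by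
  refine continuous_of_dominated (bound := fun q => ‖K q‖) (fun x => ?_)
    (fun x => Filter.Eventually.of_forall fun q => by simp) hK.norm
    (Filter.Eventually.of_forall fun q => by fun_prop)
  exact hK.aestronglyMeasurable.mul (by fun_prop : Continuous fun q : ℝ × ℝ =>
    ch (x * (q.1 + q.2))).aestronglyMeasurable

lemma lpn_le_of_tendsto {p : ℝ} (hp : 0 < p) {T : ℕ → ℝ → ℂ} {U : ℝ → ℂ} {B : ℝ≥0∞}
    (hT : ∀ N, Measurable (T N)) (hB : ∀ N, lpn p (fun x => ‖T N x‖ₑ) ≤ B)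
    (h : ∀ x, Filter.Tendsto (fun N => T N x) Filter.atTop (nhds (U x))) :
    lpn p (fun x => ‖U x‖ₑ) ≤ B := by
  have hB' : ∀ N, ∫⁻ x, ‖T N x‖ₑ ^ p ≤ B ^ p := fun N => by
    have := hB N
    rwa [lpn, one_div, ENNReal.rpow_inv_le_iff hp] at this
  rw [lpn, one_div, ENNReal.rpow_inv_le_iff hp]
  have hU : ∀ x, ‖U x‖ₑ ^ p = Filter.liminf (fun N => ‖T N x‖ₑ ^ p) Filter.atTop := fun x =>
    (((ENNReal.continuous_rpow_const (y := p)).tendsto _).comp (h x).enorm).liminf_eq.symm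
  simp_rw [hU]
  refine (lintegral_liminf_le fun N => (hT N).enorm.pow_const p).trans ?_
  exact Filter.liminf_le_of_le (by isBoundedDefault) fun b hb =>
    let ⟨N, hN⟩ := hb.exists
    hN.trans (hB' N)

lemma ae_ne_zero : ∀ᵐ q : ℝ × ℝ, q ≠ 0 := by
  refine compl_mem_ae_iff.2 ?_
  exact measure_singleton (0 : ℝ × ℝ)

lemma IsSym.aestronglyMeasurable {A : ℝ} {φ : ℝ → ℝ → ℂ} (hφ : IsSym A φ) :
    AEStronglyMeasurable fun q : ℝ × ℝ => φ q.1 q.2 := by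
  have := hφ.contDiffOn.continuousOn.aestronglyMeasurable (μ := volume)
    isOpen_puncturedPlane.measurableSet
  rwa [Measure.restrict_eq_self_of_ae_mem (s := puncturedPlane) ae_ne_zero] at this

lemma IsSym.integrable_mul {A M : ℝ} {φ : ℝ → ℝ → ℂ} (hφ : IsSym A φ)
    (hM : ∀ x y : ℝ, ‖φ x y‖ ≤ M) {F G : ℝ → ℂ} (hF : Integrable F) (hG : Integrable G) :
    Integrable fun q : ℝ × ℝ => φ q.1 q.2 * (F q.1 * G q.2) :=
  (hF.mul_prod hG).bdd_mul hφ.aestronglyMeasurable (Filter.Eventually.of_forall fun _ => hM _ _)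

theorem exists_lpn_multiplier_le {p p₁ p₂ : ℝ} (hp : 1 < p) (hp₁ : 1 < p₁) (hp₂ : 1 < p₂)
    (h : 1 / p = 1 / p₁ + 1 / p₂) : ∃ D : ℝ≥0, ∀ (A M : ℝ) (φ : ℝ → ℝ → ℂ), IsSym A φ →
    (∀ x y : ℝ, ‖φ x y‖ ≤ M) → ∀ (f g : ℝ → ℂ), Nice f → Nice g → Integrable (𝓕 f) →
    Integrable (𝓕 g) →
    lpn p (fun x => ‖∫ q : ℝ × ℝ, φ q.1 q.2 * (𝓕 f q.1 * 𝓕 g q.2) * ch (x * (q.1 + q.2))‖ₑ) ≤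
      D * ENNReal.ofReal A * (lpn p₁ (fun x => ‖f x‖ₑ) * lpn p₂ (fun x => ‖g x‖ₑ)) := by
  obtain ⟨χ, W₁, W₂, W₃, J, hW₁, hW₂, hW₃, hχ, hle, hlim⟩ := exists_partition
  obtain ⟨D, hD⟩ := exists_lpn_sum_piece_le hp hp₁ hp₂ h hW₁ hW₂ hW₃ hχ
  refine ⟨D, fun A M φ hφ hM f g hf hg hF hG => ?_⟩
  have hH := hφ.integrable_mul hM hF hG
  set H : ℝ × ℝ → ℂ := fun q => φ q.1 q.2 * (𝓕 f q.1 * 𝓕 g q.2)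
  set S : ℕ → ℝ × ℝ → ℂ := fun N q => ∑ j ∈ J N, χ (q.1 / 2 ^ j) (q.2 / 2 ^ j) with hS
  have hi : ∀ x (j : ℤ), Integrable fun q : ℝ × ℝ =>
      χ (q.1 / 2 ^ j) (q.2 / 2 ^ j) * H q * ch (x * (q.1 + q.2)) := fun x j =>
    (piece_eq hW₁ hW₂ hW₃ hχ hφ hf.integrable hg.integrable hF hG j x).1.congr
      (Filter.Eventually.of_forall fun q => by simp only [H]; ring)
  have hSH : ∀ N x (q : ℝ × ℝ), S N q * H q * ch (x * (q.1 + q.2)) =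
      ∑ j ∈ J N, χ (q.1 / 2 ^ j) (q.2 / 2 ^ j) * H q * ch (x * (q.1 + q.2)) := fun N x q => by
    rw [hS, Finset.sum_mul, Finset.sum_mul]
  have hSi : ∀ N x, Integrable fun q : ℝ × ℝ => S N q * H q * ch (x * (q.1 + q.2)) := fun N x => by
    simp_rw [hSH]
    exact integrable_finsetSum _ fun j _ => hi x j
  have hT : ∀ N x, ∑ j ∈ J N, piece χ φ f g j x =
      ∫ q : ℝ × ℝ, S N q * H q * ch (x * (q.1 + q.2)) := fun N x => by
    simp_rw [hSH]
    rw [integral_finsetSum _ fun j _ => hi x j]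
    refine Finset.sum_congr rfl fun j _ => ?_
    rw [piece]
    congr 1; funext q
    simp only [H]; ring
  refine lpn_le_of_tendsto (by linarith) (T := fun N x => ∑ j ∈ J N, piece χ φ f g j x)
    (fun N => ?_) (fun N => hD A φ hφ (J N) f g hf hg hF hG) fun x => ?_
  · simp_rw [hT]
    exact (continuous_integral_mul_ch (K := fun q => S N q * H q)
      (by simpa [ch] using hSi N 0)).measurable
  · simp_rw [hT]
    refine tendsto_integral_of_dominated_convergence (fun q => ‖H q‖)
      (fun N => (hSi N x).aestronglyMeasurable) hH.norm
      (fun N => Filter.Eventually.of_forall fun q => ?_) ?_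
    · rw [norm_mul, norm_mul, norm_ch, mul_one]
      exact mul_le_of_le_one_left (norm_nonneg _) (hle N q.1 q.2)
    · filter_upwards [ae_ne_zero] with q hq
      simpa using ((hlim q.1 q.2 hq).mul_const (H q)).mul_const (ch (x * (q.1 + q.2)))

lemma FtR1_eq_fourier (f : ℝ → ℂ) : FtR1 f = 𝓕 f := by
  funext ξ
  rw [fourier_eq_ch, FtR1]
  congr 1; funext x
  rw [ch, mul_comm]
  congr 2; push_cast; ring

lemma nice_schwartz (f : SchwartzMap ℝ ℂ) : Nice (f : ℝ → ℂ) where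
  continuous := f.continuous
  integrable := f.integrable
  bounded := ⟨SchwartzMap.seminorm ℝ 0 0 f, f.norm_le_seminorm ℝ⟩

lemma integrable_fourier_schwartz (f : SchwartzMap ℝ ℂ) : Integrable (𝓕 (f : ℝ → ℂ)) := by
  rw [← SchwartzMap.fourier_coe]
  exact (𝓕 f).integrable

end CoifmanMeyer

/-- **The Coifman–Meyer multiplier theorem on `ℝ`** (the paper's Corollary 4.2 for trivial
Dunkl multiplicity `κ = 0`, with Hörmander order `7`). If `φ : ℝ² → ℂ` is bounded, `C^7` on
`ℝ² ∖ {0}` with `|ξ|^{|α|}|∂^α φ(ξ)| ≤ A` for `|α| ≤ 7`, then the bilinear multiplier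
operator with symbol `φ` maps `L^{p₁} × L^{p₂} → L^p` with norm at most `C·A`. -/
theorem stmt11 (p p₁ p₂ : ℝ) (hp : 1 < p) (hp₁ : 1 < p₁) (hp₂ : 1 < p₂)
    (hppp : 1 / p = 1 / p₁ + 1 / p₂) :
    ∃ C : ℝ, 0 < C ∧
      ∀ (φ : ℝ → ℝ → ℂ) (A : ℝ),
        (∃ M : ℝ, ∀ x y : ℝ, ‖φ x y‖ ≤ M) →
        ContDiffOn ℝ 7 (fun q : ℝ × ℝ => φ q.1 q.2) {q : ℝ × ℝ | q ≠ 0} →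
        (∀ a b : ℕ, a + b ≤ 7 → ∀ x y : ℝ, (x, y) ≠ ((0 : ℝ), (0 : ℝ)) →
          Real.sqrt (x ^ 2 + y ^ 2) ^ (a + b) * ‖mpd a b φ x y‖ ≤ A) →
        ∀ f g : SchwartzMap ℝ ℂ,
          eLpNorm
              (fun x : ℝ => ∫ ξ₁ : ℝ, ∫ ξ₂ : ℝ,
                φ ξ₁ ξ₂ * FtR1 (⇑f) ξ₁ * FtR1 (⇑g) ξ₂ *
                  Complex.exp (2 * Real.pi * Complex.I * (x : ℂ) * ((ξ₁ : ℂ) + (ξ₂ : ℂ))))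
              (ENNReal.ofReal p) volume ≤
            ENNReal.ofReal (C * A) *
              (eLpNorm (⇑f) (ENNReal.ofReal p₁) volume *
                eLpNorm (⇑g) (ENNReal.ofReal p₂) volume) := by
  obtain ⟨D, hD⟩ := CoifmanMeyer.exists_lpn_multiplier_le hp hp₁ hp₂ hppp
  refine ⟨D + 1, by positivity, fun φ A ⟨M, hM⟩ hφ hA f g => ?_⟩
  have hsym : CoifmanMeyer.IsSym A φ := ⟨hφ, hA⟩
  have hF := CoifmanMeyer.integrable_fourier_schwartz f
  have hG := CoifmanMeyer.integrable_fourier_schwartz g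
  have hint : ∀ x : ℝ, (∫ ξ₁ : ℝ, ∫ ξ₂ : ℝ, φ ξ₁ ξ₂ * FtR1 (⇑f) ξ₁ * FtR1 (⇑g) ξ₂ *
      Complex.exp (2 * Real.pi * Complex.I * (x : ℂ) * ((ξ₁ : ℂ) + (ξ₂ : ℂ)))) =
      ∫ q : ℝ × ℝ, φ q.1 q.2 * (FourierTransform.fourier (⇑f) q.1 *
        FourierTransform.fourier (⇑g) q.2) * CoifmanMeyer.ch (x * (q.1 + q.2)) := fun x => by
    have hi := (hsym.integrable_mul hM hF hG).mul_bdd (c := 1)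
      (by fun_prop : Continuous fun q : ℝ × ℝ =>
        CoifmanMeyer.ch (x * (q.1 + q.2))).aestronglyMeasurable
      (Filter.Eventually.of_forall fun q => by simp)
    rw [Measure.volume_eq_prod, integral_prod _ hi]
    simp only [CoifmanMeyer.FtR1_eq_fourier]
    congr 1; funext ξ₁
    congr 1; funext ξ₂
    rw [CoifmanMeyer.ch, mul_assoc (φ ξ₁ ξ₂)]
    congr 2
    push_cast
    ring
  simp_rw [hint]
  rw [CoifmanMeyer.eLpNorm_eq_lpn (by linarith), CoifmanMeyer.eLpNorm_eq_lpn (by linarith),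
    CoifmanMeyer.eLpNorm_eq_lpn (by linarith)]
  refine (hD A M φ hsym hM f g (CoifmanMeyer.nice_schwartz f) (CoifmanMeyer.nice_schwartz g)
    hF hG).trans ?_
  gcongr
  rw [ENNReal.ofReal_mul (by positivity)]
  gcongr
  rw [← ENNReal.ofReal_coe_nnreal]
  exact ENNReal.ofReal_le_ofReal (by linarith)
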